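/- Let g be a Riemannian metric on T² whose geodesic flow has zero topological entropy. Then no lift c: ℝ → ℝ² of a geodesic to the universal covering has a self-intersection, i.e. every lifted geodesic is injective up to equality of parameters: c(t₁) = c(t₂) implies t₁ = t₂. -/

import Mathlib

open Filter Topology Set
open scoped ENNReal

noncomputable section

/-- The Euclidean norm of a point of `ℝ × ℝ` (the universal covering of `T²`). -/
def norm2 (p : ℝ × ℝ) : ℝ := Real.sqrt (p.1 ^ 2 + p.2 ^ 2)

/-- The translation vector of the covering transformation `τ_{(m,n)}` of `T² = ℝ²/ℤ²`. -/
def lat (k : ℤ × ℤ) : ℝ × ℝ := ((k.1 : ℝ), (k.2 : ℝ))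

/-- The transl of a curve in `ℝ²` by the covering transformation `τ_k`. -/
def transl (k : ℤ × ℤ) (c : ℝ → ℝ × ℝ) : ℝ → ℝ × ℝ := fun t => c t + lat k

/-- The asymptotic direction `δ(τ_k)` of the axes of the translation element `τ_k`. -/
def latDir (k : ℤ × ℤ) : ℝ × ℝ := (norm2 (lat k))⁻¹ • lat k

/-- A smooth Riemannian metric on the torus `T² = ℝ²/ℤ²`, described through its lift to the
universal covering `ℝ²`: a smooth family of positive definite symmetric bilinear forms on the
tangent spaces of `ℝ²`, invariant under the deck transformation group `ℤ²`. -/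
structure TorusMetric where
  g : (ℝ × ℝ) → (ℝ × ℝ) → (ℝ × ℝ) → ℝ
  smooth : ContDiff ℝ (⊤ : ℕ∞) fun p : (ℝ × ℝ) × (ℝ × ℝ) × (ℝ × ℝ) => g p.1 p.2.1 p.2.2
  symm : ∀ x v w, g x v w = g x w v
  linear : ∀ x w, IsLinearMap ℝ fun v => g x v w
  posdef : ∀ x v, v ≠ 0 → 0 < g x v v
  periodic : ∀ (k : ℤ × ℤ) (x v w : ℝ × ℝ), g (x + lat k) v w = g x v w

namespace TorusMetric

/-- The Riemannian length of the curve `c` between the parameters `a` and `b`. -/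
def length (M : TorusMetric) (c : ℝ → ℝ × ℝ) (a b : ℝ) : ℝ :=
  ∫ t in a..b, Real.sqrt (M.g (c t) (deriv c t) (deriv c t))

/-- The Riemannian distance on the universal covering `ℝ²` (hence also on `T²`). -/
def dist (M : TorusMetric) (x y : ℝ × ℝ) : ℝ :=
  sInf {L | ∃ c : ℝ → ℝ × ℝ, ContDiff ℝ 1 c ∧ c 0 = x ∧ c 1 = y ∧ L = M.length c 0 1}

/-- A (complete, unit speed) geodesic of the lifted metric on the universal covering `ℝ²`:
a smooth curve with constant unit speed which is locally length minimizing. -/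
def IsGeodesic (M : TorusMetric) (c : ℝ → ℝ × ℝ) : Prop :=
  ContDiff ℝ (⊤ : ℕ∞) c ∧ (∀ t, M.g (c t) (deriv c t) (deriv c t) = 1) ∧
    ∀ t : ℝ, ∃ ε > 0, ∀ s₁ s₂, t - ε ≤ s₁ → s₁ ≤ s₂ → s₂ ≤ t + ε →
      M.dist (c s₁) (c s₂) = M.length c s₁ s₂

end TorusMetric

/-- The distance between two points of the unit tangent bundle `ST²` of the torus; points of
`ST²` are represented by points of the tangent bundle `ℝ² × ℝ²` of the universal covering
(the deck transformations act trivially on the vector component). -/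
def phaseDist (p q : (ℝ × ℝ) × (ℝ × ℝ)) : ℝ :=
  sInf {r : ℝ | ∃ k : ℤ × ℤ, r = norm2 (p.1 - (q.1 + lat k)) + norm2 (p.2 - q.2)}

/-- A `(φ,ε)`-separated set with respect to time `T` for the geodesic flow `φ` of `M` on
`ST²`: a finite family of geodesics (each geodesic `c` representing the phase point
`(c 0, ċ 0) ∈ ST²`, of which `t ↦ (c t, ċ t)` is the flow orbit) such that any two distinct
members satisfy `max_{0 ≤ t ≤ T} d(φᵗ v, φᵗ w) > ε`. -/
def IsSeparated (M : TorusMetric) (ε T : ℝ) (F : Finset (ℝ → ℝ × ℝ)) : Prop :=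
  (∀ c ∈ F, M.IsGeodesic c) ∧
    ∀ c₁ ∈ F, ∀ c₂ ∈ F, c₁ ≠ c₂ →
      ∃ t ∈ Set.Icc (0 : ℝ) T, ε < phaseDist (c₁ t, deriv c₁ t) (c₂ t, deriv c₂ t)

/-- `r_T(φ, ε)`: the maximal cardinality of `(φ,ε)`-separated sets with respect to `T`. -/
def sepCount (M : TorusMetric) (ε T : ℝ) : ℝ≥0∞ :=
  ⨆ (F : Finset (ℝ → ℝ × ℝ)) (_ : IsSeparated M ε T F), (F.card : ℝ≥0∞)

/-- Extended real logarithm of an extended nonnegative real. -/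
def elog (x : ℝ≥0∞) : EReal :=
  if x = 0 then ⊥ else if x = ⊤ then ⊤ else ((Real.log x.toReal : ℝ) : EReal)

/-- Bowen's topological entropy `h_top(g)` of the geodesic flow of `g` on `ST²`:
`lim_{ε → 0} limsup_{T → ∞} (1/T) log r_T(φ,ε)`; since `r_T(φ,ε)` is monotone in `ε`,
the limit `ε → 0` is realized as the supremum over `ε > 0`. -/
def topEnt (M : TorusMetric) : EReal :=
  ⨆ (ε : ℝ) (_ : 0 < ε),
    Filter.limsup (fun T : ℝ => ((T⁻¹ : ℝ) : EReal) * elog (sepCount M ε T)) Filter.atTop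

/-- The forward ray `c⁺` of `c` is escaping: `‖c(t)‖ → ∞` as `t → ∞`. -/
def EscapesForward (c : ℝ → ℝ × ℝ) : Prop :=
  Filter.Tendsto (fun t => norm2 (c t)) Filter.atTop Filter.atTop

/-- The backward ray `c⁻` of `c` is escaping: `‖c(-t)‖ → ∞` as `t → ∞`. -/
def EscapesBackward (c : ℝ → ℝ × ℝ) : Prop :=
  Filter.Tendsto (fun t => norm2 (c (-t))) Filter.atTop Filter.atTop

/-- `z ∈ S¹` is the asymptotic direction `δ(c⁺) = lim_{t → ∞} c(t)/‖c(t)‖` of the forward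
ray of `c`. -/
def HasDirection (c : ℝ → ℝ × ℝ) (z : ℝ × ℝ) : Prop :=
  norm2 z = 1 ∧ Filter.Tendsto (fun t => (norm2 (c t))⁻¹ • c t) Filter.atTop (nhds z)

/-- The canonical projection `π : S¹ → P¹(ℝ) ≅ ℝ ∪ {∞}`, sending `(x, y)` to `y/x` if
`x ≠ 0` and to `∞` otherwise; `ℝ ∪ {∞}` is the one-point compactification of `ℝ`. -/
def projPt (z : ℝ × ℝ) : OnePoint ℝ :=
  if z.1 = 0 then OnePoint.infty else ((z.2 / z.1 : ℝ) : OnePoint ℝ)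

/-- `crossDet v w ≠ 0` expresses transversality of two directions in `ℝ²`. -/
def crossDet (v w : ℝ × ℝ) : ℝ := v.1 * w.2 - v.2 * w.1

/-- The set of points at which the curve `c₁` (restricted to parameters in `D₁`) and the
curve `c₂` (restricted to parameters in `D₂`) intersect transversally. -/
def transInter (c₁ c₂ : ℝ → ℝ × ℝ) (D₁ D₂ : Set ℝ) : Set (ℝ × ℝ) :=
  {x | ∃ s ∈ D₁, ∃ t ∈ D₂, c₁ s = x ∧ c₂ t = x ∧ crossDet (deriv c₁ s) (deriv c₂ t) ≠ 0}

/-- The geodesic `c` is an axis of the (nontrivial) translation element `τ_k`: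
`τ_k c(t) = c(t + ℓ)` for some `ℓ` and all `t`. -/
def IsAxisOf (M : TorusMetric) (c : ℝ → ℝ × ℝ) (k : ℤ × ℤ) : Prop :=
  M.IsGeodesic c ∧ k ≠ 0 ∧ ∃ ℓ : ℝ, ∀ t, c (t + ℓ) = c t + lat k

/-- The geodesic `c` is an axis of some nontrivial translation element. -/
def IsAxis (M : TorusMetric) (c : ℝ → ℝ × ℝ) : Prop := ∃ k : ℤ × ℤ, IsAxisOf M c k

/-- The curve `c` is minimal: each of its segments minimizes the Riemannian length between
its endpoints. -/
def IsMinimal (M : TorusMetric) (c : ℝ → ℝ × ℝ) : Prop :=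
  ∀ s t : ℝ, s ≤ t → M.dist (c s) (c t) = M.length c s t

/-- Equivalence of translation elements: `τ₁^a = τ₂^b` for some nonzero integers `a, b`. -/
def TransEquiv (k₁ k₂ : ℤ × ℤ) : Prop := ∃ a b : ℤ, a ≠ 0 ∧ b ≠ 0 ∧ a • k₁ = b • k₂

/-- A translation element is primitive if it is not a nontrivial power of another
translation element. -/
def IsPrimitive (k : ℤ × ℤ) : Prop := k ≠ 0 ∧ ∀ (j : ℤ × ℤ) (n : ℤ), k = n • j → IsUnit n

/-- The metric `g` on `T²` is flat, i.e. its Gaussian curvature vanishes identically;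
equivalently (by the theorems of Myers–Steenrod and Cartan–Hadamard), the universal covering
`ℝ²` with the induced Riemannian distance is isometric to the Euclidean plane. -/
def IsFlat (M : TorusMetric) : Prop :=
  ∃ F : (ℝ × ℝ) ≃ (ℝ × ℝ), ∀ x y, M.dist x y = norm2 (F x - F y)

/-- A continuous function on a preconnected set whose exponential is constant is constant. -/
theorem eq_of_exp_const {X : Type*} [TopologicalSpace X] {S : Set X} (hS : IsPreconnected S)
    {u : X → ℂ} (hu : ContinuousOn u S) {c : ℂ} (hc : ∀ x ∈ S, Complex.exp (u x) = c)
    {x y : X} (hx : x ∈ S) (hy : y ∈ S) : u x = u y := by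
  have hdisc : DiscreteTopology (Set.range ((↑) : ℤ → ℝ)) :=
    (Int.isClosedEmbedding_coe_real.isEmbedding.toHomeomorph.symm.isEmbedding).discreteTopology
  have key : ∀ z ∈ S, ∃ n : ℤ, u z = u x + n * (2 * Real.pi * Complex.I) := fun z hz =>
    Complex.exp_eq_exp_iff_exists_int.1 ((hc z hz).trans (hc x hx).symm)
  let r : X → ℝ := fun z => ((u z - u x).im) / (2 * Real.pi)
  have hr : ∀ z (n : ℤ), u z = u x + n * (2 * Real.pi * Complex.I) → r z = n := by
    intro z n h
    have : (2 * Real.pi) ≠ 0 := by positivity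
    simp only [r, h]
    field_simp
    simp
    ring
  have hmaps : Set.MapsTo r S (Set.range ((↑) : ℤ → ℝ)) := by
    intro z hz
    obtain ⟨n, hn⟩ := key z hz
    exact ⟨n, (hr z n hn).symm⟩
  have hcont : ContinuousOn r S := by
    have : ContinuousOn (fun z => (u z - u x).im) S :=
      Complex.continuous_im.comp_continuousOn (hu.sub continuousOn_const)
    exact this.div_const _
  have h1 := hS.constant_of_mapsTo (T := Set.range ((↑) : ℤ → ℝ)) ⟨hdisc⟩ hcont hmaps hx hy
  obtain ⟨n, hn⟩ := key y hy
  have h2 := hr y n hn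
  have h3 : r x = 0 := by simp [r]
  rw [h3, h2] at h1
  have : (n : ℤ) = 0 := by exact_mod_cast h1.symm
  rw [hn, this]; simp

/-- Logarithms of continuous nonvanishing functions on simply connected spaces. -/
theorem exists_continuous_log {A : Type*} [TopologicalSpace A] [SimplyConnectedSpace A]
    [LocallyPathConnectedSpace A] (f : A → ℂ) (hf : Continuous f) (h0 : ∀ a, f a ≠ 0) :
    ∃ L : A → ℂ, Continuous L ∧ ∀ a, Complex.exp (L a) = f a := by
  obtain ⟨a₀⟩ : Nonempty A := inferInstance
  obtain ⟨F, ⟨-, hF⟩, -⟩ := Complex.isCoveringMapOn_exp.existsUnique_continuousMap_lifts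
    ⟨f, hf⟩ (a₀ := a₀) (e₀ := Complex.log (f a₀)) (Complex.exp_log (h0 a₀)) (by simpa using h0)
  exact ⟨F, F.continuous, fun a => congrFun hF a⟩

theorem chord_lemma_complex (α : ℝ → ℂ) (hα : Continuous α) {L : ℝ} (hL : 0 ≤ L) {v : ℂ}
    (h : α L = α 0 + 2 * v) :
    ∃ s t, 0 ≤ s ∧ s ≤ t ∧ t ≤ L ∧ α t = α s + v := by
  by_contra hcon
  push Not at hcon
  let cl : ℝ → ℝ := fun s => max 0 (min s L)
  have hcl : Continuous cl := by fun_prop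
  have hcl0 : ∀ s, 0 ≤ cl s := fun s => le_max_left _ _
  have hclL : ∀ s, cl s ≤ L := fun s => max_le hL (min_le_right _ _)
  have hclid : ∀ s, 0 ≤ s → s ≤ L → cl s = s := fun s h0 h1 => by
    simp [cl, min_eq_left h1, max_eq_right h0]
  let G : ℝ × ℝ → ℂ := fun p => α (max (cl p.1) (cl p.2)) - α (min (cl p.1) (cl p.2)) - v
  have hG : Continuous G := by fun_prop
  have hG0 : ∀ p, G p ≠ 0 := by
    intro p hp
    refine hcon (min (cl p.1) (cl p.2)) (max (cl p.1) (cl p.2)) (le_min (hcl0 _) (hcl0 _))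
      min_le_max (max_le (hclL _) (hclL _)) ?_
    simp only [G] at hp
    linear_combination hp
  obtain ⟨Λ, hΛ, hexp⟩ := exists_continuous_log G hG hG0
  have hdiag : Λ (0, 0) = Λ (L, L) := by
    refine eq_of_exp_const (u := fun s => Λ (s, s)) (c := -v) (S := univ) isPreconnected_univ
      (by fun_prop) ?_ (mem_univ 0) (mem_univ L)
    intro s _
    rw [hexp]
    simp [G]
  have hside : Λ (0, L) - Λ (0, 0) = Λ (L, L) - Λ (0, L) := by
    refine eq_of_exp_const (u := fun s => Λ (s, L) - Λ (0, s)) (c := -1) (S := Icc 0 L)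
      isPreconnected_Icc (by fun_prop) ?_ (left_mem_Icc.2 hL) (right_mem_Icc.2 hL)
    intro s hs
    rw [Complex.exp_sub, hexp, hexp, div_eq_iff (hG0 _)]
    simp only [G]
    rw [hclid s hs.1 hs.2, hclid L hL le_rfl, hclid 0 le_rfl hL, max_eq_right hs.2,
      min_eq_left hs.2, max_eq_right hs.1, min_eq_left hs.1, h]
    ring
  have hz : Complex.exp (Λ (0, L) - Λ (0, 0)) = -1 := by
    rw [Complex.exp_sub, hexp, hexp, div_eq_iff (hG0 _)]
    simp only [G]
    rw [hclid L hL le_rfl, hclid 0 le_rfl hL, max_eq_right hL,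
      min_eq_left hL, h]
    simp
    ring
  have h2 : Λ (0, L) - Λ (0, 0) = 0 := by
    have : (2 : ℂ) * (Λ (0, L) - Λ (0, 0)) = 0 := by
      linear_combination hside - hdiag
    simpa using this
  rw [h2, Complex.exp_zero] at hz
  norm_num at hz

/-- The complex number with the given coordinates. -/
def toC (p : ℝ × ℝ) : ℂ := ⟨p.1, p.2⟩

theorem continuous_toC : Continuous toC :=
  Complex.equivRealProdCLM.symm.continuous

@[simp] theorem toC_re (p : ℝ × ℝ) : (toC p).re = p.1 := rfl
@[simp] theorem toC_im (p : ℝ × ℝ) : (toC p).im = p.2 := rfl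

theorem toC_injective : Function.Injective toC := fun p q h =>
  Prod.ext (congrArg Complex.re h) (congrArg Complex.im h)

theorem toC_eq_zero {p : ℝ × ℝ} : toC p = 0 ↔ p = 0 :=
  ⟨fun h => toC_injective (h.trans rfl), fun h => by rw [h]; rfl⟩

theorem toC_sub (p q : ℝ × ℝ) : toC (p - q) = toC p - toC q := rfl
theorem toC_add (p q : ℝ × ℝ) : toC (p + q) = toC p + toC q := rfl

/-- The universal chord theorem in the plane for the chord `v` of a curve with chord `2 v`. -/
theorem chord_lemma (α : ℝ → ℝ × ℝ) {L : ℝ} (hα : ContinuousOn α (Icc 0 L)) (hL : 0 ≤ L)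
    {v : ℝ × ℝ} (h : α L = α 0 + (2 : ℝ) • v) :
    ∃ s t, 0 ≤ s ∧ s ≤ t ∧ t ≤ L ∧ α t = α s + v := by
  have hproj : Continuous (fun s => α (projIcc 0 L hL s)) :=
    hα.comp_continuous (by fun_prop) (fun s => (projIcc 0 L hL s).2)
  obtain ⟨s, t, h0, h1, h2, h3⟩ := chord_lemma_complex
    (fun s => toC (α (projIcc 0 L hL s))) (continuous_toC.comp hproj) hL (v := toC v)
    (by
      simp only [projIcc_left, projIcc_right, h, toC_add]
      congr 1
      apply Complex.ext <;> simp)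
  refine ⟨s, t, h0, h1, h2, toC_injective ?_⟩
  rw [projIcc_of_mem hL ⟨h0.trans h1, h2⟩, projIcc_of_mem hL ⟨h0, h1.trans h2⟩] at h3
  rw [h3, toC_add]

/-- `f` ends up in the right half plane at `+∞` and in the left half plane at `-∞`. -/
def EndsRight (f : ℝ → ℂ) : Prop :=
  (∀ᶠ t in atTop, 0 < (f t).re) ∧ ∀ᶠ t in atBot, (f t).re < 0

/-- `f` has a continuous argument running from about `π` at `-∞` to about `2 π n` at `+∞`. -/
def HasIdx (f : ℝ → ℂ) (n : ℤ) : Prop :=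
  ∃ L : ℝ → ℂ, Continuous L ∧ (∀ t, Complex.exp (L t) = f t) ∧
    (∀ᶠ t in atTop, |(L t).im - 2 * Real.pi * n| < Real.pi / 2) ∧
    ∀ᶠ t in atBot, |(L t).im - Real.pi| < Real.pi / 2

theorem exp_int_mul_two_pi_I (n : ℤ) : Complex.exp (n * (2 * Real.pi * Complex.I)) = 1 :=
  Complex.exp_int_mul_two_pi_mul_I n

theorem im_int_mul_two_pi_I (n : ℤ) : ((n : ℂ) * (2 * Real.pi * Complex.I)).im = 2 * Real.pi * n := by
  simp
  ring

theorem exists_int_of_exp_eq_one {z : ℂ} (h : Complex.exp z = 1) :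
    ∃ n : ℤ, z = n * (2 * Real.pi * Complex.I) :=
  Complex.exp_eq_one_iff.1 h

theorem exists_hasIdx {f : ℝ → ℂ} (hf : Continuous f) (h0 : ∀ t, f t ≠ 0) (he : EndsRight f) :
    ∃ n, HasIdx f n := by
  obtain ⟨L, hL, hexp⟩ := exists_continuous_log f hf h0
  obtain ⟨a, ha⟩ := eventually_atTop.1 he.1
  obtain ⟨b, hb⟩ := eventually_atBot.1 he.2
  have hra : ∀ t ∈ Ici a, f t ∈ Complex.slitPlane := fun t ht => Or.inl (ha t ht)
  have hrb : ∀ t ∈ Iic b, -f t ∈ Complex.slitPlane := fun t ht =>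
    Or.inl (by simpa using hb t ht)
  have h1 : ∀ t ∈ Ici a, L t - Complex.log (f t) = L a - Complex.log (f a) := fun t ht =>
    eq_of_exp_const (u := fun t => L t - Complex.log (f t)) (c := 1) isPreconnected_Ici
      (hL.continuousOn.sub (hf.continuousOn.clog hra))
      (fun s _ => by rw [Complex.exp_sub, hexp, Complex.exp_log (h0 s), div_self (h0 s)])
      ht self_mem_Ici
  have h2 : ∀ t ∈ Iic b, L t - Complex.log (-f t) = L b - Complex.log (-f b) := fun t ht =>
    eq_of_exp_const (u := fun t => L t - Complex.log (-f t)) (c := -1) isPreconnected_Iic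
      (hL.continuousOn.sub (hf.neg.continuousOn.clog hrb))
      (fun s _ => by
        rw [Complex.exp_sub, hexp, Complex.exp_log (neg_ne_zero.2 (h0 s)), div_neg,
          div_self (h0 s)])
      ht self_mem_Iic
  obtain ⟨n, hn⟩ : ∃ n : ℤ, L a - Complex.log (f a) = n * (2 * Real.pi * Complex.I) :=
    exists_int_of_exp_eq_one (by
      rw [Complex.exp_sub, hexp, Complex.exp_log (h0 a), div_self (h0 a)])
  obtain ⟨m, hm⟩ : ∃ m : ℤ, L b - Complex.log (-f b) - Real.pi * Complex.I
      = m * (2 * Real.pi * Complex.I) :=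
    exists_int_of_exp_eq_one (by
      rw [Complex.exp_sub, Complex.exp_pi_mul_I, Complex.exp_sub, hexp,
        Complex.exp_log (neg_ne_zero.2 (h0 b))]
      field_simp [h0 b])
  refine ⟨n - m, fun t => L t - m * (2 * Real.pi * Complex.I), by fun_prop, fun t => ?_, ?_, ?_⟩
  · rw [Complex.exp_sub, exp_int_mul_two_pi_I, hexp, div_one]
  · filter_upwards [eventually_ge_atTop a] with t ht
    have e1 : L t - m * (2 * Real.pi * Complex.I)
        = Complex.log (f t) + n * (2 * Real.pi * Complex.I) - m * (2 * Real.pi * Complex.I) := by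
      rw [← hn, ← h1 t ht]; ring
    rw [e1, Complex.sub_im, Complex.add_im, im_int_mul_two_pi_I, im_int_mul_two_pi_I,
      Complex.log_im]
    have := Complex.abs_arg_lt_pi_div_two_iff.2 (Or.inl (ha t ht))
    push_cast
    convert this using 2
    ring
  · filter_upwards [eventually_le_atBot b] with t ht
    have e1 : L t - m * (2 * Real.pi * Complex.I)
        = Complex.log (-f t) + Real.pi * Complex.I := by
      rw [← hm, ← h2 t ht]; ring
    rw [e1, Complex.add_im, Complex.log_im]
    have := Complex.abs_arg_lt_pi_div_two_iff.2
      (Or.inl (show 0 < (-f t).re by simpa using hb t ht))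
    convert this using 2
    simp

theorem HasIdx.unique {f : ℝ → ℂ} {n m : ℤ} (h : HasIdx f n) (h' : HasIdx f m) : n = m := by
  obtain ⟨L, hL, hexp, ht, hb⟩ := h
  obtain ⟨L', hL', hexp', ht', hb'⟩ := h'
  have hc : ∀ s t, L s - L' s = L t - L' t := fun s t =>
    eq_of_exp_const (u := fun t => L t - L' t) (c := 1) isPreconnected_univ
      (by fun_prop)
      (fun s _ => by rw [Complex.exp_sub, hexp, ← hexp', div_self (Complex.exp_ne_zero _)])
      (mem_univ s) (mem_univ t)
  obtain ⟨s, hs, hs'⟩ := (ht.and ht').exists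
  obtain ⟨r, hr, hr'⟩ := (hb.and hb').exists
  obtain ⟨k, hk⟩ := exists_int_of_exp_eq_one (z := L r - L' r)
    (by rw [Complex.exp_sub, hexp, ← hexp', div_self (Complex.exp_ne_zero _)])
  have e1 := congrArg Complex.im hk
  rw [im_int_mul_two_pi_I, Complex.sub_im] at e1
  have e2 := congrArg Complex.im (hc s r)
  rw [Complex.sub_im, Complex.sub_im] at e2
  rw [abs_lt] at hs hs' hr hr'
  have hp := Real.pi_pos
  have hk0 : k = 0 := by
    have h1 : (k : ℝ) < 1 := by nlinarith
    have h2 : (-1 : ℝ) < k := by nlinarith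
    have h1' : k < 1 := by exact_mod_cast h1
    have h2' : -1 < k := by exact_mod_cast h2
    omega
  rw [hk0] at e1
  have h1 : ((n - m : ℤ) : ℝ) < 1 := by push_cast; push_cast at e1; nlinarith
  have h2 : (-1 : ℝ) < ((n - m : ℤ) : ℝ) := by push_cast; push_cast at e1; nlinarith
  have h1' : n - m < 1 := by exact_mod_cast h1
  have h2' : -1 < n - m := by exact_mod_cast h2
  omega

/-- The winding index of a curve avoiding the origin. -/
def idx (f : ℝ → ℂ) : ℤ := by
  classical exact if h : ∃ n, HasIdx f n then h.choose else 0

theorem HasIdx.idx_eq {f : ℝ → ℂ} {n : ℤ} (h : HasIdx f n) : idx f = n := by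
  have h' : ∃ n, HasIdx f n := ⟨n, h⟩
  rw [idx, dif_pos h']
  exact h'.choose_spec.unique h

theorem hasIdx_idx {f : ℝ → ℂ} (hf : Continuous f) (h0 : ∀ t, f t ≠ 0) (he : EndsRight f) :
    HasIdx f (idx f) := by
  obtain ⟨n, hn⟩ := exists_hasIdx hf h0 he
  rwa [hn.idx_eq]

theorem abs_lt_pi_div_two_of_cos_pos {x : ℝ} (h1 : |x| < 3 * Real.pi / 2) (h2 : 0 < Real.cos x) :
    |x| < Real.pi / 2 := by
  by_contra hcon
  push Not at hcon
  rw [← Real.cos_abs] at h2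
  have := Real.cos_nonpos_of_pi_div_two_le_of_le hcon (by linarith)
  linarith

theorem re_exp_pos_iff {z : ℂ} : 0 < (Complex.exp z).re ↔ 0 < Real.cos z.im := by
  rw [Complex.exp_re]
  exact mul_pos_iff_of_pos_left (Real.exp_pos _)

theorem HasIdx.of_div_mem_slitPlane {f g : ℝ → ℂ} {n : ℤ} (h : HasIdx f n) (hf : Continuous f)
    (hg : Continuous g) (hs : ∀ t, g t / f t ∈ Complex.slitPlane) (he : EndsRight g) :
    HasIdx g n := by
  obtain ⟨L, hL, hexp, ht, hb⟩ := h
  have hf0 : ∀ t, f t ≠ 0 := fun t => by rw [← hexp]; exact Complex.exp_ne_zero _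
  have hg0 : ∀ t, g t / f t ≠ 0 := fun t => Complex.slitPlane_ne_zero (hs t)
  have hexp' : ∀ t, Complex.exp (L t + Complex.log (g t / f t)) = g t := fun t => by
    rw [Complex.exp_add, Complex.exp_log (hg0 t), hexp, mul_div_cancel₀ _ (hf0 t)]
  have harg : ∀ t, |(g t / f t).arg| < Real.pi := fun t => by
    rw [abs_lt]
    exact ⟨Complex.neg_pi_lt_arg _, lt_of_le_of_ne (Complex.arg_le_pi _)
      (Complex.mem_slitPlane_iff_arg.1 (hs t)).1⟩
  refine ⟨fun t => L t + Complex.log (g t / f t),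
    hL.add ((hg.div hf hf0).clog hs), hexp', ?_, ?_⟩
  · filter_upwards [ht, he.1] with t h1 h2
    have h3 := harg t
    apply abs_lt_pi_div_two_of_cos_pos
    · rw [Complex.add_im, Complex.log_im]
      rw [abs_lt] at h1 h3 ⊢
      constructor <;> linarith [h1.1, h1.2, h3.1, h3.2]
    · rw [← hexp' t, re_exp_pos_iff] at h2
      have : (L t + Complex.log (g t / f t)).im - 2 * Real.pi * n
        = (L t + Complex.log (g t / f t)).im - n * (2 * Real.pi) := by ring
      rwa [this, Real.cos_sub_int_mul_two_pi]
  · filter_upwards [hb, he.2] with t h1 h2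
    have h3 := harg t
    apply abs_lt_pi_div_two_of_cos_pos
    · rw [Complex.add_im, Complex.log_im]
      rw [abs_lt] at h1 h3 ⊢
      constructor <;> linarith [h1.1, h1.2, h3.1, h3.2]
    · rw [← hexp' t] at h2
      have h4 : (Complex.exp (L t + Complex.log (g t / f t))).re
        = Real.exp (L t + Complex.log (g t / f t)).re
          * Real.cos (L t + Complex.log (g t / f t)).im := Complex.exp_re _
      rw [h4] at h2
      rw [Real.cos_sub_pi]
      have := Real.exp_pos (L t + Complex.log (g t / f t)).re
      nlinarith

theorem div_mem_slitPlane_of_re_pos {z w : ℂ} (hz : 0 < z.re) (hw : 0 < w.re) :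
    z / w ∈ Complex.slitPlane := by
  have hz0 : z ≠ 0 := fun h => by simp [h] at hz
  have hw0 : w ≠ 0 := fun h => by simp [h] at hw
  have h1 := Complex.abs_arg_lt_pi_div_two_iff.2 (Or.inl hz)
  have h2 := Complex.abs_arg_lt_pi_div_two_iff.2 (Or.inl hw)
  rw [abs_lt] at h1 h2
  rw [Complex.mem_slitPlane_iff_arg]
  have hm : z.arg - w.arg ∈ Ioo (-Real.pi) Real.pi := by constructor <;> linarith [h1.1, h1.2]
  have h3 : (z / w).arg = z.arg - w.arg := by
    have e : z / w = ((‖z‖ / ‖w‖ : ℝ) : ℂ) *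
        (Real.cos (z.arg - w.arg) + Real.sin (z.arg - w.arg) * Complex.I) := by
      have e1 := Complex.norm_mul_exp_arg_mul_I z
      have e2 := Complex.norm_mul_exp_arg_mul_I w
      conv_lhs => rw [← e1, ← e2]
      rw [mul_div_mul_comm, ← Complex.exp_sub, Complex.ofReal_cos, Complex.ofReal_sin,
        ← Complex.exp_mul_I]
      push_cast
      ring_nf
    rw [e]
    push_cast [Complex.ofReal_cos, Complex.ofReal_sin]
    have := Complex.arg_mul_cos_add_sin_mul_I (r := ‖z‖ / ‖w‖) (θ := z.arg - w.arg)
      (by positivity) ⟨hm.1, hm.2.le⟩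
    push_cast at this
    exact this
  refine ⟨?_, div_ne_zero hz0 hw0⟩
  rw [h3]
  exact hm.2.ne

theorem div_mem_slitPlane_of_re_neg {z w : ℂ} (hz : z.re < 0) (hw : w.re < 0) :
    z / w ∈ Complex.slitPlane := by
  have := div_mem_slitPlane_of_re_pos (z := -z) (w := -w) (by simpa using hz) (by simpa using hw)
  rwa [neg_div_neg_eq] at this

/-- The index is locally constant in families with uniform control of the ends. -/
theorem eventually_idx_eq {X : Type*} [TopologicalSpace X] {F : X → ℝ → ℂ}
    (hF : Continuous fun p : X × ℝ => F p.1 p.2) {x₀ : X} (h0 : ∀ t, F x₀ t ≠ 0) {T : ℝ}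
    (hT : ∀ᶠ x in 𝓝 x₀, ∀ t, (T ≤ t → 0 < (F x t).re) ∧ (t ≤ -T → (F x t).re < 0)) :
    ∀ᶠ x in 𝓝 x₀, idx (F x) = idx (F x₀) := by
  have hx : ∀ x, Continuous (F x) := fun x => hF.comp (by fun_prop : Continuous fun t => (x, t))
  have hends : ∀ x, (∀ t, (T ≤ t → 0 < (F x t).re) ∧ (t ≤ -T → (F x t).re < 0)) →
      EndsRight (F x) := fun x h =>
    ⟨by filter_upwards [eventually_ge_atTop T] with t ht using (h t).1 ht,
     by filter_upwards [eventually_le_atBot (-T)] with t ht using (h t).2 ht⟩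
  have hcomp : ∀ᶠ x in 𝓝 x₀, ∀ t ∈ Icc (-T) T, F x t / F x₀ t ∈ Complex.slitPlane := by
    refine isCompact_Icc.eventually_forall_of_forall_eventually fun t _ => ?_
    have hc : ContinuousAt (fun p : X × ℝ => F p.1 p.2 / F x₀ p.2) (x₀, t) :=
      (hF.continuousAt).div (((hx x₀).comp continuous_snd).continuousAt) (h0 t)
    refine hc.eventually_mem (Complex.isOpen_slitPlane.mem_nhds ?_)
    simp only [div_self (h0 t)]
    exact Complex.one_mem_slitPlane
  have hT0 := hT.self_of_nhds
  have hidx := hasIdx_idx (hx x₀) h0 (hends x₀ hT0)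
  filter_upwards [hT, hcomp] with x h1 h2
  refine (hidx.of_div_mem_slitPlane (hx x₀) (hx x) (fun t => ?_) (hends x h1)).idx_eq
  by_cases ha : T ≤ t
  · exact div_mem_slitPlane_of_re_pos ((h1 t).1 ha) ((hT0 t).1 ha)
  · by_cases hb : t ≤ -T
    · exact div_mem_slitPlane_of_re_neg ((h1 t).2 hb) ((hT0 t).2 hb)
    · exact h2 t ⟨by linarith, by linarith⟩

theorem idx_eq_zero_of_im_pos {f : ℝ → ℂ} (hf : Continuous f) (h : ∀ t, 0 < (f t).im)
    (he : EndsRight f) : idx f = 0 := by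
  have hs : ∀ t, f t ∈ Complex.slitPlane := fun t => Or.inr (h t).ne'
  refine HasIdx.idx_eq ⟨fun t => Complex.log (f t), hf.clog hs,
    fun t => Complex.exp_log (Complex.slitPlane_ne_zero (hs t)), ?_, ?_⟩
  · filter_upwards [he.1] with t ht
    have := Complex.abs_arg_lt_pi_div_two_iff.2 (Or.inl ht)
    rw [Complex.log_im]
    simpa only [Int.cast_zero, mul_zero, sub_zero] using this
  · filter_upwards [he.2] with t ht
    have h1 := Complex.arg_le_pi (f t)
    have h2 : Real.pi / 2 < (f t).arg := by
      by_contra hc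
      push Not at hc
      rcases Complex.arg_le_pi_div_two_iff.1 hc with h3 | h3
      · linarith
      · linarith [h t]
    rw [Complex.log_im, abs_lt]
    constructor <;> linarith

theorem idx_eq_one_of_im_neg {f : ℝ → ℂ} (hf : Continuous f) (h : ∀ t, (f t).im < 0)
    (he : EndsRight f) : idx f = 1 := by
  have hs : ∀ t, -f t ∈ Complex.slitPlane := fun t => Or.inr (by simpa using (h t).ne)
  refine HasIdx.idx_eq ⟨fun t => Complex.log (-f t) + Real.pi * Complex.I,
    (hf.neg.clog hs).add continuous_const,
    fun t => ?_, ?_, ?_⟩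
  · rw [Complex.exp_add, Complex.exp_pi_mul_I, Complex.exp_log (Complex.slitPlane_ne_zero (hs t))]
    ring
  · filter_upwards [he.1] with t ht
    have h1 := Complex.arg_le_pi (-f t)
    have h2 : Real.pi / 2 < (-f t).arg := by
      by_contra hc
      push Not at hc
      rcases Complex.arg_le_pi_div_two_iff.1 hc with h3 | h3
      · simp at h3; linarith
      · simp at h3; linarith [h t]
    rw [Complex.add_im, Complex.log_im, abs_lt]
    simp
    constructor <;> linarith
  · filter_upwards [he.2] with t ht
    have := Complex.abs_arg_lt_pi_div_two_iff.2 (Or.inl (show 0 < (-f t).re by simpa using ht))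
    rw [← Complex.log_im] at this
    convert this using 2
    simp

theorem log_neg_of_im_pos {z : ℂ} (hz : 0 < z.im) :
    Complex.log (-z) = Complex.log z - Real.pi * Complex.I := by
  have h := Complex.arg_neg_eq_arg_sub_pi_of_im_pos hz
  apply Complex.ext
  · simp [Complex.log_re]
  · simp [Complex.log_im, h]

theorem log_neg_of_im_neg {z : ℂ} (hz : z.im < 0) :
    Complex.log (-z) = Complex.log z + Real.pi * Complex.I := by
  have h := Complex.arg_neg_eq_arg_add_pi_of_im_neg hz
  apply Complex.ext
  · simp [Complex.log_re]
  · simp [Complex.log_im, h]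

/-- The index changes when a base point crosses the curve transversally. -/
theorem idx_ne_of_crossing {h u : ℝ → ℂ} {P₀ v : ℂ} {s τ : ℝ} (hh : Continuous h) (hv : v ≠ 0)
    (hu : ∀ t, h t = P₀ + v * u t) (hs : 0 < s) (hτ : 0 < τ) (hu0 : u 0 = 0)
    (hpos : ∀ t, 0 < t → t ≤ τ → 0 < (u t).re) (hneg : ∀ t, -τ ≤ t → t < 0 → (u t).re < 0)
    (hfar : ∀ t, τ ≤ |t| → 3 * s < ‖u t‖)
    (he₁ : EndsRight fun t => h t - (P₀ + v * (s * Complex.I)))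
    (he₂ : EndsRight fun t => h t - (P₀ - v * (s * Complex.I))) :
    idx (fun t => h t - (P₀ + v * (s * Complex.I)))
      ≠ idx (fun t => h t - (P₀ - v * (s * Complex.I))) := by
  set f₁ : ℝ → ℂ := fun t => h t - (P₀ + v * (s * Complex.I)) with hf₁
  set f₂ : ℝ → ℂ := fun t => h t - (P₀ - v * (s * Complex.I)) with hf₂
  have hc₁ : Continuous f₁ := by fun_prop
  have hc₂ : Continuous f₂ := by fun_prop
  have huc : Continuous u := by
    have : u = fun t => (h t - P₀) / v := by
      funext t
      rw [hu t]
      field_simp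
      ring
    rw [this]
    fun_prop
  have e₁ : ∀ t, f₁ t = v * (u t - s * Complex.I) := fun t => by simp only [hf₁, hu t]; ring
  have e₂ : ∀ t, f₂ t = v * (u t + s * Complex.I) := fun t => by simp only [hf₂, hu t]; ring
  have hre : ∀ t, |t| ≤ τ → t ≠ 0 → (u t).re ≠ 0 := by
    intro t ht h0
    rw [abs_le] at ht
    rcases lt_or_gt_of_ne h0 with h1 | h1
    · exact (hneg t ht.1 h1).ne
    · exact (hpos t h1 ht.2).ne'
  have hne : ∀ t, u t - s * Complex.I ≠ 0 ∧ u t + s * Complex.I ≠ 0 := by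
    intro t
    by_cases ht : |t| ≤ τ
    · by_cases h0 : t = 0
      · subst h0
        rw [hu0]
        simp [hs.ne']
      · have := hre t ht h0
        constructor <;> intro hcon <;> apply this <;> simpa using congrArg Complex.re hcon
    · have h3 := hfar t (not_le.1 ht).le
      constructor <;> intro hcon
      · have : u t = s * Complex.I := by linear_combination hcon
        rw [this] at h3
        simp [abs_of_pos hs] at h3
        linarith
      · have : u t = -(s * Complex.I) := by linear_combination hcon
        rw [this] at h3
        simp [abs_of_pos hs] at h3
        linarith
  have h0₁ : ∀ t, f₁ t ≠ 0 := fun t => by rw [e₁]; exact mul_ne_zero hv (hne t).1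
  have h0₂ : ∀ t, f₂ t ≠ 0 := fun t => by rw [e₂]; exact mul_ne_zero hv (hne t).2
  let ρ : ℝ → ℂ := fun t => f₂ t / f₁ t
  have hρc : Continuous ρ := hc₂.div hc₁ h0₁
  have hρ0 : ∀ t, ρ t ≠ 0 := fun t => div_ne_zero (h0₂ t) (h0₁ t)
  have hρe : ∀ t, ρ t = (u t + s * Complex.I) / (u t - s * Complex.I) := fun t => by
    simp only [ρ, e₁, e₂]
    rw [mul_div_mul_left _ _ hv]
  have him : ∀ t, ∃ c > 0, (ρ t).im = c * (u t).re := by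
    intro t
    have hn : 0 < Complex.normSq (u t - s * Complex.I) := Complex.normSq_pos.2 (hne t).1
    refine ⟨2 * s / Complex.normSq (u t - s * Complex.I), by positivity, ?_⟩
    rw [hρe, Complex.div_im]
    simp
    field_simp
    ring
  have hfarre : ∀ t, τ ≤ |t| → 0 < (ρ t).re := by
    intro t ht
    have h3 := hfar t ht
    have hn : 0 < Complex.normSq (u t - s * Complex.I) := Complex.normSq_pos.2 (hne t).1
    have e : (ρ t).re = (‖u t‖ ^ 2 - s ^ 2) / Complex.normSq (u t - s * Complex.I) := by
      rw [hρe, Complex.div_re, ← Complex.normSq_eq_norm_sq, Complex.normSq_apply (u t)]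
      simp
      field_simp
      ring
    rw [e]
    apply div_pos _ hn
    nlinarith
  have hmid : ∀ t ∈ Icc (-τ) τ, -ρ t ∈ Complex.slitPlane := by
    intro t ht
    by_cases h0 : t = 0
    · left
      subst h0
      rw [hρe, hu0, zero_add, zero_sub, div_neg, neg_neg, div_self]
      · simp
      · simp [hs.ne']
    · right
      obtain ⟨c, hc, hc'⟩ := him t
      rw [Complex.neg_im, hc']
      exact neg_ne_zero.2 (mul_ne_zero hc.ne' (hre t (abs_le.2 ht) h0))
  obtain ⟨L₁, hL₁, hx₁, hr₁, hl₁⟩ := hasIdx_idx hc₁ h0₁ he₁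
  obtain ⟨L₂, hL₂, hx₂, hr₂, hl₂⟩ := hasIdx_idx hc₂ h0₂ he₂
  have hexp : ∀ t, Complex.exp (L₂ t - L₁ t) = ρ t := fun t => by
    rw [Complex.exp_sub, hx₁, hx₂]
  have hright : ∀ t ∈ Ici τ, L₂ t - L₁ t - Complex.log (ρ t)
      = L₂ τ - L₁ τ - Complex.log (ρ τ) := fun t ht =>
    eq_of_exp_const (u := fun t => L₂ t - L₁ t - Complex.log (ρ t)) (c := 1) isPreconnected_Ici
      ((hL₂.sub hL₁).continuousOn.sub (hρc.continuousOn.clog fun r hr =>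
        Or.inl (hfarre r (le_trans hr (le_abs_self r)))))
      (fun r _ => by rw [Complex.exp_sub, hexp, Complex.exp_log (hρ0 r), div_self (hρ0 r)])
      ht self_mem_Ici
  have hleft : ∀ t ∈ Iic (-τ), L₂ t - L₁ t - Complex.log (ρ t)
      = L₂ (-τ) - L₁ (-τ) - Complex.log (ρ (-τ)) := fun t ht =>
    eq_of_exp_const (u := fun t => L₂ t - L₁ t - Complex.log (ρ t)) (c := 1) isPreconnected_Iic
      ((hL₂.sub hL₁).continuousOn.sub (hρc.continuousOn.clog fun r hr =>
        Or.inl (hfarre r (le_trans (by simp only [mem_Iic] at hr; linarith) (neg_le_abs r)))))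
      (fun r _ => by rw [Complex.exp_sub, hexp, Complex.exp_log (hρ0 r), div_self (hρ0 r)])
      ht self_mem_Iic
  have hmiddle : L₂ (-τ) - L₁ (-τ) - Complex.log (-ρ (-τ)) = L₂ τ - L₁ τ - Complex.log (-ρ τ) :=
    eq_of_exp_const (u := fun t => L₂ t - L₁ t - Complex.log (-ρ t)) (c := -1)
      (S := Icc (-τ) τ) isPreconnected_Icc
      ((hL₂.sub hL₁).continuousOn.sub (hρc.neg.continuousOn.clog hmid))
      (fun r _ => by
        rw [Complex.exp_sub, hexp, Complex.exp_log (neg_ne_zero.2 (hρ0 r)), div_neg,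
          div_self (hρ0 r)])
      (left_mem_Icc.2 (by linarith)) (right_mem_Icc.2 (by linarith))
  obtain ⟨c₁, hc₁pos, hi₁⟩ := him τ
  obtain ⟨c₂, hc₂pos, hi₂⟩ := him (-τ)
  rw [log_neg_of_im_pos (z := ρ τ) (by
      rw [hi₁]; exact mul_pos hc₁pos (hpos τ hτ le_rfl)),
    log_neg_of_im_neg (z := ρ (-τ)) (by
      rw [hi₂]; exact mul_neg_of_pos_of_neg hc₂pos (hneg _ le_rfl (by linarith)))] at hmiddle
  intro hcon
  obtain ⟨a, ⟨ha₁, ha₂⟩, haτ⟩ := ((hr₁.and hr₂).and (eventually_ge_atTop τ)).exists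
  obtain ⟨b, ⟨hb₁, hb₂⟩, hbτ⟩ := ((hl₁.and hl₂).and (eventually_le_atBot (-τ))).exists
  have ea := congrArg Complex.im (hright a haτ)
  have eb := congrArg Complex.im (hleft b hbτ)
  have em := congrArg Complex.im hmiddle
  have aa := Complex.abs_arg_lt_pi_div_two_iff.2 (Or.inl (hfarre a (le_trans haτ (le_abs_self a))))
  have ab := Complex.abs_arg_lt_pi_div_two_iff.2 (Or.inl (hfarre b
    (le_trans (by linarith) (neg_le_abs b))))
  obtain ⟨k, hk⟩ := exists_int_of_exp_eq_one (z := L₂ b - L₁ b - Complex.log (ρ b))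
    (by rw [Complex.exp_sub, hexp, Complex.exp_log (hρ0 b), div_self (hρ0 b)])
  have ek := congrArg Complex.im hk
  rw [im_int_mul_two_pi_I] at ek
  simp only [Complex.sub_im, Complex.add_im, Complex.log_im, Complex.mul_im, Complex.ofReal_re,
    Complex.ofReal_im, Complex.I_re, Complex.I_im, mul_one, add_zero, mul_zero]
    at ea eb em ek
  rw [hcon] at ha₁
  rw [abs_lt] at ha₁ ha₂ hb₁ hb₂ aa ab
  have hp := Real.pi_pos
  have hk0 : k = 0 := by
    have h1 : (k : ℝ) < 1 := by nlinarith
    have h2 : (-1 : ℝ) < k := by nlinarith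
    have h1' : k < 1 := by exact_mod_cast h1
    have h2' : -1 < k := by exact_mod_cast h2
    omega
  rw [hk0] at ek
  simp at ek
  linarith

theorem exists_lat_translate (x : ℝ × ℝ) : ∃ k : ℤ × ℤ, x + lat k ∈ Icc (0 : ℝ × ℝ) (1, 1) := by
  refine ⟨(-⌊x.1⌋, -⌊x.2⌋), ?_, ?_⟩ <;> constructor <;> simp only [lat, Prod.fst_add, Prod.snd_add,
    Prod.fst_zero, Prod.snd_zero, Int.cast_neg]
  · linarith [Int.floor_le x.1]
  · linarith [Int.floor_le x.2]
  · linarith [Int.lt_floor_add_one x.1]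
  · linarith [Int.lt_floor_add_one x.2]

/-- A continuous `ℤ²`-periodic function is bounded. -/
theorem bounded_of_periodic {E : Type*} [NormedAddCommGroup E] {f : ℝ × ℝ → E} (hf : Continuous f)
    (hp : ∀ (k : ℤ × ℤ) x, f (x + lat k) = f x) : ∃ C : ℝ, 0 < C ∧ ∀ x, ‖f x‖ ≤ C := by
  obtain ⟨C, hC⟩ := (isCompact_Icc (a := (0 : ℝ × ℝ)) (b := (1, 1))).exists_bound_of_continuousOn
    hf.continuousOn
  refine ⟨max C 1, by positivity, fun x => ?_⟩
  obtain ⟨k, hk⟩ := exists_lat_translate x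
  rw [← hp k x]
  exact (hC _ hk).trans (le_max_left _ _)

theorem fderiv_periodic {E : Type*} [NormedAddCommGroup E] [NormedSpace ℝ E] {f : ℝ × ℝ → E}
    (hp : ∀ (k : ℤ × ℤ) x, f (x + lat k) = f x) (k : ℤ × ℤ) (x : ℝ × ℝ) :
    fderiv ℝ f (x + lat k) = fderiv ℝ f x := by
  rw [← fderiv_comp_add_right]
  simp only [hp]

theorem lipschitz_of_periodic {E : Type*} [NormedAddCommGroup E] [NormedSpace ℝ E]
    {f : ℝ × ℝ → E} (hf : ContDiff ℝ 1 f) (hp : ∀ (k : ℤ × ℤ) x, f (x + lat k) = f x) :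
    ∃ C : ℝ, 0 < C ∧ (∀ x, ‖fderiv ℝ f x‖ ≤ C) ∧ ∀ x y, ‖f x - f y‖ ≤ C * ‖x - y‖ := by
  obtain ⟨C, hC0, hC⟩ := bounded_of_periodic (hf.continuous_fderiv one_ne_zero) (fderiv_periodic hp)
  refine ⟨C, hC0, hC, fun x y => ?_⟩
  exact Convex.norm_image_sub_le_of_norm_fderiv_le (𝕜 := ℝ) (s := univ)
    (fun z _ => (hf.differentiable one_ne_zero) z) (fun z _ => hC z) convex_univ (mem_univ _)
    (mem_univ _)

namespace TorusMetric

variable (M : TorusMetric)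

theorem g_add (x v v' w : ℝ × ℝ) : M.g x (v + v') w = M.g x v w + M.g x v' w :=
  (M.linear x w).map_add v v'

theorem g_smul (x : ℝ × ℝ) (r : ℝ) (v w : ℝ × ℝ) : M.g x (r • v) w = r * M.g x v w :=
  (M.linear x w).map_smul r v

theorem g_eq (x v w : ℝ × ℝ) : M.g x v w = M.g x (1, 0) (1, 0) * (v.1 * w.1)
    + M.g x (1, 0) (0, 1) * (v.1 * w.2 + v.2 * w.1) + M.g x (0, 1) (0, 1) * (v.2 * w.2) := by
  have h : ∀ u : ℝ × ℝ, u = u.1 • ((1, 0) : ℝ × ℝ) + u.2 • ((0, 1) : ℝ × ℝ) := fun u => by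
    ext <;> simp
  have e1 : ∀ u : ℝ × ℝ, M.g x v u = v.1 * M.g x (1, 0) u + v.2 * M.g x (0, 1) u := fun u => by
    conv_lhs => rw [h v]
    rw [g_add, g_smul, g_smul]
  have e2 : ∀ u : ℝ × ℝ, M.g x u w = w.1 * M.g x (1, 0) u + w.2 * M.g x (0, 1) u := fun u => by
    rw [M.symm]
    conv_lhs => rw [h w]
    rw [g_add, g_smul, g_smul]
  rw [e1, e2, e2, M.symm x (0, 1) (1, 0)]
  ring

/-- The metric as a field of continuous bilinear forms. -/
def G (x : ℝ × ℝ) : (ℝ × ℝ) →L[ℝ] (ℝ × ℝ) →L[ℝ] ℝ :=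
  M.g x (1, 0) (1, 0) • (ContinuousLinearMap.fst ℝ ℝ ℝ).smulRight (ContinuousLinearMap.fst ℝ ℝ ℝ)
  + M.g x (1, 0) (0, 1) •
    ((ContinuousLinearMap.fst ℝ ℝ ℝ).smulRight (ContinuousLinearMap.snd ℝ ℝ ℝ)
      + (ContinuousLinearMap.snd ℝ ℝ ℝ).smulRight (ContinuousLinearMap.fst ℝ ℝ ℝ))
  + M.g x (0, 1) (0, 1) •
    (ContinuousLinearMap.snd ℝ ℝ ℝ).smulRight (ContinuousLinearMap.snd ℝ ℝ ℝ)

theorem G_apply (x v w : ℝ × ℝ) : M.G x v w = M.g x v w := by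
  rw [g_eq]
  simp [G]
  ring

theorem contDiff_coeff (v w : ℝ × ℝ) : ContDiff ℝ (⊤ : ℕ∞) fun x => M.g x v w :=
  M.smooth.comp (g := fun p : (ℝ × ℝ) × (ℝ × ℝ) × (ℝ × ℝ) => M.g p.1 p.2.1 p.2.2)
    (f := fun x => (x, v, w)) (contDiff_id.prodMk contDiff_const)

theorem contDiff_G : ContDiff ℝ (⊤ : ℕ∞) M.G := by
  rw [contDiff_clm_apply_iff]
  intro v
  rw [contDiff_clm_apply_iff]
  intro w
  simp only [G_apply]
  exact M.contDiff_coeff v w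

theorem G_periodic (k : ℤ × ℤ) (x : ℝ × ℝ) : M.G (x + lat k) = M.G x := by
  simp only [G, M.periodic]

/-- The Riemannian norm of a tangent vector. -/
def speed (x v : ℝ × ℝ) : ℝ := Real.sqrt (M.g x v v)

theorem g_nonneg (x v : ℝ × ℝ) : 0 ≤ M.g x v v := by
  by_cases h : v = 0
  · rw [h, g_eq]; simp
  · exact (M.posdef x v h).le

theorem speed_nonneg (x v : ℝ × ℝ) : 0 ≤ M.speed x v := Real.sqrt_nonneg _

theorem speed_sq (x v : ℝ × ℝ) : M.speed x v ^ 2 = M.g x v v := Real.sq_sqrt (M.g_nonneg x v)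

theorem speed_smul (x : ℝ × ℝ) (r : ℝ) (v : ℝ × ℝ) : M.speed x (r • v) = |r| * M.speed x v := by
  unfold speed
  rw [g_smul, M.symm, g_smul, ← mul_assoc, Real.sqrt_mul' _ (M.g_nonneg _ _), Real.sqrt_mul_self_eq_abs]

theorem speed_neg (x v : ℝ × ℝ) : M.speed x (-v) = M.speed x v := by
  have := M.speed_smul x (-1) v
  simpa using this

theorem continuous_G : Continuous M.G := M.contDiff_G.continuous

theorem continuous_speed : Continuous fun p : (ℝ × ℝ) × (ℝ × ℝ) => M.speed p.1 p.2 := by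
  unfold speed
  simp_rw [← G_apply]
  have := M.continuous_G
  fun_prop

theorem g_cauchy_schwarz (x v w : ℝ × ℝ) : M.g x v w ≤ M.speed x v * M.speed x w := by
  by_cases hw : w = 0
  · subst hw
    rw [g_eq]
    simp only [Prod.fst_zero, Prod.snd_zero, mul_zero, add_zero]
    exact mul_nonneg (M.speed_nonneg _ _) (M.speed_nonneg _ _)
  have hc := M.posdef x w hw
  have h := M.g_nonneg x (M.g x w w • v + (-M.g x v w) • w)
  have e : M.g x (M.g x w w • v + (-M.g x v w) • w) (M.g x w w • v + (-M.g x v w) • w)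
      = M.g x w w * (M.g x v v * M.g x w w - M.g x v w ^ 2) := by
    simp only [← G_apply, map_add, map_smul, add_apply, smul_apply, smul_eq_mul]
    simp only [G_apply, M.symm x w v]
    ring
  rw [e] at h
  have h2 := nonneg_of_mul_nonneg_right h hc
  have h3 : M.g x v w ^ 2 ≤ (M.speed x v * M.speed x w) ^ 2 := by
    rw [mul_pow, speed_sq, speed_sq]; linarith
  exact (le_abs_self _).trans
    (abs_le_of_sq_le_sq h3 (mul_nonneg (M.speed_nonneg _ _) (M.speed_nonneg _ _)))

theorem exists_speed_lower : ∃ m : ℝ, 0 < m ∧ ∀ x v, m * ‖v‖ ≤ M.speed x v := by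
  have hK : IsCompact (Icc (0 : ℝ × ℝ) (1, 1) ×ˢ Metric.sphere (0 : ℝ × ℝ) 1) :=
    isCompact_Icc.prod (isCompact_sphere _ _)
  have hne : (Icc (0 : ℝ × ℝ) (1, 1) ×ˢ Metric.sphere (0 : ℝ × ℝ) 1).Nonempty :=
    ⟨((0, 0), (1, 0)), by
      constructor
      · constructor <;> constructor <;> simp
      · simp [Prod.norm_def]⟩
  obtain ⟨p, hp, hmin⟩ := hK.exists_isMinOn hne M.continuous_speed.continuousOn
  have hpv : p.2 ≠ 0 := fun h => by
    have := hp.2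
    rw [h] at this
    simp at this
  refine ⟨M.speed p.1 p.2, Real.sqrt_pos.2 (M.posdef _ _ hpv), fun x v => ?_⟩
  by_cases hv : v = 0
  · subst hv
    simpa using M.speed_nonneg x 0
  obtain ⟨k, hk⟩ := exists_lat_translate x
  have h1 : M.speed p.1 p.2 ≤ M.speed (x + lat k) (‖v‖⁻¹ • v) :=
    hmin (show ((x + lat k, ‖v‖⁻¹ • v) : (ℝ × ℝ) × (ℝ × ℝ)) ∈ _ from
      ⟨hk, by simp [norm_smul, hv]⟩)
  rw [speed_smul] at h1
  have h2 : M.speed (x + lat k) v = M.speed x v := by simp [speed, M.periodic]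
  have hv' := norm_pos_iff.2 hv
  rw [h2, abs_of_pos (by positivity)] at h1
  calc M.speed p.1 p.2 * ‖v‖ ≤ (‖v‖⁻¹ * M.speed x v) * ‖v‖ := by gcongr
    _ = M.speed x v := by field_simp

/-- Constants controlling the metric. -/
theorem exists_constants : ∃ m C K : ℝ, 0 < m ∧ 0 < C ∧ 0 < K ∧
    (∀ x v, m * ‖v‖ ≤ M.speed x v) ∧ (∀ x v, M.speed x v ≤ C * ‖v‖) ∧
    (∀ x y v, |M.speed x v - M.speed y v| ≤ K * ‖x - y‖ * ‖v‖) := by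
  obtain ⟨m, hm, hlow⟩ := M.exists_speed_lower
  obtain ⟨C, hC, hbd⟩ := bounded_of_periodic M.continuous_G M.G_periodic
  obtain ⟨K, hK, -, hlip⟩ := lipschitz_of_periodic (M.contDiff_G.of_le (by simp)) M.G_periodic
  refine ⟨m, Real.sqrt C, K / m, hm, Real.sqrt_pos.2 hC, by positivity, hlow, fun x v => ?_,
    fun x y v => ?_⟩
  · unfold speed
    rw [← Real.sqrt_mul_self (norm_nonneg v), ← Real.sqrt_mul hC.le]
    apply Real.sqrt_le_sqrt
    rw [← G_apply]
    calc M.G x v v ≤ ‖M.G x v v‖ := le_abs_self _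
      _ ≤ ‖M.G x‖ * ‖v‖ * ‖v‖ := ContinuousLinearMap.le_opNorm₂ _ _ _
      _ ≤ C * (‖v‖ * ‖v‖) := by rw [mul_assoc]; gcongr; exact hbd x
  · by_cases hv : v = 0
    · subst hv
      simp [speed, ← G_apply]
    have hv' := norm_pos_iff.2 hv
    have h1 := hlow x v
    have h2 := hlow y v
    have hpos : 0 < M.speed x v + M.speed y v := by nlinarith [mul_pos hm hv']
    have e : (M.speed x v - M.speed y v) * (M.speed x v + M.speed y v)
        = (M.G x - M.G y) v v := by
      have : (M.speed x v - M.speed y v) * (M.speed x v + M.speed y v)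
        = M.speed x v ^ 2 - M.speed y v ^ 2 := by ring
      rw [this, speed_sq, speed_sq]
      simp [G_apply]
    have h3 : |M.speed x v - M.speed y v| * (M.speed x v + M.speed y v)
        ≤ K * ‖x - y‖ * ‖v‖ * ‖v‖ := by
      have e' : |M.speed x v - M.speed y v| * (M.speed x v + M.speed y v) = |(M.G x - M.G y) v v| := by
        rw [← e, abs_mul, abs_of_pos hpos]
      rw [e']
      calc |(M.G x - M.G y) v v| ≤ ‖M.G x - M.G y‖ * ‖v‖ * ‖v‖ :=
            ContinuousLinearMap.le_opNorm₂ (M.G x - M.G y) v v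
        _ ≤ _ := by gcongr; exact hlip x y
    have h4 : |M.speed x v - M.speed y v| * (m * ‖v‖) ≤ K * ‖x - y‖ * ‖v‖ * ‖v‖ := by
      refine le_trans ?_ h3
      gcongr
      linarith [M.speed_nonneg y v]
    rw [div_mul_eq_mul_div, div_mul_eq_mul_div, le_div_iff₀ hm]
    have h5 : |M.speed x v - M.speed y v| * m * ‖v‖ ≤ K * ‖x - y‖ * ‖v‖ * ‖v‖ := by linarith
    exact le_of_mul_le_mul_right h5 hv'

end TorusMetric

namespace TorusMetric

variable (M : TorusMetric)

/-- Lower bound for the speed. -/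
def cm : ℝ := M.exists_constants.choose

/-- Upper bound for the speed. -/
def cC : ℝ := M.exists_constants.choose_spec.choose

/-- Lipschitz constant of the speed. -/
def cK : ℝ := M.exists_constants.choose_spec.choose_spec.choose

theorem cm_pos : 0 < M.cm := M.exists_constants.choose_spec.choose_spec.choose_spec.1

theorem cC_pos : 0 < M.cC := M.exists_constants.choose_spec.choose_spec.choose_spec.2.1

theorem cK_pos : 0 < M.cK := M.exists_constants.choose_spec.choose_spec.choose_spec.2.2.1

theorem le_speed (x v : ℝ × ℝ) : M.cm * ‖v‖ ≤ M.speed x v :=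
  M.exists_constants.choose_spec.choose_spec.choose_spec.2.2.2.1 x v

theorem speed_le (x v : ℝ × ℝ) : M.speed x v ≤ M.cC * ‖v‖ :=
  M.exists_constants.choose_spec.choose_spec.choose_spec.2.2.2.2.1 x v

theorem speed_lip (x y v : ℝ × ℝ) : |M.speed x v - M.speed y v| ≤ M.cK * ‖x - y‖ * ‖v‖ :=
  M.exists_constants.choose_spec.choose_spec.choose_spec.2.2.2.2.2 x y v

theorem length_eq (c : ℝ → ℝ × ℝ) (a b : ℝ) :
    M.length c a b = ∫ t in a..b, M.speed (c t) (deriv c t) := rfl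

variable {M}

theorem continuous_speed_comp {c v : ℝ → ℝ × ℝ} (hc : Continuous c) (hv : Continuous v) :
    Continuous fun t => M.speed (c t) (v t) :=
  M.continuous_speed.comp (hc.prodMk hv)

theorem continuous_speed_deriv {c : ℝ → ℝ × ℝ} (hc : ContDiff ℝ 1 c) :
    Continuous fun t => M.speed (c t) (deriv c t) :=
  continuous_speed_comp hc.continuous (hc.continuous_deriv le_rfl)

theorem length_nonneg (c : ℝ → ℝ × ℝ) {a b : ℝ} (hab : a ≤ b) : 0 ≤ M.length c a b := by
  rw [length_eq]
  exact intervalIntegral.integral_nonneg hab fun t _ => M.speed_nonneg _ _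

theorem length_add {c : ℝ → ℝ × ℝ} (hc : ContDiff ℝ 1 c) (a b d : ℝ) :
    M.length c a b + M.length c b d = M.length c a d := by
  simp only [length_eq]
  exact intervalIntegral.integral_add_adjacent_intervals
    ((continuous_speed_deriv hc).intervalIntegrable _ _)
    ((continuous_speed_deriv hc).intervalIntegrable _ _)

theorem length_comp {c : ℝ → ℝ × ℝ} (hc : ContDiff ℝ 1 c) {φ : ℝ → ℝ} (hφ : ContDiff ℝ 1 φ)
    (hφm : Monotone φ) (a b : ℝ) : M.length (c ∘ φ) a b = M.length c (φ a) (φ b) := by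
  simp only [length_eq]
  rw [← intervalIntegral.integral_comp_mul_deriv (f := φ) (f' := deriv φ)
    (g := fun t => M.speed (c t) (deriv c t))
    (fun x _ => (hφ.differentiable (by simp) x).hasDerivAt)
    (hφ.continuous_deriv le_rfl).continuousOn (continuous_speed_deriv hc)]
  refine intervalIntegral.integral_congr fun t _ => ?_
  have h := ((hc.differentiable (by simp) (φ t)).hasDerivAt).scomp t
    (hφ.differentiable (by simp) t).hasDerivAt
  simp only [Function.comp]
  rw [h.deriv, speed_smul, abs_of_nonneg hφm.deriv_nonneg]
  ring

theorem bddBelow_lengths (x y : ℝ × ℝ) : BddBelow {L | ∃ c : ℝ → ℝ × ℝ, ContDiff ℝ 1 c ∧ c 0 = x ∧ c 1 = y ∧ L = M.length c 0 1} := by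
  refine ⟨0, ?_⟩
  rintro L ⟨c, -, -, -, rfl⟩
  exact length_nonneg c zero_le_one

theorem nonempty_lengths (x y : ℝ × ℝ) : {L | ∃ c : ℝ → ℝ × ℝ, ContDiff ℝ 1 c ∧ c 0 = x ∧ c 1 = y ∧ L = M.length c 0 1}.Nonempty :=
  ⟨_, fun t => x + t • (y - x), by fun_prop, by simp, by simp, rfl⟩

theorem dist_nonneg (x y : ℝ × ℝ) : 0 ≤ M.dist x y := by
  apply Real.sInf_nonneg
  rintro L ⟨c, -, -, -, rfl⟩
  exact length_nonneg c zero_le_one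

theorem dist_le_length {c : ℝ → ℝ × ℝ} (hc : ContDiff ℝ 1 c) {a b : ℝ} (hab : a ≤ b) :
    M.dist (c a) (c b) ≤ M.length c a b := by
  have hφ : ContDiff ℝ 1 fun t : ℝ => a + t * (b - a) := by fun_prop
  have hm : Monotone fun t : ℝ => a + t * (b - a) := fun s t h => by
    have := sub_nonneg.2 hab
    dsimp only; gcongr
  have h := length_comp (M := M) hc hφ hm 0 1
  simp only [zero_mul, add_zero, one_mul, add_sub_cancel] at h
  rw [← h]
  exact csInf_le (bddBelow_lengths _ _) ⟨_, hc.comp hφ, by simp, by simp, rfl⟩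

theorem exists_length_lt {x y : ℝ × ℝ} {r : ℝ} (h : M.dist x y < r) :
    ∃ c : ℝ → ℝ × ℝ, ContDiff ℝ 1 c ∧ c 0 = x ∧ c 1 = y ∧ M.length c 0 1 < r := by
  obtain ⟨L, ⟨c, h1, h2, h3, rfl⟩, h4⟩ := exists_lt_of_csInf_lt (nonempty_lengths x y) h
  exact ⟨c, h1, h2, h3, h4⟩

theorem dist_self (x : ℝ × ℝ) : M.dist x x = 0 := by
  refine le_antisymm ?_ (dist_nonneg _ _)
  have := dist_le_length (M := M) (c := fun _ => x) contDiff_const (zero_le_one (α := ℝ))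
  have h0 : M.length (fun _ => x) 0 1 = 0 := by
    simp [length_eq, speed, ← G_apply]
  simpa [h0] using this

theorem dist_comm_le (x y : ℝ × ℝ) : M.dist y x ≤ M.dist x y := by
  refine le_of_forall_gt fun r hr => ?_
  obtain ⟨c, hc, h0, h1, hl⟩ := exists_length_lt hr
  have hc' : ContDiff ℝ 1 fun t => c (1 - t) := hc.comp (by fun_prop)
  have := dist_le_length (M := M) hc' (zero_le_one (α := ℝ))
  simp only [sub_zero, sub_self, h0, h1] at this
  refine this.trans_lt ?_
  have e : M.length (fun t => c (1 - t)) 0 1 = M.length c 0 1 := by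
    simp only [length_eq]
    have := intervalIntegral.integral_comp_sub_left (a := 0) (b := 1)
      (fun t => M.speed (c t) (deriv c t)) 1
    simp only [sub_zero, sub_self] at this
    rw [← this]
    refine intervalIntegral.integral_congr fun t _ => ?_
    have : deriv (fun t => c (1 - t)) t = - deriv c (1 - t) := by
      exact deriv_comp_const_sub (f := c) (a := 1) (x := t)
    simp only [this, speed_neg]
  rwa [e]

theorem dist_comm (x y : ℝ × ℝ) : M.dist x y = M.dist y x :=
  le_antisymm (dist_comm_le _ _) (dist_comm_le _ _)

theorem dist_triangle (x y z : ℝ × ℝ) : M.dist x z ≤ M.dist x y + M.dist y z := by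
  refine le_of_forall_pos_lt_add fun ε hε => ?_
  obtain ⟨c₁, hc₁, h10, h11, hl1⟩ := exists_length_lt (M := M) (x := x) (y := y)
    (r := M.dist x y + ε / 2) (by linarith)
  obtain ⟨c₂, hc₂, h20, h21, hl2⟩ := exists_length_lt (M := M) (x := y) (y := z)
    (r := M.dist y z + ε / 2) (by linarith)
  have hst : ContDiff ℝ 1 Real.smoothTransition := Real.smoothTransition.contDiff
  set φ₁ : ℝ → ℝ := fun t => Real.smoothTransition (2 * t) with hφ₁
  set φ₂ : ℝ → ℝ := fun t => Real.smoothTransition (2 * t - 1) with hφ₂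
  have d1 : ContDiff ℝ 1 φ₁ := hst.comp (by fun_prop)
  have d2 : ContDiff ℝ 1 φ₂ := hst.comp (by fun_prop)
  have m1 : Monotone φ₁ := fun s t h => Real.smoothTransition.monotone (by linarith)
  have m2 : Monotone φ₂ := fun s t h => Real.smoothTransition.monotone (by linarith)
  set c : ℝ → ℝ × ℝ := fun t => (c₁ ∘ φ₁) t + ((c₂ ∘ φ₂) t - y) with hcdef
  have hc : ContDiff ℝ 1 c := (hc₁.comp d1).add ((hc₂.comp d2).sub contDiff_const)
  have e1 : ∀ t, t ≤ 1/2 → c t = (c₁ ∘ φ₁) t := fun t ht => by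
    have : φ₂ t = 0 := Real.smoothTransition.zero_of_nonpos (by linarith)
    simp [hcdef, this, h20]
  have e2 : ∀ t, 1/2 ≤ t → c t = (c₂ ∘ φ₂) t := fun t ht => by
    have : φ₁ t = 1 := Real.smoothTransition.one_of_one_le (by linarith)
    simp [hcdef, this, h11]
  have l1 : M.length c 0 (1/2) = M.length c₁ 0 1 := by
    have : M.length (c₁ ∘ φ₁) 0 (1/2) = M.length c₁ 0 1 := by
      rw [length_comp hc₁ d1 m1]; norm_num [hφ₁]
    rw [← this]
    simp only [length_eq]
    refine intervalIntegral.integral_congr_Ioo_of_le (by norm_num) fun t ht => ?_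
    have he : c =ᶠ[𝓝 t] c₁ ∘ φ₁ := by
      filter_upwards [Iio_mem_nhds ht.2] with s hs using e1 s (le_of_lt hs)
    simp only [he.deriv_eq, he.eq_of_nhds]
  have l2 : M.length c (1/2) 1 = M.length c₂ 0 1 := by
    have : M.length (c₂ ∘ φ₂) (1/2) 1 = M.length c₂ 0 1 := by
      rw [length_comp hc₂ d2 m2]; norm_num [hφ₂]
    rw [← this]
    simp only [length_eq]
    refine intervalIntegral.integral_congr_Ioo_of_le (by norm_num) fun t ht => ?_
    have he : c =ᶠ[𝓝 t] c₂ ∘ φ₂ := by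
      filter_upwards [Ioi_mem_nhds ht.1] with s hs using e2 s (le_of_lt hs)
    simp only [he.deriv_eq, he.eq_of_nhds]
  have h := dist_le_length (M := M) hc (zero_le_one (α := ℝ))
  have c0 : c 0 = x := by rw [e1 0 (by norm_num)]; simp [hφ₁, h10]
  have c1 : c 1 = z := by rw [e2 1 (by norm_num)]; norm_num [hφ₂, h21]
  rw [c0, c1, ← length_add hc 0 (1/2) 1, l1, l2] at h
  linarith

theorem abs_dist_sub_le (x y z : ℝ × ℝ) : |M.dist x z - M.dist y z| ≤ M.dist x y := by
  rw [abs_le]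
  constructor <;> linarith [dist_triangle (M := M) x y z, dist_triangle (M := M) y x z,
    dist_comm (M := M) x y]

theorem cm_norm_sub_le_length {c : ℝ → ℝ × ℝ} (hc : ContDiff ℝ 1 c) {a b : ℝ} (hab : a ≤ b) :
    M.cm * ‖c b - c a‖ ≤ M.length c a b := by
  have h : ∫ t in a..b, deriv c t = c b - c a :=
    intervalIntegral.integral_deriv_eq_sub (fun t _ => hc.differentiable (by simp) t)
      ((hc.continuous_deriv le_rfl).intervalIntegrable _ _)
  rw [← h, length_eq]
  calc M.cm * ‖∫ t in a..b, deriv c t‖ ≤ M.cm * ∫ t in a..b, ‖deriv c t‖ := by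
        have := M.cm_pos
        gcongr
        exact intervalIntegral.norm_integral_le_integral_norm hab
    _ = ∫ t in a..b, M.cm * ‖deriv c t‖ := by rw [intervalIntegral.integral_const_mul]
    _ ≤ _ := by
        apply intervalIntegral.integral_mono_on hab
        · exact (continuous_const.mul (hc.continuous_deriv le_rfl).norm).intervalIntegrable _ _
        · exact (continuous_speed_deriv hc).intervalIntegrable _ _
        · exact fun t _ => M.le_speed _ _

theorem cm_norm_le_dist (x y : ℝ × ℝ) : M.cm * ‖y - x‖ ≤ M.dist x y := by
  refine le_of_forall_gt fun r hr => ?_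
  obtain ⟨c, hc, h0, h1, hl⟩ := exists_length_lt hr
  have := cm_norm_sub_le_length (M := M) hc (zero_le_one (α := ℝ))
  rw [h0, h1] at this
  linarith

theorem dist_le_speed (x y : ℝ × ℝ) :
    M.dist x y ≤ M.speed x (y - x) + M.cK * ‖y - x‖ ^ 2 := by
  set c : ℝ → ℝ × ℝ := fun t => x + t • (y - x) with hcd
  have hc : ContDiff ℝ 1 c := by fun_prop
  have h := dist_le_length (M := M) hc (zero_le_one (α := ℝ))
  have hd : ∀ t, deriv c t = y - x := fun t => by
    have : HasDerivAt c ((1 : ℝ) • (y - x)) t := ((hasDerivAt_id t).smul_const (y - x)).const_add x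
    simpa using this.deriv
  have h0 : c 0 = x := by simp [hcd]
  have h1 : c 1 = y := by simp [hcd]
  rw [h0, h1] at h
  refine h.trans ?_
  rw [length_eq]
  have : ∫ t in (0:ℝ)..1, M.speed (c t) (deriv c t)
      ≤ ∫ t in (0:ℝ)..1, (M.speed x (y - x) + M.cK * ‖y - x‖ ^ 2) := by
    apply intervalIntegral.integral_mono_on zero_le_one
    · exact (continuous_speed_deriv hc).intervalIntegrable _ _
    · exact continuous_const.intervalIntegrable _ _
    · intro t ht
      rw [hd]
      have := (abs_le.1 (M.speed_lip (c t) x (y - x))).2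
      have hn : ‖c t - x‖ ≤ ‖y - x‖ := by
        simp only [hcd, add_sub_cancel_left, norm_smul, Real.norm_eq_abs, abs_of_nonneg ht.1]
        exact mul_le_of_le_one_left (norm_nonneg _) ht.2
      have h3 : M.cK * ‖c t - x‖ * ‖y - x‖ ≤ M.cK * ‖y - x‖ * ‖y - x‖ := by
        have := M.cK_pos
        gcongr
      nlinarith
  simpa using this

theorem dist_le (x y : ℝ × ℝ) : M.dist x y ≤ M.cC * ‖y - x‖ := by
  set c : ℝ → ℝ × ℝ := fun t => x + t • (y - x) with hcd
  have hc : ContDiff ℝ 1 c := by fun_prop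
  have h := dist_le_length (M := M) hc (zero_le_one (α := ℝ))
  have hd : ∀ t, deriv c t = y - x := fun t => by
    have : HasDerivAt c ((1 : ℝ) • (y - x)) t := ((hasDerivAt_id t).smul_const (y - x)).const_add x
    simpa using this.deriv
  have h0 : c 0 = x := by simp [hcd]
  have h1 : c 1 = y := by simp [hcd]
  rw [h0, h1] at h
  refine h.trans ?_
  rw [length_eq]
  have : ∫ t in (0:ℝ)..1, M.speed (c t) (deriv c t) ≤ ∫ t in (0:ℝ)..1, M.cC * ‖y - x‖ := by
    apply intervalIntegral.integral_mono_on zero_le_one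
    · exact (continuous_speed_deriv hc).intervalIntegrable _ _
    · exact continuous_const.intervalIntegrable _ _
    · intro t ht
      rw [hd]
      exact M.speed_le _ _
  simpa using this

theorem speed_le_length {c : ℝ → ℝ × ℝ} (hc : ContDiff ℝ 1 c) {x y : ℝ × ℝ} (h0 : c 0 = x)
    (h1 : c 1 = y) : M.speed x (y - x) ≤ M.length c 0 1 + M.cK / M.cm ^ 2 * M.length c 0 1 ^ 2 := by
  set Λ := M.length c 0 1 with hΛ
  have hm := M.cm_pos
  have hK := M.cK_pos
  have hΛ0 : 0 ≤ Λ := length_nonneg c zero_le_one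
  have cd := hc.continuous_deriv le_rfl
  have hcl : ∀ t ∈ Icc (0:ℝ) 1, ‖c t - x‖ ≤ Λ / M.cm := fun t ht => by
    rw [le_div_iff₀ hm]
    have a1 := cm_norm_sub_le_length (M := M) hc ht.1
    have a2 := length_add (M := M) hc 0 t 1
    have a3 := length_nonneg (M := M) c ht.2
    rw [h0] at a1
    linarith
  -- the speed measured at the initial point
  have hsp : ∫ t in (0:ℝ)..1, M.speed x (deriv c t) ≤ Λ + M.cK / M.cm ^ 2 * Λ ^ 2 := by
    have : ∫ t in (0:ℝ)..1, M.speed x (deriv c t)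
        ≤ ∫ t in (0:ℝ)..1, (1 + M.cK / M.cm ^ 2 * Λ) * M.speed (c t) (deriv c t) := by
      apply intervalIntegral.integral_mono_on zero_le_one
      · exact (continuous_speed_comp continuous_const cd).intervalIntegrable _ _
      · exact (continuous_const.mul (continuous_speed_deriv hc)).intervalIntegrable _ _
      · intro t ht
        have b1 := (abs_le.1 (M.speed_lip (c t) x (deriv c t))).1
        have b2 := M.le_speed (c t) (deriv c t)
        have b3 := hcl t ht
        have b4 : ‖deriv c t‖ ≤ M.speed (c t) (deriv c t) / M.cm := by
          rw [le_div_iff₀ hm]; linarith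
        have b5 : M.cK * ‖c t - x‖ * ‖deriv c t‖
            ≤ M.cK * (Λ / M.cm) * (M.speed (c t) (deriv c t) / M.cm) := by gcongr
        have b6 : M.cK * (Λ / M.cm) * (M.speed (c t) (deriv c t) / M.cm)
          = M.cK / M.cm ^ 2 * Λ * M.speed (c t) (deriv c t) := by field_simp
        linarith
    rw [intervalIntegral.integral_const_mul, ← length_eq, ← hΛ] at this
    linarith [this, show (1 + M.cK / M.cm ^ 2 * Λ) * Λ = Λ + M.cK / M.cm ^ 2 * Λ ^ 2 by ring]
  refine le_trans ?_ hsp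
  have h_eq_int : ∫ t in (0:ℝ)..1, deriv c t = y - x := by
    rw [← h0, ← h1]
    exact intervalIntegral.integral_deriv_eq_sub (fun t _ => hc.differentiable (by simp) t)
      (cd.intervalIntegrable _ _)
  set w := y - x
  rcases eq_or_ne w 0 with hw | hw
  · have : M.speed x w = 0 := by rw [hw]; simp [speed, ← G_apply]
    rw [this]
    exact intervalIntegral.integral_nonneg zero_le_one fun t _ => M.speed_nonneg _ _
  have hsw : 0 < M.speed x w := Real.sqrt_pos.2 (M.posdef x w hw)
  have e1 : M.speed x w ^ 2 = ∫ t in (0:ℝ)..1, M.G x w (deriv c t) := by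
    rw [speed_sq, ← G_apply]
    conv_lhs => rw [← h_eq_int]
    rw [h_eq_int]
    rw [ContinuousLinearMap.intervalIntegral_comp_comm (M.G x w) (cd.intervalIntegrable _ _), h_eq_int]
  have e2 : ∫ t in (0:ℝ)..1, M.G x w (deriv c t)
      ≤ ∫ t in (0:ℝ)..1, M.speed x w * M.speed x (deriv c t) := by
    apply intervalIntegral.integral_mono_on zero_le_one
    · exact ((M.G x w).continuous.comp cd).intervalIntegrable _ _
    · exact (continuous_const.mul (continuous_speed_comp continuous_const cd)).intervalIntegrable _ _
    · intro t _
      rw [G_apply]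
      exact M.g_cauchy_schwarz _ _ _
  rw [intervalIntegral.integral_const_mul, ← e1, sq] at e2
  exact le_of_mul_le_mul_left e2 hsw

theorem speed_le_dist (x y : ℝ × ℝ) :
    M.speed x (y - x) ≤ M.dist x y + M.cK / M.cm ^ 2 * M.dist x y ^ 2 := by
  have hcont : Continuous fun r : ℝ => r + M.cK / M.cm ^ 2 * r ^ 2 := by fun_prop
  refine ge_of_tendsto (x := 𝓝[>] (M.dist x y)) (hcont.continuousWithinAt.tendsto) ?_
  filter_upwards [self_mem_nhdsWithin] with r hr
  obtain ⟨c, hc, h0, h1, hl⟩ := exists_length_lt (M := M) hr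
  have := speed_le_length (M := M) hc h0 h1
  have h0 := length_nonneg (M := M) c (zero_le_one (α := ℝ))
  have hm := M.cm_pos
  have hK := M.cK_pos
  refine this.trans ?_
  gcongr

theorem dist_add_lat (x y : ℝ × ℝ) (k : ℤ × ℤ) :
    M.dist (x + lat k) (y + lat k) = M.dist x y := by
  have key : ∀ (k : ℤ × ℤ) x y, M.dist (x + lat k) (y + lat k) ≤ M.dist x y := by
    intro k x y
    refine le_of_forall_gt fun r hr => ?_
    obtain ⟨c, hc, h0, h1, hl⟩ := exists_length_lt (M := M) hr
    have := dist_le_length (M := M) (c := fun t => c t + lat k) (hc.add contDiff_const)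
      (zero_le_one (α := ℝ))
    rw [h0, h1] at this
    refine this.trans_lt ?_
    have e : M.length (fun t => c t + lat k) 0 1 = M.length c 0 1 := by
      simp only [length, deriv_add_const, M.periodic]
    rwa [e]
  refine le_antisymm (key k x y) ?_
  have := key (-k) (x + lat k) (y + lat k)
  have hk : lat (-k) = - lat k := by simp [lat]
  simpa [hk] using this

theorem dist_sub_lat (x y : ℝ × ℝ) (k : ℤ × ℤ) :
    M.dist (x - lat k) (y - lat k) = M.dist x y := by
  rw [← dist_add_lat _ _ k]; simp

theorem dist_eq_zero {x y : ℝ × ℝ} (h : M.dist x y = 0) : x = y := by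
  have h1 := cm_norm_le_dist (M := M) x y
  have h2 : ‖y - x‖ ≤ 0 := by
    have := M.cm_pos
    by_contra hh
    push Not at hh
    have := mul_pos this hh
    linarith
  exact (sub_eq_zero.1 (norm_le_zero_iff.1 h2)).symm

theorem continuous_dist : Continuous fun p : (ℝ × ℝ) × (ℝ × ℝ) => M.dist p.1 p.2 := by
  rw [continuous_iff_continuousAt]
  rintro ⟨x, y⟩
  rw [ContinuousAt, tendsto_iff_norm_sub_tendsto_zero]
  have hb : Tendsto (fun p : (ℝ × ℝ) × (ℝ × ℝ) => M.cC * ‖p.1 - x‖ + M.cC * ‖p.2 - y‖)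
      (𝓝 (x, y)) (𝓝 0) := by
    have : Continuous fun p : (ℝ × ℝ) × (ℝ × ℝ) => M.cC * ‖p.1 - x‖ + M.cC * ‖p.2 - y‖ := by
      fun_prop
    simpa using this.tendsto (x, y)
  refine squeeze_zero (fun _ => norm_nonneg _) (fun p => ?_) hb
  have h1 := abs_dist_sub_le (M := M) p.1 x p.2
  have h2 := abs_dist_sub_le (M := M) p.2 y x
  rw [dist_comm p.2 x, dist_comm y x] at h2
  have h3 := dist_le (M := M) x p.1
  have h4 := dist_le (M := M) y p.2
  rw [dist_comm] at h3 h4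
  rw [Real.norm_eq_abs]
  calc |M.dist p.1 p.2 - M.dist x y|
      ≤ |M.dist p.1 p.2 - M.dist x p.2| + |M.dist x p.2 - M.dist x y| := abs_sub_le _ _ _
    _ ≤ _ := by linarith

end TorusMetric

/-- A continuous curve with second differences of order `h ^ (3/2)` is of class `C¹`, with a
Hölder bound for the difference quotients. -/
theorem c1_of_second_diff {E : Type*} [NormedAddCommGroup E] [NormedSpace ℝ E] [CompleteSpace E]
    {γ : ℝ → E} (hγ : Continuous γ) {a b B : ℝ} (hB : 0 ≤ B)
    (hd : ∀ s h, 0 < h → h ≤ 1 → a ≤ s - h → s + h ≤ b →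
      ‖γ (s + h) - (2 : ℝ) • γ s + γ (s - h)‖ ≤ B * (h * √h)) :
    (∀ s ∈ Ioo a b, DifferentiableAt ℝ γ s) ∧ ContinuousOn (deriv γ) (Ioo a b) ∧
      ∀ s h, a < s → 0 < h → h ≤ 1 → s + h < b →
        ‖h⁻¹ • (γ (s + h) - γ s) - deriv γ s‖ ≤ 4 * B * √h := by
  set q : ℝ → ℝ → E := fun h s => h⁻¹ • (γ (s + h) - γ s) with hq
  have step : ∀ s h, a ≤ s → 0 < h → h ≤ 1 → s + h ≤ b →
      ‖q h s - q (h / 2) s‖ ≤ B * √(h / 2) / 2 := by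
    intro s h hs h0 h1 hb
    have e : q h s - q (h / 2) s
        = h⁻¹ • (γ (s + h / 2 + h / 2) - (2 : ℝ) • γ (s + h / 2) + γ (s + h / 2 - h / 2)) := by
      simp only [hq]
      rw [show s + h / 2 + h / 2 = s + h by ring, show s + h / 2 - h / 2 = s by ring,
        show (h / 2)⁻¹ = h⁻¹ * 2 by field_simp]
      module
    rw [e, norm_smul, Real.norm_eq_abs, abs_of_pos (inv_pos.2 h0)]
    have := hd (s + h / 2) (h / 2) (by linarith) (by linarith) (by linarith) (by linarith)
    calc h⁻¹ * _ ≤ h⁻¹ * (B * (h / 2 * √(h / 2))) := by gcongr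
      _ = _ := by field_simp
  have geo : ∀ s h, a ≤ s → 0 < h → h ≤ 1 → s + h ≤ b → ∀ n : ℕ,
      dist (q (h / 2 ^ n) s) (q (h / 2 ^ (n + 1)) s) ≤ B * √h * (3 / 4 : ℝ) ^ n := by
    intro s h hs h0 h1 hb n
    have hn : h / 2 ^ n ≤ h := div_le_self h0.le (one_le_pow₀ (by norm_num))
    have := step s (h / 2 ^ n) hs (by positivity) (by linarith) (by linarith)
    rw [dist_eq_norm]
    have e1 : h / 2 ^ n / 2 = h / 2 ^ (n + 1) := by rw [pow_succ]; field_simp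
    rw [e1] at this
    refine this.trans ?_
    have e2 : √(h / 2 ^ (n + 1)) ≤ √h * (3 / 4 : ℝ) ^ n := by
      rw [Real.sqrt_le_left (by positivity)]
      rw [mul_pow, Real.sq_sqrt h0.le, ← pow_mul, mul_comm n 2, pow_mul]
      rw [div_eq_mul_inv]
      gcongr
      rw [← inv_pow, pow_succ]
      calc (2⁻¹ : ℝ) ^ n * 2⁻¹ ≤ ((3 / 4) ^ 2) ^ n * 1 := by gcongr <;> norm_num
        _ = _ := by ring
    have : 0 ≤ √h * (3 / 4 : ℝ) ^ n := by positivity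
    have := mul_le_mul_of_nonneg_left e2 hB
    nlinarith
  have key : ∀ s₀ ∈ Ioo a b, ∃ V : ℝ → E, ∃ S, IsOpen S ∧ s₀ ∈ S ∧ ContinuousOn V S ∧
      ∀ s ∈ S, HasDerivAt γ (V s) s := by
    intro s₀ hs₀
    set S := Ioo a (s₀ + (b - s₀) / 2) with hS
    set h₀ := min 1 ((b - s₀) / 2) with hh₀
    have h0 : 0 < h₀ := lt_min one_pos (by linarith [hs₀.2])
    have h1 : h₀ ≤ 1 := min_le_left _ _
    have h2 : ∀ s ∈ S, s + h₀ ≤ b := fun s hs => by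
      have := hs.2; have := min_le_right 1 ((b - s₀) / 2); linarith
    have hconv : ∀ s : ℝ, ∃ v : E, s ∈ S → Tendsto (fun n : ℕ => q (h₀ / 2 ^ n) s) atTop (𝓝 v) := by
      intro s
      by_cases hs : s ∈ S
      · obtain ⟨v, hv⟩ := cauchySeq_tendsto_of_complete
          (cauchySeq_of_le_geometric _ _ (by norm_num) (geo s h₀ hs.1.le h0 h1 (h2 s hs)))
        exact ⟨v, fun _ => hv⟩
      · exact ⟨0, fun h => absurd h hs⟩
    choose V hV using hconv
    have hunif : TendstoUniformlyOn (fun n : ℕ => q (h₀ / 2 ^ n)) V atTop S := by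
      rw [Metric.tendstoUniformlyOn_iff]
      intro ε hε
      have ht : Tendsto (fun n : ℕ => B * √h₀ * (3 / 4 : ℝ) ^ n / (1 - 3 / 4)) atTop (𝓝 0) := by
        have := (tendsto_pow_atTop_nhds_zero_of_lt_one (r := (3 / 4 : ℝ)) (by norm_num)
          (by norm_num)).const_mul (B * √h₀)
        simpa using this.div_const (1 - 3 / 4)
      filter_upwards [ht.eventually (gt_mem_nhds hε)] with n hn s hs
      rw [dist_comm]
      exact (dist_le_of_le_geometric_of_tendsto _ _ (by norm_num)
        (geo s h₀ hs.1.le h0 h1 (h2 s hs)) (hV s hs) n).trans_lt hn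
    have hqc : ∀ h, Continuous (q h) := fun h => by fun_prop
    refine ⟨V, S, isOpen_Ioo, ⟨hs₀.1, by linarith [hs₀.2]⟩,
      hunif.continuousOn (Frequently.of_forall fun n => (hqc _).continuousOn), ?_⟩
    intro s hs
    set Γ : ℝ → E := fun t => ∫ u in (0:ℝ)..t, γ u with hΓ
    have dΓ : ∀ t, HasDerivAt Γ (γ t) t := fun t => (hγ.integral_hasStrictDerivAt 0 t).hasDerivAt
    refine hasDerivAt_of_tendstoUniformlyOn isOpen_Ioo hunif
      (f := fun n s => (h₀ / 2 ^ n)⁻¹ • (Γ (s + h₀ / 2 ^ n) - Γ s)) ?_ ?_ hs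
    · refine Eventually.of_forall fun n s _ => ?_
      have := (((dΓ (s + h₀ / 2 ^ n)).comp_add_const s (h₀ / 2 ^ n)).sub (dΓ s)).const_smul
        (h₀ / 2 ^ n)⁻¹
      exact this
    · intro s _
      have h3 := (hasDerivAt_iff_tendsto_slope_zero.1 (dΓ s))
      refine h3.comp ?_
      rw [tendsto_nhdsWithin_iff]
      refine ⟨?_, Eventually.of_forall fun n => by simp [h0.ne']⟩
      have := (tendsto_pow_atTop_nhds_zero_of_lt_one (r := (1 / 2 : ℝ)) (by norm_num)
          (by norm_num)).const_mul h₀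
      simpa [div_eq_mul_inv] using this
  have hdiff : ∀ s ∈ Ioo a b, DifferentiableAt ℝ γ s := fun s hs => by
    obtain ⟨V, S, -, hsS, -, hV⟩ := key s hs
    exact (hV s hsS).differentiableAt
  refine ⟨hdiff, ?_, ?_⟩
  · intro s hs
    obtain ⟨V, S, hS, hsS, hc, hV⟩ := key s hs
    have : ContinuousAt (deriv γ) s :=
      (hc.continuousAt (hS.mem_nhds hsS)).congr
        (by filter_upwards [hS.mem_nhds hsS] with t ht using ((hV t ht).deriv).symm)
    exact this.continuousWithinAt
  · intro s h hs h0 h1 hb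
    have hlim : Tendsto (fun n : ℕ => q (h / 2 ^ n) s) atTop (𝓝 (deriv γ s)) := by
      have h3 := (hasDerivAt_iff_tendsto_slope_zero.1 (hdiff s ⟨hs, by linarith⟩).hasDerivAt)
      refine h3.comp ?_
      rw [tendsto_nhdsWithin_iff]
      refine ⟨?_, Eventually.of_forall fun n => by simp [h0.ne']⟩
      have := (tendsto_pow_atTop_nhds_zero_of_lt_one (r := (1 / 2 : ℝ)) (by norm_num)
          (by norm_num)).const_mul h
      simpa [div_eq_mul_inv] using this
    have := dist_le_of_le_geometric_of_tendsto₀ _ _ (by norm_num) (geo s h hs.le h0 h1 hb.le) hlim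
    rw [dist_eq_norm] at this
    simp only [pow_zero, div_one] at this
    refine this.trans (le_of_eq ?_)
    ring

namespace TorusMetric

variable {M : TorusMetric}

theorem g_parallelogram (y u w : ℝ × ℝ) :
    M.g y (u - w) (u - w) = 2 * M.g y u u + 2 * M.g y w w - M.g y (u + w) (u + w) := by
  simp only [← G_apply, map_sub, map_add, sub_apply, add_apply]
  ring

variable (M) in
/-- The curve `γ` is isometric (a minimal segment by arc length) on `[a, b]`. -/
def IsoOn (γ : ℝ → ℝ × ℝ) (a b : ℝ) : Prop :=
  ∀ s t, a ≤ s → s ≤ t → t ≤ b → M.dist (γ s) (γ t) = t - s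

theorem IsoOn.mono {γ : ℝ → ℝ × ℝ} {a b a' b' : ℝ} (h : M.IsoOn γ a b) (ha : a ≤ a') (hb : b' ≤ b) :
    M.IsoOn γ a' b' := fun s t h1 h2 h3 => h s t (ha.trans h1) h2 (h3.trans hb)

theorem IsoOn.norm_sub_le {γ : ℝ → ℝ × ℝ} {a b : ℝ} (h : M.IsoOn γ a b) {s t : ℝ} (hs : a ≤ s)
    (hst : s ≤ t) (ht : t ≤ b) : ‖γ t - γ s‖ ≤ (t - s) / M.cm := by
  rw [le_div_iff₀ M.cm_pos, ← h s t hs hst ht, mul_comm]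
  exact cm_norm_le_dist _ _

variable (M) in
/-- Constant in the second difference estimate for minimal segments. -/
def cB : ℝ := √((32 * (M.cK / M.cm ^ 2) + 64 * (M.cK / M.cm ^ 2) ^ 2) / M.cm ^ 2)

theorem IsoOn.second_diff {γ : ℝ → ℝ × ℝ} {a b : ℝ} (hγ : M.IsoOn γ a b) {s h : ℝ} (h0 : 0 < h)
    (h1 : h ≤ 1) (ha : a ≤ s - h) (hb : s + h ≤ b) :
    ‖γ (s + h) - (2 : ℝ) • γ s + γ (s - h)‖ ≤ M.cB * (h * √h) := by
  have hm := M.cm_pos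
  have hK := M.cK_pos
  set A := M.cK / M.cm ^ 2 with hA
  have hA0 : 0 < A := by positivity
  have d1 : M.dist (γ (s - h)) (γ s) = h := by
    rw [hγ (s - h) s ha (by linarith) (by linarith)]; ring
  have d2 : M.dist (γ s) (γ (s + h)) = h := by
    rw [hγ s (s + h) (by linarith) (by linarith) hb]; ring
  have d3 : M.dist (γ (s - h)) (γ (s + h)) = 2 * h := by
    rw [hγ (s - h) (s + h) ha (by linarith) hb]; ring
  have n1 := hγ.norm_sub_le ha (show s - h ≤ s by linarith) (by linarith)
  have n3 := hγ.norm_sub_le ha (show s - h ≤ s + h by linarith) hb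
  set x := γ (s - h)
  set y := γ s
  set z := γ (s + h)
  have s1 : M.speed y (y - x) ≤ h + A * h ^ 2 := by
    have := speed_le_dist (M := M) y x
    rw [dist_comm, d1, ← speed_neg, neg_sub] at this
    exact this
  have s2 : M.speed y (z - y) ≤ h + A * h ^ 2 := by
    have := speed_le_dist (M := M) y z
    rwa [d2] at this
  have s3 : 2 * h - 6 * A * h ^ 2 ≤ M.speed y (z - x) := by
    have a1 := dist_le_speed (M := M) x z
    have a2 := (abs_le.1 (M.speed_lip x y (z - x))).2
    have e1 : ‖x - y‖ ≤ h / M.cm := by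
      rw [norm_sub_rev]; convert! n1 using 2; ring
    have e2 : ‖z - x‖ ≤ 2 * h / M.cm := by
      convert! n3 using 2; ring
    have a3 : M.cK * ‖x - y‖ * ‖z - x‖ ≤ M.cK * (h / M.cm) * (2 * h / M.cm) := by gcongr
    have a4 : M.cK * ‖z - x‖ ^ 2 ≤ M.cK * (2 * h / M.cm) ^ 2 := by gcongr
    have e3 : M.cK * (h / M.cm) * (2 * h / M.cm) = 2 * A * h ^ 2 := by rw [hA]; field_simp
    have e4 : M.cK * (2 * h / M.cm) ^ 2 = 4 * A * h ^ 2 := by rw [hA]; field_simp; norm_num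
    rw [d3] at a1
    linarith
  have hpar := g_parallelogram (M := M) y (y - x) (z - y)
  simp only [← speed_sq] at hpar
  rw [show y - x + (z - y) = z - x by abel] at hpar
  have hb1 : M.speed y (y - x - (z - y)) ^ 2 ≤ (32 * A + 64 * A ^ 2) * h ^ 3 := by
    have q1 : M.speed y (y - x) ^ 2 ≤ (h + A * h ^ 2) ^ 2 :=
      pow_le_pow_left₀ (M.speed_nonneg _ _) s1 2
    have q2 : M.speed y (z - y) ^ 2 ≤ (h + A * h ^ 2) ^ 2 :=
      pow_le_pow_left₀ (M.speed_nonneg _ _) s2 2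
    have h3 : 0 < h ^ 3 := by positivity
    have h4 : h ^ 4 ≤ h ^ 3 := pow_le_pow_of_le_one h0.le h1 (by norm_num)
    have h4' := mul_le_mul_of_nonneg_left h4 (sq_nonneg A)
    rcases le_or_gt 0 (2 * h - 6 * A * h ^ 2) with hp | hp
    · have q3 : (2 * h - 6 * A * h ^ 2) ^ 2 ≤ M.speed y (z - x) ^ 2 := pow_le_pow_left₀ hp s3 2
      nlinarith [mul_pos (pow_pos hA0 2) (pow_pos h0 4), mul_pos hA0 h3]
    · have hh : 1 < 3 * (A * h) := by
        by_contra hc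
        push Not at hc
        nlinarith
      have q4 : h + A * h ^ 2 ≤ 4 * (A * h ^ 2) := by nlinarith
      have q5 : (h + A * h ^ 2) ^ 2 ≤ (4 * (A * h ^ 2)) ^ 2 := pow_le_pow_left₀ (by positivity) q4 2
      nlinarith [sq_nonneg (M.speed y (z - x)), mul_pos hA0 h3]
  have hb2 : (M.cm * ‖z - (2 : ℝ) • y + x‖) ^ 2 ≤ (32 * A + 64 * A ^ 2) * h ^ 3 := by
    refine le_trans ?_ hb1
    have e : ‖z - (2 : ℝ) • y + x‖ = ‖y - x - (z - y)‖ := by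
      rw [← norm_neg]; congr 1; module
    rw [e]
    exact pow_le_pow_left₀ (by positivity) (M.le_speed _ _) 2
  have e5 : M.cB * (h * √h) = √((32 * A + 64 * A ^ 2) / M.cm ^ 2 * h ^ 3) := by
    rw [cB, ← hA, Real.sqrt_mul (by positivity)]
    congr 1
    rw [show h ^ 3 = h ^ 2 * h by ring, Real.sqrt_mul (by positivity), Real.sqrt_sq h0.le]
  rw [e5]
  apply Real.le_sqrt_of_sq_le
  rw [div_mul_eq_mul_div, le_div_iff₀ (by positivity)]
  linarith [hb2, mul_pow M.cm ‖z - (2 : ℝ) • y + x‖ 2]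

theorem cB_nonneg : 0 ≤ M.cB := Real.sqrt_nonneg _

theorem IsoOn.differentiableAt {γ : ℝ → ℝ × ℝ} {a b : ℝ} (hc : Continuous γ) (hγ : M.IsoOn γ a b)
    {s : ℝ} (hs : s ∈ Ioo a b) : DifferentiableAt ℝ γ s :=
  (c1_of_second_diff hc (cB_nonneg (M := M))
    fun _ _ h0 h1 ha hb => hγ.second_diff h0 h1 ha hb).1 s hs

theorem IsoOn.continuousOn_deriv {γ : ℝ → ℝ × ℝ} {a b : ℝ} (hc : Continuous γ)
    (hγ : M.IsoOn γ a b) : ContinuousOn (deriv γ) (Ioo a b) :=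
  (c1_of_second_diff hc (cB_nonneg (M := M))
    fun _ _ h0 h1 ha hb => hγ.second_diff h0 h1 ha hb).2.1

theorem IsoOn.slope_sub_deriv_le {γ : ℝ → ℝ × ℝ} {a b : ℝ} (hc : Continuous γ)
    (hγ : M.IsoOn γ a b) {s h : ℝ} (hs : a < s) (h0 : 0 < h) (h1 : h ≤ 1) (hb : s + h < b) :
    ‖h⁻¹ • (γ (s + h) - γ s) - deriv γ s‖ ≤ 4 * M.cB * √h :=
  (c1_of_second_diff hc (cB_nonneg (M := M))
    fun _ _ h0 h1 ha hb => hγ.second_diff h0 h1 ha hb).2.2 s h hs h0 h1 hb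

theorem IsoOn.speed_deriv {γ : ℝ → ℝ × ℝ} {a b : ℝ} (hc : Continuous γ)
    (hγ : M.IsoOn γ a b) {s : ℝ} (hs : s ∈ Ioo a b) : M.speed (γ s) (deriv γ s) = 1 := by
  have hd := (hγ.differentiableAt hc hs).hasDerivAt
  have h3 : Tendsto (fun h : ℝ => h⁻¹ • (γ (s + h) - γ s)) (𝓝[>] 0) (𝓝 (deriv γ s)) :=
    (hasDerivAt_iff_tendsto_slope_zero.1 hd).mono_left
      (nhdsWithin_mono _ fun x hx => (ne_of_gt hx))
  have h4 : Tendsto (fun h : ℝ => M.speed (γ s) (h⁻¹ • (γ (s + h) - γ s))) (𝓝[>] 0)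
      (𝓝 (M.speed (γ s) (deriv γ s))) := by
    have hcs : Continuous fun v => M.speed (γ s) v :=
      M.continuous_speed.comp (continuous_const.prodMk continuous_id)
    exact (hcs.tendsto _).comp h3
  have hm := M.cm_pos
  have hK := M.cK_pos
  have hev : ∀ᶠ h : ℝ in 𝓝[>] 0, 0 < h ∧ s + h < b := by
    filter_upwards [Ioo_mem_nhdsGT (show (0:ℝ) < b - s by linarith [hs.2])] with h hh
    exact ⟨hh.1, by linarith [hh.2]⟩
  have t0 : Tendsto (fun h : ℝ => h) (𝓝[>] 0) (𝓝 0) := nhdsWithin_le_nhds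
  apply le_antisymm
  · have : Tendsto (fun h : ℝ => 1 + M.cK / M.cm ^ 2 * h) (𝓝[>] 0) (𝓝 1) := by
      simpa using (t0.const_mul (M.cK / M.cm ^ 2)).const_add 1
    refine le_of_tendsto_of_tendsto h4 this ?_
    filter_upwards [hev] with h hh
    have a1 := speed_le_dist (M := M) (γ s) (γ (s + h))
    rw [hγ s (s + h) hs.1.le (by linarith) hh.2.le, add_sub_cancel_left] at a1
    rw [speed_smul, abs_of_pos (inv_pos.2 hh.1), inv_mul_le_iff₀ hh.1]
    linarith
  · have : Tendsto (fun h : ℝ => 1 - M.cK / M.cm ^ 2 * h) (𝓝[>] 0) (𝓝 1) := by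
      simpa using (t0.const_mul (M.cK / M.cm ^ 2)).const_sub 1
    refine le_of_tendsto_of_tendsto this h4 ?_
    filter_upwards [hev] with h hh
    have a1 := dist_le_speed (M := M) (γ s) (γ (s + h))
    have a2 := hγ.norm_sub_le hs.1.le (show s ≤ s + h by linarith) hh.2.le
    rw [hγ s (s + h) hs.1.le (by linarith) hh.2.le, add_sub_cancel_left] at a1
    rw [add_sub_cancel_left] at a2
    rw [speed_smul, abs_of_pos (inv_pos.2 hh.1), le_inv_mul_iff₀ hh.1]
    have a3 : M.cK * ‖γ (s + h) - γ s‖ ^ 2 ≤ M.cK * (h / M.cm) ^ 2 := by gcongr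
    have e : M.cK * (h / M.cm) ^ 2 = h * (M.cK / M.cm ^ 2 * h) := by field_simp
    linarith

end TorusMetric

theorem hasDerivAt_integral_line {E : Type*} [NormedAddCommGroup E] [NormedSpace ℝ E]
    {Φ : E → ℝ} (hΦ : ContDiff ℝ 1 Φ) {p q : ℝ → E} (hp : Continuous p) (hq : Continuous q)
    (a b : ℝ) :
    HasDerivAt (fun r : ℝ => ∫ t in a..b, Φ (p t + r • q t)) (∫ t in a..b, fderiv ℝ Φ (p t) (q t))
      0 := by
  have hF' : Continuous fun z : ℝ × ℝ => fderiv ℝ Φ (p z.2 + z.1 • q z.2) (q z.2) := by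
    have := hΦ.continuous_fderiv (by simp)
    fun_prop
  obtain ⟨C, hC⟩ := ((isCompact_Icc (a := (-1:ℝ)) (b := 1)).prod
    (isCompact_uIcc (a := a) (b := b))).exists_bound_of_continuousOn hF'.continuousOn
  have := (intervalIntegral.hasDerivAt_integral_of_dominated_loc_of_deriv_le
    (μ := MeasureTheory.volume) (a := a) (b := b) (x₀ := (0:ℝ)) (s := Icc (-1) 1)
    (F := fun r t => Φ (p t + r • q t))
    (F' := fun r t => fderiv ℝ Φ (p t + r • q t) (q t)) (bound := fun _ => C)
    (Icc_mem_nhds (by norm_num) (by norm_num)) ?_ ?_ ?_ ?_ ?_ ?_).2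
  · simpa using this
  · refine Eventually.of_forall fun r => Continuous.aestronglyMeasurable ?_
    have := hΦ.continuous
    fun_prop
  · refine Continuous.intervalIntegrable ?_ _ _
    have := hΦ.continuous
    fun_prop
  · refine Continuous.aestronglyMeasurable ?_
    exact hF'.comp (by fun_prop : Continuous fun t : ℝ => ((0 : ℝ), t))
  · refine Eventually.of_forall fun t ht r hr => ?_
    exact hC (r, t) ⟨hr, uIoc_subset_uIcc ht⟩
  · exact continuous_const.intervalIntegrable _ _
  · refine Eventually.of_forall fun t _ r _ => ?_
    have h1 : HasDerivAt (fun r : ℝ => p t + r • q t) (q t) r := by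
      simpa using ((hasDerivAt_id r).smul_const (q t)).const_add (p t)
    exact ((hΦ.differentiable (by simp) _).hasFDerivAt).comp_hasDerivAt r h1

/-- The lemma of du Bois-Reymond. -/
theorem hasDerivAt_of_integral_variation {P Q : ℝ → ℝ} (hP : Continuous P) (hQ : Continuous Q)
    {a b : ℝ} (hab : a < b) (h : ∀ φ : ℝ → ℝ, ContDiff ℝ 1 φ → φ a = 0 → φ b = 0 →
      ∫ t in a..b, (Q t * φ t + P t * deriv φ t) = 0) {t : ℝ} (ht : t ∈ Ioo a b) :
    HasDerivAt P (Q t) t := by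
  set R : ℝ → ℝ := fun t => ∫ u in a..t, Q u with hR
  have dR : ∀ t, HasDerivAt R (Q t) t := fun t => (hQ.integral_hasStrictDerivAt a t).hasDerivAt
  have cR : Continuous R := continuous_iff_continuousAt.2 fun t => (dR t).continuousAt
  set W : ℝ → ℝ := fun t => P t - R t with hW
  have cW : Continuous W := hP.sub cR
  set κ : ℝ := (b - a)⁻¹ * ∫ t in a..b, W t with hκ
  set φ : ℝ → ℝ := fun t => ∫ u in a..t, (W u - κ) with hφ
  have cWk : Continuous fun u => W u - κ := cW.sub continuous_const
  have dφ : ∀ t, HasDerivAt φ (W t - κ) t := fun t =>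
    (cWk.integral_hasStrictDerivAt a t).hasDerivAt
  have eφ : deriv φ = fun t => W t - κ := funext fun t => (dφ t).deriv
  have φ1 : ContDiff ℝ 1 φ := by
    rw [contDiff_one_iff_deriv, eφ]
    exact ⟨fun t => (dφ t).differentiableAt, cWk⟩
  have φa : φ a = 0 := by simp [hφ]
  have φb : φ b = 0 := by
    simp only [hφ]
    rw [intervalIntegral.integral_sub (cW.intervalIntegrable _ _)
      (continuous_const.intervalIntegrable _ _), intervalIntegral.integral_const, hκ]
    have : b - a ≠ 0 := by linarith
    simp only [smul_eq_mul]
    field_simp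
    ring
  have h1 := h φ φ1 φa φb
  have h2 : ∫ t in a..b, R t * (W t - κ) = - ∫ t in a..b, Q t * φ t := by
    have := intervalIntegral.integral_mul_deriv_eq_deriv_mul (u := R) (v := φ)
      (u' := Q) (v' := fun t => W t - κ) (a := a) (b := b) (fun t _ => dR t) (fun t _ => dφ t)
      (hQ.intervalIntegrable _ _) (cWk.intervalIntegrable _ _)
    rw [this, φa, φb]; ring
  have cφ : Continuous φ := φ1.continuous
  have i1 : IntervalIntegrable (fun t => Q t * φ t) MeasureTheory.volume a b :=
    (hQ.mul cφ).intervalIntegrable _ _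
  have i2 : IntervalIntegrable (fun t => P t * (W t - κ)) MeasureTheory.volume a b :=
    (hP.mul cWk).intervalIntegrable _ _
  simp only [eφ] at h1
  rw [intervalIntegral.integral_add i1 i2] at h1
  have h3 : ∫ t in a..b, κ * (W t - κ) = 0 := by
    rw [intervalIntegral.integral_const_mul]
    have : ∫ t in a..b, (W t - κ) = 0 := φb
    rw [this, mul_zero]
  have h4 : ∫ t in a..b, (W t - κ) ^ 2 = 0 := by
    have e : ∀ t, (W t - κ) ^ 2 = P t * (W t - κ) - R t * (W t - κ) - κ * (W t - κ) := fun t => by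
      simp only [hW]; ring
    simp_rw [e]
    rw [intervalIntegral.integral_sub, intervalIntegral.integral_sub, h3, h2]
    · linarith
    all_goals refine Continuous.intervalIntegrable ?_ _ _; fun_prop
  set H : ℝ → ℝ := fun t => ∫ u in a..t, (W u - κ) ^ 2 with hH
  have cH : Continuous fun u => (W u - κ) ^ 2 := cWk.pow 2
  have hH0 : ∀ t ∈ Icc a b, H t = 0 := by
    intro t ht
    have p1 : 0 ≤ H t := intervalIntegral.integral_nonneg ht.1 fun u _ => sq_nonneg _
    have p2 : 0 ≤ ∫ u in t..b, (W u - κ) ^ 2 :=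
      intervalIntegral.integral_nonneg ht.2 fun u _ => sq_nonneg _
    have p3 := intervalIntegral.integral_add_adjacent_intervals
      (cH.intervalIntegrable (μ := MeasureTheory.volume) a t) (cH.intervalIntegrable t b)
    simp only [hH] at p1 ⊢
    linarith
  have hWk : ∀ t ∈ Ioo a b, W t = κ := by
    intro t ht
    have d1 : HasDerivAt H ((W t - κ) ^ 2) t := (cH.integral_hasStrictDerivAt a t).hasDerivAt
    have d2 : HasDerivAt H 0 t := by
      refine (hasDerivAt_const t (0:ℝ)).congr_of_eventuallyEq ?_
      filter_upwards [Ioo_mem_nhds ht.1 ht.2] with u hu using hH0 u ⟨hu.1.le, hu.2.le⟩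
    have := d1.unique d2
    have := pow_eq_zero_iff (two_ne_zero) |>.1 this
    linarith
  refine ((dR t).add_const κ).congr_of_eventuallyEq ?_
  filter_upwards [Ioo_mem_nhds ht.1 ht.2] with u hu
  have := hWk u hu
  simp only [hW] at this
  linarith

/-- Solutions of a smooth autonomous equation are smooth. -/
theorem contDiff_of_hasDerivAt {E : Type*} [NormedAddCommGroup E] [NormedSpace ℝ E]
    {Ψ : E → E} (hΨ : ContDiff ℝ (⊤ : ℕ∞) Ψ) {u : ℝ → E} (hu : ∀ t, HasDerivAt u (Ψ (u t)) t) :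
    ContDiff ℝ (⊤ : ℕ∞) u := by
  rw [contDiff_infty]
  intro n
  induction n with
  | zero =>
    exact contDiff_zero.2 (continuous_iff_continuousAt.2 fun t => (hu t).continuousAt)
  | succ k ih =>
    have e : deriv u = fun t => Ψ (u t) := funext fun t => (hu t).deriv
    push_cast
    rw [contDiff_succ_iff_deriv, e]
    refine ⟨fun t => (hu t).differentiableAt, by simp, ?_⟩
    exact (contDiff_infty.1 hΨ k).comp ih

/-- Uniqueness for smooth autonomous equations. -/
theorem eq_of_hasDerivAt_autonomous {E : Type*} [NormedAddCommGroup E] [NormedSpace ℝ E]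
    [ProperSpace E]
    {Ψ : E → E} (hΨ : ContDiff ℝ 1 Ψ) {u v : ℝ → E} (hu : ∀ t, HasDerivAt u (Ψ (u t)) t)
    (hv : ∀ t, HasDerivAt v (Ψ (v t)) t) {t₀ : ℝ} (h : u t₀ = v t₀) : u = v := by
  have cu : Continuous u := continuous_iff_continuousAt.2 fun t => (hu t).continuousAt
  have cv : Continuous v := continuous_iff_continuousAt.2 fun t => (hv t).continuousAt
  ext t
  obtain ⟨A, B, Ht, Ht₀⟩ : ∃ A B, t ∈ Set.Ioo A B ∧ t₀ ∈ Set.Ioo A B := by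
    use (min (-|t|) (-|t₀|) - 1), (max |t| |t₀| + 1)
    grind
  set K := u '' Icc A B ∪ v '' Icc A B with hK
  have hKc : IsCompact K := (isCompact_Icc.image cu).union (isCompact_Icc.image cv)
  obtain ⟨C, hC⟩ := (hΨ.locallyLipschitz.locallyLipschitzOn (s := K)).exists_lipschitzOnWith_of_compact hKc
  exact ODE_solution_unique_of_mem_Ioo (v := fun _ => Ψ) (s := fun _ => K) (K := C)
    (fun _ _ => hC) Ht₀
    (fun s hs => ⟨hu s, Or.inl ⟨s, ⟨hs.1.le, hs.2.le⟩, rfl⟩⟩)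
    (fun s hs => ⟨hv s, Or.inr ⟨s, ⟨hs.1.le, hs.2.le⟩, rfl⟩⟩) h Ht

namespace TorusMetric

variable (M : TorusMetric)

/-- The quadratic form of the metric as a function on the tangent bundle. -/
def quad (p : (ℝ × ℝ) × (ℝ × ℝ)) : ℝ := M.g p.1 p.2 p.2

theorem contDiff_quad : ContDiff ℝ (⊤ : ℕ∞) M.quad :=
  M.smooth.comp (contDiff_fst.prodMk (contDiff_snd.prodMk contDiff_snd))

/-- The determinant of the metric. -/
def gdet (x : ℝ × ℝ) : ℝ :=
  M.g x (1, 0) (1, 0) * M.g x (0, 1) (0, 1) - M.g x (1, 0) (0, 1) ^ 2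

theorem gdet_pos (x : ℝ × ℝ) : 0 < M.gdet x := by
  have h1 := M.posdef x (1, 0) (by simp)
  set w : ℝ × ℝ := (-M.g x (1, 0) (0, 1), M.g x (1, 0) (1, 0)) with hw
  have h2 := M.posdef x w (by
    intro h
    have := congrArg Prod.snd h
    simp only [hw, Prod.snd_zero] at this
    exact h1.ne' this)
  rw [g_eq] at h2
  simp only [hw] at h2
  unfold gdet
  by_contra hc
  push Not at hc
  nlinarith

/-- The velocity with given momentum. -/
def vel (p : (ℝ × ℝ) × (ℝ × ℝ)) : ℝ × ℝ :=
  ((M.g p.1 (0, 1) (0, 1) * p.2.1 - M.g p.1 (1, 0) (0, 1) * p.2.2) / M.gdet p.1,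
   (M.g p.1 (1, 0) (1, 0) * p.2.2 - M.g p.1 (1, 0) (0, 1) * p.2.1) / M.gdet p.1)

/-- The momentum of a tangent vector. -/
def mom (x v : ℝ × ℝ) : ℝ × ℝ := (M.g x v (1, 0), M.g x v (0, 1))

theorem vel_mom (x v : ℝ × ℝ) : M.vel (x, M.mom x v) = v := by
  have hd := (M.gdet_pos x).ne'
  have s := M.symm x (0, 1) (1, 0)
  ext
  · simp only [vel, mom]
    rw [div_eq_iff hd, g_eq M x v, g_eq M x v, gdet]
    ring
  · simp only [vel, mom]
    rw [div_eq_iff hd, g_eq M x v, g_eq M x v, gdet]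
    ring

theorem contDiff_vel : ContDiff ℝ (⊤ : ℕ∞) M.vel := by
  have c1 := (M.contDiff_coeff (1, 0) (1, 0)).comp (contDiff_fst (𝕜 := ℝ) (E := ℝ × ℝ) (F := ℝ × ℝ))
  have c2 := (M.contDiff_coeff (1, 0) (0, 1)).comp (contDiff_fst (𝕜 := ℝ) (E := ℝ × ℝ) (F := ℝ × ℝ))
  have c3 := (M.contDiff_coeff (0, 1) (0, 1)).comp (contDiff_fst (𝕜 := ℝ) (E := ℝ × ℝ) (F := ℝ × ℝ))
  have cd : ContDiff ℝ (⊤ : ℕ∞) fun p : (ℝ × ℝ) × (ℝ × ℝ) => M.gdet p.1 :=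
    (c1.mul c3).sub (c2.pow 2)
  have y1 : ContDiff ℝ (⊤ : ℕ∞) fun p : (ℝ × ℝ) × (ℝ × ℝ) => p.2.1 := by fun_prop
  have y2 : ContDiff ℝ (⊤ : ℕ∞) fun p : (ℝ × ℝ) × (ℝ × ℝ) => p.2.2 := by fun_prop
  have hne : ∀ p : (ℝ × ℝ) × (ℝ × ℝ), M.gdet p.1 ≠ 0 := fun p => (M.gdet_pos _).ne'
  exact (((c3.mul y1).sub (c2.mul y2)).div cd hne).prodMk
    (((c1.mul y2).sub (c2.mul y1)).div cd hne)

/-- The Hamiltonian vector field of the geodesic flow. -/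
def field (p : (ℝ × ℝ) × (ℝ × ℝ)) : (ℝ × ℝ) × (ℝ × ℝ) :=
  (M.vel p, (fderiv ℝ M.quad (p.1, M.vel p) ((1, 0), 0) / 2,
    fderiv ℝ M.quad (p.1, M.vel p) ((0, 1), 0) / 2))

theorem contDiff_field : ContDiff ℝ (⊤ : ℕ∞) M.field := by
  have h1 : ContDiff ℝ (⊤ : ℕ∞) fun p : (ℝ × ℝ) × (ℝ × ℝ) => fderiv ℝ M.quad (p.1, M.vel p) :=
    (M.contDiff_quad.fderiv_right (m := (⊤ : ℕ∞)) (by simp)).comp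
      (contDiff_fst.prodMk M.contDiff_vel)
  refine M.contDiff_vel.prodMk (ContDiff.prodMk ?_ ?_)
  · exact (h1.clm_apply contDiff_const).div_const 2
  · exact (h1.clm_apply contDiff_const).div_const 2

theorem fderiv_quad_snd (x v w : ℝ × ℝ) : fderiv ℝ M.quad (x, v) (0, w) = 2 * M.g x v w := by
  have h1 : HasDerivAt (fun r : ℝ => ((x, v + r • w) : (ℝ × ℝ) × (ℝ × ℝ))) (0, w) 0 := by
    have : HasDerivAt (fun r : ℝ => v + r • w) w 0 := by
      simpa using ((hasDerivAt_id (0:ℝ)).smul_const w).const_add v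
    exact (hasDerivAt_const (0:ℝ) x).prodMk this
  have h2 : HasFDerivAt M.quad (fderiv ℝ M.quad (x, v)) ((fun r : ℝ => ((x, v + r • w) : (ℝ × ℝ) × (ℝ × ℝ))) 0) := by
    simpa using (M.contDiff_quad.differentiable (by simp) (x, v)).hasFDerivAt
  have h3 := h2.comp_hasDerivAt (0:ℝ) h1
  have e : (M.quad ∘ fun r : ℝ => ((x, v + r • w) : (ℝ × ℝ) × (ℝ × ℝ)))
      = fun r => M.g x v v + r * (2 * M.g x v w) + r ^ 2 * M.g x w w := by
    ext r
    have s := M.symm x w v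
    simp only [Function.comp, quad, ← G_apply, map_add, map_smul, add_apply,
      smul_apply, smul_eq_mul] at s ⊢
    rw [s]; ring
  rw [e] at h3
  have h4 : HasDerivAt (fun r : ℝ => M.g x v v + r * (2 * M.g x v w) + r ^ 2 * M.g x w w)
      (2 * M.g x v w) 0 := by
    have := (((hasDerivAt_id (0:ℝ)).mul_const (2 * M.g x v w)).const_add (M.g x v v)).add
      (((hasDerivAt_pow 2 (0:ℝ))).mul_const (M.g x w w))
    exact this.congr_deriv (by simp)
  exact h3.unique h4

/-- Locally isometric curves. -/
def LocIso (γ : ℝ → ℝ × ℝ) : Prop := ∀ t, ∃ ε > 0, M.IsoOn γ (t - ε) (t + ε)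

variable {M}

theorem LocIso.continuous {γ : ℝ → ℝ × ℝ} (h : M.LocIso γ) : Continuous γ := by
  rw [continuous_iff_continuousAt]
  intro t
  obtain ⟨ε, hε, hi⟩ := h t
  rw [ContinuousAt, tendsto_iff_norm_sub_tendsto_zero]
  have hb : Tendsto (fun s : ℝ => |s - t| / M.cm) (𝓝 t) (𝓝 0) := by
    have : Continuous fun s : ℝ => |s - t| / M.cm := by fun_prop
    simpa using this.tendsto t
  refine squeeze_zero' (Eventually.of_forall fun _ => norm_nonneg _) ?_ hb
  filter_upwards [Icc_mem_nhds (show t - ε < t by linarith) (show t < t + ε by linarith)] with s hs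
  rcases le_total s t with hst | hst
  · rw [norm_sub_rev, abs_sub_comm, abs_of_nonneg (by linarith)]
    exact hi.norm_sub_le hs.1 hst (by linarith)
  · rw [abs_of_nonneg (by linarith)]
    exact hi.norm_sub_le (by linarith) hst hs.2

theorem LocIso.speed_deriv {γ : ℝ → ℝ × ℝ} (h : M.LocIso γ) (t : ℝ) :
    M.speed (γ t) (deriv γ t) = 1 := by
  obtain ⟨ε, hε, hi⟩ := h t
  exact hi.speed_deriv h.continuous ⟨by linarith, by linarith⟩

theorem LocIso.contDiff_one {γ : ℝ → ℝ × ℝ} (h : M.LocIso γ) : ContDiff ℝ 1 γ := by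
  rw [contDiff_one_iff_deriv]
  constructor
  · intro t
    obtain ⟨ε, hε, hi⟩ := h t
    exact hi.differentiableAt h.continuous ⟨by linarith, by linarith⟩
  · rw [continuous_iff_continuousAt]
    intro t
    obtain ⟨ε, hε, hi⟩ := h t
    exact (hi.continuousOn_deriv h.continuous).continuousAt
      (Ioo_mem_nhds (by linarith) (by linarith))

theorem IsoOn.first_variation {γ : ℝ → ℝ × ℝ} (h : M.LocIso γ) {a b : ℝ} (hab : a < b)
    (hi : M.IsoOn γ a b) (e : ℝ × ℝ) {φ : ℝ → ℝ} (hφ : ContDiff ℝ 1 φ) (ha : φ a = 0)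
    (hb : φ b = 0) :
    ∫ t in a..b, fderiv ℝ M.quad (γ t, deriv γ t) (φ t • e, deriv φ t • e) = 0 := by
  have c1 := h.contDiff_one
  have cd := c1.continuous_deriv le_rfl
  have cφ := hφ.continuous
  have cφ' := hφ.continuous_deriv le_rfl
  set p : ℝ → (ℝ × ℝ) × (ℝ × ℝ) := fun t => (γ t, deriv γ t) with hp
  set q : ℝ → (ℝ × ℝ) × (ℝ × ℝ) := fun t => (φ t • e, deriv φ t • e) with hq
  have hder := hasDerivAt_integral_line (M.contDiff_quad.of_le (by simp)) (p := p) (q := q)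
    (c1.continuous.prodMk cd) (by fun_prop) a b
  refine IsLocalMin.hasDerivAt_eq_zero (Eventually.of_forall fun r => ?_) hder
  have h0 : ∫ t in a..b, M.quad (p t + (0:ℝ) • q t) = b - a := by
    have : ∀ t, M.quad (p t + (0:ℝ) • q t) = 1 := fun t => by
      simp only [zero_smul, add_zero, hp, quad]
      rw [← speed_sq, h.speed_deriv, one_pow]
    simp only [this]
    simp
  simp only [h0]
  set σ : ℝ → ℝ × ℝ := fun t => γ t + (r * φ t) • e with hσ
  have hσ1 : ContDiff ℝ 1 σ := c1.add ((contDiff_const.mul hφ).smul contDiff_const)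
  have dσ : ∀ t, deriv σ t = deriv γ t + r • deriv φ t • e := fun t => by
    have d1 := (c1.differentiable (by simp) t).hasDerivAt
    have d2 := (hφ.differentiable (by simp) t).hasDerivAt
    have := d1.add ((d2.const_mul r).smul_const e)
    rw [smul_smul]
    exact this.deriv
  have hl := dist_le_length (M := M) hσ1 hab.le
  have ea : σ a = γ a := by simp [hσ, ha]
  have eb : σ b = γ b := by simp [hσ, hb]
  rw [ea, eb, hi a b le_rfl hab.le le_rfl, length_eq] at hl
  have hq1 : ∀ t, M.quad (p t + r • q t) = M.speed (σ t) (deriv σ t) ^ 2 := fun t => by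
    rw [speed_sq, dσ]
    simp only [hp, hq, quad, hσ, Prod.fst_add, Prod.snd_add, Prod.smul_fst, Prod.smul_snd, smul_smul]
  simp_rw [hq1]
  have cs := continuous_speed_deriv (M := M) hσ1
  have h_eq_int : ∫ t in a..b, M.speed (σ t) (deriv σ t)
      ≤ ∫ t in a..b, (1 + M.speed (σ t) (deriv σ t) ^ 2) / 2 := by
    apply intervalIntegral.integral_mono_on hab.le (cs.intervalIntegrable _ _)
    · exact Continuous.intervalIntegrable (by fun_prop) _ _
    · intro t _
      nlinarith [sq_nonneg (M.speed (σ t) (deriv σ t) - 1)]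
  have i2 : IntervalIntegrable (fun t => M.speed (σ t) (deriv σ t) ^ 2)
    MeasureTheory.volume a b := (cs.pow 2).intervalIntegrable _ _
  rw [intervalIntegral.integral_div, intervalIntegral.integral_add
    (continuous_const.intervalIntegrable _ _) i2] at h_eq_int
  simp only [intervalIntegral.integral_const, smul_eq_mul, mul_one] at h_eq_int
  linarith

theorem LocIso.hasDerivAt_mom {γ : ℝ → ℝ × ℝ} (h : M.LocIso γ) (e : ℝ × ℝ) (t : ℝ) :
    HasDerivAt (fun t => M.g (γ t) (deriv γ t) e)
      (fderiv ℝ M.quad (γ t, deriv γ t) (e, 0) / 2) t := by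
  obtain ⟨ε, hε, hi⟩ := h t
  have c1 := h.contDiff_one
  have cd := c1.continuous_deriv le_rfl
  have cf := (M.contDiff_quad.continuous_fderiv (by simp)).comp (c1.continuous.prodMk cd)
  have cQ : Continuous fun t => fderiv ℝ M.quad (γ t, deriv γ t) (e, 0) := by
    exact cf.clm_apply continuous_const
  have cP : Continuous fun t => fderiv ℝ M.quad (γ t, deriv γ t) (0, e) := by
    exact cf.clm_apply continuous_const
  have := hasDerivAt_of_integral_variation cP cQ (show t - ε < t + ε by linarith)
    (fun φ hφ ha hb => by
      rw [← IsoOn.first_variation h (by linarith) hi e hφ ha hb]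
      refine intervalIntegral.integral_congr fun s _ => ?_
      have e1 : ((φ s • e, deriv φ s • e) : (ℝ × ℝ) × (ℝ × ℝ))
        = φ s • (e, 0) + deriv φ s • (0, e) := by simp
      simp only [e1, map_add, map_smul, smul_eq_mul]
      ring) (t := t) ⟨by linarith, by linarith⟩
  simp only [fderiv_quad_snd] at this
  simpa using this.div_const 2

/-- The phase curve of a locally isometric curve is an integral curve of the geodesic field. -/
theorem LocIso.hasDerivAt_phase {γ : ℝ → ℝ × ℝ} (h : M.LocIso γ) (t : ℝ) :
    HasDerivAt (fun t => (γ t, M.mom (γ t) (deriv γ t)))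
      (M.field (γ t, M.mom (γ t) (deriv γ t))) t := by
  have d0 := (h.contDiff_one.differentiable (by simp) t).hasDerivAt
  have := d0.prodMk ((h.hasDerivAt_mom (1, 0) t).prodMk (h.hasDerivAt_mom (0, 1) t))
  simp only [field, vel_mom]
  exact this

theorem LocIso.contDiff {γ : ℝ → ℝ × ℝ} (h : M.LocIso γ) : ContDiff ℝ (⊤ : ℕ∞) γ :=
  (contDiff_of_hasDerivAt M.contDiff_field h.hasDerivAt_phase).fst

theorem LocIso.isGeodesic {γ : ℝ → ℝ × ℝ} (h : M.LocIso γ) : M.IsGeodesic γ := by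
  refine ⟨h.contDiff, fun t => ?_, fun t => ?_⟩
  · rw [← speed_sq, h.speed_deriv, one_pow]
  · obtain ⟨ε, hε, hi⟩ := h t
    refine ⟨ε, hε, fun s₁ s₂ h1 h2 h3 => ?_⟩
    rw [hi s₁ s₂ h1 h2 h3, length_eq]
    simp [h.speed_deriv]

theorem IsGeodesic.locIso {γ : ℝ → ℝ × ℝ} (h : M.IsGeodesic γ) : M.LocIso γ := by
  intro t
  obtain ⟨ε, hε, hi⟩ := h.2.2 t
  refine ⟨ε, hε, fun s₁ s₂ h1 h2 h3 => ?_⟩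
  rw [hi s₁ s₂ h1 h2 h3, length]
  simp [h.2.1]

theorem LocIso.shift {γ : ℝ → ℝ × ℝ} (h : M.LocIso γ) (a : ℝ) : M.LocIso fun t => γ (t + a) := by
  intro t
  obtain ⟨ε, hε, hi⟩ := h (t + a)
  refine ⟨ε, hε, fun s₁ s₂ h1 h2 h3 => ?_⟩
  rw [hi _ _ (by linarith) (by linarith) (by linarith)]
  ring

theorem LocIso.neg {γ : ℝ → ℝ × ℝ} (h : M.LocIso γ) : M.LocIso fun t => γ (-t) := by
  intro t
  obtain ⟨ε, hε, hi⟩ := h (-t)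
  refine ⟨ε, hε, fun s₁ s₂ h1 h2 h3 => ?_⟩
  rw [dist_comm, hi _ _ (by linarith) (by linarith) (by linarith)]
  ring

theorem LocIso.deriv_ne_zero {γ : ℝ → ℝ × ℝ} (h : M.LocIso γ) (t : ℝ) : deriv γ t ≠ 0 := by
  intro h0
  have := h.speed_deriv t
  rw [h0] at this
  simp [speed, ← G_apply] at this

/-- Two geodesics with the same position and velocity coincide. -/
theorem LocIso.eq_of_deriv_eq {γ σ : ℝ → ℝ × ℝ} (h : M.LocIso γ) (h' : M.LocIso σ) {t : ℝ}
    (h0 : γ t = σ t) (h1 : deriv γ t = deriv σ t) : γ = σ := by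
  have := eq_of_hasDerivAt_autonomous (M.contDiff_field.of_le (by simp)) h.hasDerivAt_phase
    h'.hasDerivAt_phase (t₀ := t) (by simp only [h0, h1])
  funext s
  exact congrArg Prod.fst (congrFun this s)

/-- Two geodesics agreeing on an open interval coincide. -/
theorem LocIso.eq_of_eqOn {γ σ : ℝ → ℝ × ℝ} (h : M.LocIso γ) (h' : M.LocIso σ) {a b : ℝ}
    (hab : a < b) (he : ∀ t ∈ Ioo a b, γ t = σ t) : γ = σ := by
  have hm : (a + b) / 2 ∈ Ioo a b := ⟨by linarith, by linarith⟩
  refine h.eq_of_deriv_eq h' (he _ hm) ?_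
  refine EventuallyEq.deriv_eq ?_
  filter_upwards [Ioo_mem_nhds hm.1 hm.2] with t ht using he t ht

/-- Two geodesics with the same position and parallel velocities coincide up to reversal. -/
theorem LocIso.eq_or_eq_neg {γ σ : ℝ → ℝ × ℝ} (h : M.LocIso γ) (h' : M.LocIso σ) {t s : ℝ}
    (h0 : γ t = σ s) {r : ℝ} (h1 : deriv γ t = r • deriv σ s) :
    (∀ u, γ (t + u) = σ (s + u)) ∨ ∀ u, γ (t + u) = σ (s - u) := by
  have hs : |r| = 1 := by
    have := h.speed_deriv t
    rw [h1, h0, speed_smul, h'.speed_deriv, mul_one] at this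
    exact this
  have hγ := h.shift t
  have dγ : deriv (fun u => γ (u + t)) 0 = deriv γ t := by
    rw [deriv_comp_add_const, zero_add]
  rcases (abs_eq zero_le_one).1 hs with rfl | rfl
  · left
    have hσ := h'.shift s
    have := hγ.eq_of_deriv_eq hσ (t := 0) (by simpa using h0) (by
      rw [dγ, deriv_comp_add_const, zero_add, h1, one_smul])
    intro u
    simpa [add_comm] using congrFun this u
  · right
    have hσ := h'.neg.shift (-s)
    have := hγ.eq_of_deriv_eq hσ (t := 0) (by simpa using h0) (by
      rw [dγ, deriv_comp_add_const (f := fun u => σ (-u)), deriv_comp_neg, h1]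
      simp)
    intro u
    have := congrFun this u
    simp only [neg_add, neg_neg] at this
    rw [add_comm t u, this]
    congr 1; ring

end TorusMetric

theorem exists_ultrafilter_lim {ι : Type*} (U : Ultrafilter ι) {f : ι → ℝ × ℝ} {C : ℝ}
    (h : ∀ᶠ i in (U : Filter ι), ‖f i‖ ≤ C) : ∃ p, Tendsto f U (𝓝 p) := by
  have hc : IsCompact (Metric.closedBall (0 : ℝ × ℝ) C) := isCompact_closedBall _ _
  obtain ⟨p, -, hp⟩ := hc.ultrafilter_le_nhds' (U.map f) (by
    rw [Ultrafilter.mem_map]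
    filter_upwards [h] with i hi
    simpa using hi)
  exact ⟨p, hp⟩

namespace TorusMetric

variable {M : TorusMetric}

theorem tendsto_dist {ι : Type*} {l : Filter ι} {f g : ι → ℝ × ℝ} {p q : ℝ × ℝ}
    (hf : Tendsto f l (𝓝 p)) (hg : Tendsto g l (𝓝 q)) :
    Tendsto (fun i => M.dist (f i) (g i)) l (𝓝 (M.dist p q)) := by
  have h : Tendsto (fun i => (f i, g i)) l (𝓝 (p, q)) := hf.prodMk_nhds hg
  have h2 : Tendsto (fun z : (ℝ × ℝ) × (ℝ × ℝ) => M.dist z.1 z.2) (𝓝 (p, q)) (𝓝 (M.dist p q)) :=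
    (continuous_dist (M := M)).tendsto (p, q)
  have h3 := h2.comp h
  exact h3

theorem norm_le_of_dist_le {x y : ℝ × ℝ} {C : ℝ} (h : M.dist x y ≤ C) : ‖y‖ ≤ ‖x‖ + C / M.cm := by
  have h1 := cm_norm_le_dist (M := M) x y
  have h2 : ‖y - x‖ ≤ C / M.cm := by
    rw [le_div_iff₀ M.cm_pos]; linarith
  have := norm_le_norm_add_norm_sub' y x
  linarith

theorem isoOn_of_lip {γ : ℝ → ℝ × ℝ} {a b : ℝ}
    (h : ∀ s t, a ≤ s → s ≤ t → t ≤ b → M.dist (γ s) (γ t) ≤ t - s)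
    (h' : b - a ≤ M.dist (γ a) (γ b)) : M.IsoOn γ a b := by
  intro s t h1 h2 h3
  refine le_antisymm (h s t h1 h2 h3) ?_
  have t1 := dist_triangle (M := M) (γ a) (γ s) (γ b)
  have t2 := dist_triangle (M := M) (γ s) (γ t) (γ b)
  have := h a s le_rfl h1 (h2.trans h3)
  have := h t b (h1.trans h2) h3 le_rfl
  linarith

theorem continuous_of_lip {γ : ℝ → ℝ × ℝ} (h : ∀ s t, M.dist (γ s) (γ t) ≤ |s - t|) :
    Continuous γ := by
  have hm := M.cm_pos
  refine (LipschitzWith.of_dist_le_mul (K := ⟨M.cm⁻¹, by positivity⟩) fun s t => ?_).continuous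
  rw [dist_eq_norm, Real.dist_eq]
  have h1 := cm_norm_le_dist (M := M) (γ t) (γ s)
  have h2 := h t s
  rw [abs_sub_comm] at h2
  change _ ≤ M.cm⁻¹ * _
  rw [inv_mul_eq_div, le_div_iff₀ hm]
  linarith

/-- Approximate segments obtained by reparametrizing almost minimizing curves. -/
theorem exists_approx_segment (x y : ℝ × ℝ) {ε : ℝ} (hε : 0 < ε) :
    ∃ γ : ℝ → ℝ × ℝ, (∀ s ∈ Icc 0 (M.dist x y), M.dist x (γ s) = s) ∧
      (∀ s t, 0 ≤ s → s ≤ t → t ≤ M.dist x y → M.dist (γ s) (γ t) ≤ t - s + ε) ∧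
      M.dist (γ (M.dist x y)) y ≤ ε := by
  set L := M.dist x y with hL
  obtain ⟨c, hc, h0, h1, hl⟩ := exists_length_lt (M := M) (x := x) (y := y) (r := L + ε) (by linarith)
  have hcont : ContinuousOn (fun τ => M.dist x (c τ)) (Icc 0 1) :=
    ((continuous_dist (M := M)).comp (continuous_const.prodMk hc.continuous)).continuousOn
  have hiv := intermediate_value_Icc (zero_le_one (α := ℝ)) hcont
  have hτ : ∀ s, ∃ τ ∈ Icc (0:ℝ) 1, s ∈ Icc 0 L → M.dist x (c τ) = s := fun s => by
    by_cases hs : s ∈ Icc 0 L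
    · obtain ⟨τ, h, h'⟩ := hiv (by simpa [h0, h1, dist_self, ← hL] using hs)
      exact ⟨τ, h, fun _ => h'⟩
    · exact ⟨0, by simp, fun h => (hs h).elim⟩
  choose τ hτ1 hτ2 using hτ
  have hlen : ∀ a b, 0 ≤ a → a ≤ b → b ≤ 1 →
      M.dist (c a) (c b) ≤ L + ε - M.dist x (c a) - M.dist (c b) y := by
    intro a b ha hab hb
    have e1 := dist_le_length (M := M) hc ha
    have e2 := dist_le_length (M := M) hc hab
    have e3 := dist_le_length (M := M) hc hb
    have e4 := length_add (M := M) hc 0 a 1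
    have e5 := length_add (M := M) hc a b 1
    rw [h0] at e1; rw [h1] at e3
    linarith
  have htri : ∀ p, L - M.dist x p ≤ M.dist p y := fun p => by
    have := dist_triangle (M := M) x p y
    linarith
  refine ⟨fun s => c (τ s), fun s hs => hτ2 s hs, fun s t h1 h2 h3 => ?_, ?_⟩
  · have es := hτ2 s ⟨h1, h2.trans h3⟩
    have et := hτ2 t ⟨h1.trans h2, h3⟩
    have ts := htri (c (τ s))
    have tt := htri (c (τ t))
    rcases le_total (τ s) (τ t) with h | h
    · have := hlen _ _ (hτ1 s).1 h (hτ1 t).2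
      linarith
    · have := hlen _ _ (hτ1 t).1 h (hτ1 s).2
      rw [dist_comm]
      linarith
  · have := hlen (τ L) 1 (hτ1 L).1 (hτ1 L).2 le_rfl
    rw [h1, hτ2 L ⟨dist_nonneg x y, le_rfl⟩, dist_self] at this
    linarith

/-- Existence of minimal segments. -/
theorem exists_segment (x y : ℝ × ℝ) : ∃ γ : ℝ → ℝ × ℝ, γ 0 = x ∧ γ (M.dist x y) = y ∧
    M.IsoOn γ 0 (M.dist x y) ∧ ∀ s t, M.dist (γ s) (γ t) ≤ |s - t| := by
  set L := M.dist x y with hL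
  have hL0 : 0 ≤ L := dist_nonneg x y
  choose γ h1 h2 h3 using fun n : ℕ =>
    exists_approx_segment (M := M) x y (ε := 1 / ((n : ℝ) + 1)) Nat.one_div_pos_of_nat
  rw [← hL] at *
  set U : Ultrafilter ℕ := Filter.hyperfilter ℕ
  have hU : (U : Filter ℕ) ≤ atTop := by
    rw [← Nat.cofinite_eq_atTop]; exact Filter.hyperfilter_le_cofinite
  have hε : Tendsto (fun n : ℕ => 1 / ((n : ℝ) + 1)) U (𝓝 0) :=
    tendsto_one_div_add_atTop_nhds_zero_nat.mono_left hU
  have hlim : ∀ s, ∃ p, s ∈ Icc 0 L → Tendsto (fun n => γ n s) U (𝓝 p) := fun s => by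
    by_cases hs : s ∈ Icc 0 L
    · obtain ⟨p, hp⟩ := exists_ultrafilter_lim U (f := fun n => γ n s) (C := ‖x‖ + s / M.cm)
        (Eventually.of_forall fun n => norm_le_of_dist_le (h1 n s hs).le)
      exact ⟨p, fun _ => hp⟩
    · exact ⟨0, fun h => (hs h).elim⟩
  choose σ hσ using hlim
  have d0 : ∀ s ∈ Icc 0 L, M.dist x (σ s) = s := fun s hs =>
    tendsto_nhds_unique (tendsto_dist tendsto_const_nhds (hσ s hs))
      (tendsto_const_nhds.congr fun n => (h1 n s hs).symm)
  have e0 : σ 0 = x := (dist_eq_zero (d0 0 ⟨le_rfl, hL0⟩)).symm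
  have eL : σ L = y := by
    refine dist_eq_zero (M := M) (le_antisymm ?_ (dist_nonneg _ _))
    exact le_of_tendsto_of_tendsto (tendsto_dist (hσ L ⟨hL0, le_rfl⟩) tendsto_const_nhds) hε
      (Eventually.of_forall fun n => h3 n)
  have hlip : ∀ s t, 0 ≤ s → s ≤ t → t ≤ L → M.dist (σ s) (σ t) ≤ t - s := fun s t a b c => by
    have := le_of_tendsto_of_tendsto
      (tendsto_dist (hσ s ⟨a, b.trans c⟩) (hσ t ⟨a.trans b, c⟩)) (hε.const_add (t - s))
      (Eventually.of_forall fun n => h2 n s t a b c)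
    simpa using this
  have cl0 : ∀ s, 0 ≤ max 0 (min s L) := fun s => le_max_left _ _
  have clL : ∀ s, max 0 (min s L) ≤ L := fun s => max_le hL0 (min_le_right _ _)
  have cle : ∀ s, 0 ≤ s → s ≤ L → max 0 (min s L) = s := fun s a b => by
    rw [min_eq_left b, max_eq_right a]
  refine ⟨fun s => σ (max 0 (min s L)), ?_, ?_, ?_, ?_⟩
  · simp only [cle 0 le_rfl hL0, e0]
  · simp only [cle L hL0 le_rfl, eL]
  · refine isoOn_of_lip (fun s t a b c => ?_) ?_
    · simp only [cle s a (b.trans c), cle t (a.trans b) c]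
      exact hlip s t a b c
    · simp only [cle 0 le_rfl hL0, cle L hL0 le_rfl, e0, eL, sub_zero]
      exact le_rfl
  · have key : ∀ s t, s ≤ t → M.dist (σ (max 0 (min s L))) (σ (max 0 (min t L))) ≤ t - s := by
      intro s t hst
      have hmono : max 0 (min s L) ≤ max 0 (min t L) :=
        max_le_max le_rfl (min_le_min hst le_rfl)
      refine (hlip _ _ (cl0 s) hmono (clL t)).trans ?_
      simp only [max_def, min_def]
      split_ifs <;> linarith
    intro s t
    rcases le_total s t with h | h
    · rw [abs_sub_comm, abs_of_nonneg (sub_nonneg.2 h)]; exact key s t h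
    · rw [abs_of_nonneg (sub_nonneg.2 h), dist_comm]; exact key t s h

end TorusMetric

theorem lat_add (a b : ℤ × ℤ) : lat (a + b) = lat a + lat b := by
  ext <;> simp [lat]

theorem lat_neg (a : ℤ × ℤ) : lat (-a) = -lat a := by
  ext <;> simp [lat]

theorem lat_sub (a b : ℤ × ℤ) : lat (a - b) = lat a - lat b := by
  ext <;> simp [lat]

theorem lat_zero : lat 0 = 0 := by
  ext <;> simp [lat]

theorem lat_nsmul (n : ℕ) (a : ℤ × ℤ) : lat (n • a) = (n : ℝ) • lat a := by
  ext <;> simp [lat]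

/-- The first standard basis vector of the lattice. -/
def e₁ : ℤ × ℤ := (1, 0)

namespace TorusMetric

variable {M : TorusMetric}

/-- A minimal segment from `x` to `x + 2 k` contains a chord `k`, and so does its complement. -/
theorem two_mul_le_dist {k : ℤ × ℤ} {μ : ℝ} (h : ∀ x, μ ≤ M.dist x (x + lat k)) (x : ℝ × ℝ) :
    2 * μ ≤ M.dist x (x + lat (k + k)) := by
  obtain ⟨γ, h0, h1, hi, hl⟩ := exists_segment (M := M) x (x + lat (k + k))
  set L := M.dist x (x + lat (k + k)) with hL
  obtain ⟨s, t, hs, hst, ht, e⟩ := chord_lemma γ (continuous_of_lip hl).continuousOn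
    (dist_nonneg x _) (v := lat k) (L := L) (by rw [h1, h0, lat_add, two_smul])
  have a1 := hi s t hs hst ht
  have a2 := hi 0 s le_rfl hs (hst.trans ht)
  have a3 := hi t L (hs.trans hst) ht le_rfl
  have b1 := h (γ s)
  have b2 := h (γ t)
  rw [← e, a1] at b1
  have b3 := dist_triangle (M := M) (γ t) (γ L) (γ t + lat k)
  have b4 : M.dist (γ L) (γ t + lat k) = s := by
    have : γ t + lat k = γ s + lat (k + k) := by rw [e, lat_add, add_assoc]
    rw [this, h1, dist_add_lat, ← h0, a2, sub_zero]
  linarith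

theorem exists_min_translate (k : ℤ × ℤ) :
    ∃ o, ∀ x, M.dist o (o + lat k) ≤ M.dist x (x + lat k) := by
  have hc : IsCompact (Icc (0 : ℝ × ℝ) (1, 1)) := isCompact_Icc
  have hf : Continuous fun x => M.dist x (x + lat k) :=
    (continuous_dist (M := M)).comp (continuous_id.prodMk (continuous_id.add continuous_const))
  obtain ⟨o, -, ho⟩ := hc.exists_isMinOn ⟨0, by constructor <;> constructor <;> simp⟩ hf.continuousOn
  refine ⟨o, fun x => ?_⟩
  obtain ⟨j, hj⟩ := exists_lat_translate x
  have := ho hj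
  change M.dist o (o + lat k) ≤ M.dist (x + lat j) (x + lat j + lat k) at this
  rwa [add_right_comm, dist_add_lat] at this

theorem dist_nsmul_le {o : ℝ × ℝ} {ℓ : ℝ} {k : ℤ × ℤ} (h : M.dist o (o + lat k) = ℓ) (n : ℕ) :
    M.dist o (o + lat (n • k)) ≤ n * ℓ := by
  induction n with
  | zero => simp [lat_zero, dist_self]
  | succ n ih =>
    have := dist_triangle (M := M) o (o + lat (n • k)) (o + lat ((n + 1) • k))
    rw [succ_nsmul, lat_add, ← add_assoc, add_right_comm o, dist_add_lat, h] at this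
    rw [succ_nsmul, lat_add, ← add_assoc, add_right_comm o]
    push_cast
    linarith

/-- A point minimizing the displacement by `k` has linearly growing displacement. -/
theorem exists_axis_point (k : ℤ × ℤ) :
    ∃ o ℓ, M.dist o (o + lat k) = ℓ ∧ ∀ n : ℕ, M.dist o (o + lat (n • k)) = n * ℓ := by
  obtain ⟨o, ho⟩ := exists_min_translate (M := M) k
  refine ⟨o, _, rfl, fun n => le_antisymm (dist_nsmul_le rfl n) ?_⟩
  set ℓ := M.dist o (o + lat k) with hℓ
  have hpow : ∀ j : ℕ, ∀ x, 2 ^ j * ℓ ≤ M.dist x (x + lat ((2 ^ j) • k)) := by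
    intro j
    induction j with
    | zero => simpa using ho
    | succ j ih =>
      intro x
      have := two_mul_le_dist ih x
      rwa [← mul_assoc, ← pow_succ', ← two_nsmul, smul_smul, ← pow_succ'] at this
  have h1 := hpow n o
  have h2 : n ≤ 2 ^ n := Nat.lt_two_pow_self.le
  obtain ⟨r, hr⟩ := Nat.exists_eq_add_of_le h2
  have h3 := dist_triangle (M := M) o (o + lat (n • k)) (o + lat ((2 ^ n) • k))
  have h4 : M.dist (o + lat (n • k)) (o + lat ((2 ^ n) • k)) = M.dist o (o + lat (r • k)) := by
    rw [hr, add_nsmul, lat_add, add_comm (lat _), ← add_assoc, dist_add_lat]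
  have h5 := dist_nsmul_le (M := M) hℓ.symm r
  have h6 : (2:ℝ) ^ n = n + r := by exact_mod_cast hr
  rw [h6] at h1
  linarith

/-- The Busemann type function of the sequence `o - n e`. -/
def bus (M : TorusMetric) (ℓ : ℝ) (o : ℝ × ℝ) (e : ℤ × ℤ) (x : ℝ × ℝ) : ℝ :=
  ⨅ n : ℕ, (M.dist o (x + lat (n • e)) - n * ℓ)

variable {ℓ : ℝ} {o : ℝ × ℝ} {e : ℤ × ℤ}

theorem bus_antitone (h : M.dist o (o + lat e) = ℓ) (x : ℝ × ℝ) :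
    Antitone fun n : ℕ => M.dist o (x + lat (n • e)) - n * ℓ := by
  refine antitone_nat_of_succ_le fun n => ?_
  have := dist_triangle (M := M) o (o + lat e) (x + lat ((n + 1) • e))
  rw [succ_nsmul, lat_add, ← add_assoc, dist_add_lat, h] at this
  rw [succ_nsmul, lat_add, ← add_assoc]
  push_cast
  linarith

theorem bus_lower (h : ∀ n : ℕ, M.dist o (o + lat (n • e)) = n * ℓ) (x : ℝ × ℝ) (n : ℕ) :
    -M.dist o x ≤ M.dist o (x + lat (n • e)) - n * ℓ := by
  have := dist_triangle (M := M) o (x + lat (n • e)) (o + lat (n • e))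
  rw [h, dist_add_lat, dist_comm x] at this
  linarith

theorem bus_bddBelow (h : ∀ n : ℕ, M.dist o (o + lat (n • e)) = n * ℓ) (x : ℝ × ℝ) :
    BddBelow (range fun n : ℕ => M.dist o (x + lat (n • e)) - n * ℓ) :=
  ⟨_, by rintro _ ⟨n, rfl⟩; exact bus_lower h x n⟩

theorem axis_one (h : ∀ n : ℕ, M.dist o (o + lat (n • e)) = n * ℓ) : M.dist o (o + lat e) = ℓ := by
  simpa using h 1

theorem bus_le (h : ∀ n : ℕ, M.dist o (o + lat (n • e)) = n * ℓ) (x : ℝ × ℝ) (n : ℕ) :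
    M.bus ℓ o e x ≤ M.dist o (x + lat (n • e)) - n * ℓ := ciInf_le (bus_bddBelow h x) n

theorem le_bus {x : ℝ × ℝ} {c : ℝ} (hc : ∀ n : ℕ, c ≤ M.dist o (x + lat (n • e)) - n * ℓ) :
    c ≤ M.bus ℓ o e x := le_ciInf hc

theorem tendsto_bus (h : ∀ n : ℕ, M.dist o (o + lat (n • e)) = n * ℓ) (x : ℝ × ℝ) :
    Tendsto (fun n : ℕ => M.dist o (x + lat (n • e)) - n * ℓ) atTop (𝓝 (M.bus ℓ o e x)) :=
  tendsto_atTop_ciInf (bus_antitone (axis_one h) x) (bus_bddBelow h x)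

theorem bus_le_add_dist (h : ∀ n : ℕ, M.dist o (o + lat (n • e)) = n * ℓ) (x y : ℝ × ℝ) :
    M.bus ℓ o e y ≤ M.bus ℓ o e x + M.dist x y := by
  rw [← sub_le_iff_le_add]
  refine le_bus fun n => ?_
  have h1 := bus_le h y n
  have h2 := dist_triangle (M := M) o (x + lat (n • e)) (y + lat (n • e))
  rw [dist_add_lat] at h2
  linarith

theorem bus_add (h : ∀ n : ℕ, M.dist o (o + lat (n • e)) = n * ℓ) (x : ℝ × ℝ) :
    M.bus ℓ o e (x + lat e) = M.bus ℓ o e x + ℓ := by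
  have h1 := (tendsto_bus h x).comp (tendsto_add_atTop_nat 1)
  have h2 := (tendsto_bus h (x + lat e)).sub_const ℓ
  have := tendsto_nhds_unique h1 (h2.congr fun n => by
    simp only [Function.comp]
    rw [add_comm n 1, add_nsmul, one_nsmul, lat_add, ← add_assoc]
    push_cast; ring)
  linarith

/-- `f` is 1-Lipschitz with respect to the Riemannian distance. -/
def Lip (M : TorusMetric) (f : ℝ × ℝ → ℝ) : Prop := ∀ x y, f y ≤ f x + M.dist x y

theorem bus_lip (h : ∀ n : ℕ, M.dist o (o + lat (n • e)) = n * ℓ) : M.Lip (M.bus ℓ o e) :=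
  bus_le_add_dist h

theorem Lip.continuous {f : ℝ × ℝ → ℝ} (h : M.Lip f) : Continuous f := by
  rw [continuous_iff_continuousAt]
  intro x
  rw [ContinuousAt, tendsto_iff_norm_sub_tendsto_zero]
  have h0 : Tendsto (fun y => M.dist x y) (𝓝 x) (𝓝 0) := by
    rw [← dist_self (M := M) x]
    exact tendsto_dist tendsto_const_nhds tendsto_id
  refine squeeze_zero (fun _ => norm_nonneg _) (fun y => ?_) h0
  have h1 := h x y
  have h2 := h y x
  rw [dist_comm] at h2
  rw [Real.norm_eq_abs, abs_le]
  constructor <;> linarith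

end TorusMetric

namespace TorusMetric

variable {M : TorusMetric}

/-- A line along which `f` grows with unit speed. -/
def Cal (M : TorusMetric) (f : ℝ × ℝ → ℝ) (γ : ℝ → ℝ × ℝ) : Prop :=
  (∀ s t, s ≤ t → M.dist (γ s) (γ t) ≤ t - s) ∧ ∀ s, f (γ s) = f (γ 0) + s

theorem Cal.isoOn {f : ℝ × ℝ → ℝ} {γ : ℝ → ℝ × ℝ} (hf : M.Lip f) (h : M.Cal f γ) (a b : ℝ) :
    M.IsoOn γ a b := by
  intro s t _ hst _
  have h1 := hf (γ s) (γ t)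
  have h2 := h.1 s t hst
  rw [h.2 s, h.2 t] at h1
  linarith

theorem Cal.locIso {f : ℝ × ℝ → ℝ} {γ : ℝ → ℝ × ℝ} (hf : M.Lip f) (h : M.Cal f γ) : M.LocIso γ :=
  fun _ => ⟨1, one_pos, h.isoOn hf _ _⟩

theorem lip_glue {γ η : ℝ → ℝ × ℝ} {a : ℝ} (ha : γ a = η a)
    (h1 : ∀ s t, s ≤ t → t ≤ a → M.dist (γ s) (γ t) ≤ t - s)
    (h2 : ∀ s t, a ≤ s → s ≤ t → M.dist (η s) (η t) ≤ t - s) (s t : ℝ) (hst : s ≤ t) :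
    M.dist (if s ≤ a then γ s else η s) (if t ≤ a then γ t else η t) ≤ t - s := by
  split_ifs with hs ht ht
  · exact h1 s t hst ht
  · have := dist_triangle (M := M) (γ s) (γ a) (η t)
    have e1 := h1 s a hs le_rfl
    have e2 := h2 a t le_rfl (not_le.1 ht).le
    rw [← ha] at e2
    linarith
  · exact absurd (hst.trans ht) hs
  · exact h2 s t (not_le.1 hs).le hst

/-- Limits of almost calibrated curves are calibrated. -/
theorem cal_limit {ι : Type*} (U : Ultrafilter ι) {f : ℝ × ℝ → ℝ} (hf : M.Lip f)
    {σ : ι → ℝ → ℝ × ℝ} {L ε : ι → ℝ} {γ : ℝ → ℝ × ℝ} (hγ : M.Cal f γ)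
    (hσ : ∀ i s t, 0 ≤ s → s ≤ t → t ≤ L i → M.dist (σ i s) (σ i t) ≤ t - s)
    (hL : Tendsto L U atTop) (hε : Tendsto ε U (𝓝 0))
    (hf' : ∀ i s, 0 ≤ s → s ≤ L i → f (σ i 0) + s - ε i ≤ f (σ i s))
    (h0 : Tendsto (fun i => σ i 0) U (𝓝 (γ 0))) {s : ℝ} (hs : 0 ≤ s) :
    Tendsto (fun i => σ i s) U (𝓝 (γ s)) := by
  have hlim : ∀ s, ∃ p, 0 ≤ s → Tendsto (fun i => σ i s) U (𝓝 p) := fun s => by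
    by_cases hs : 0 ≤ s
    · obtain ⟨p, hp⟩ := exists_ultrafilter_lim U (f := fun i => σ i s)
        (C := ‖γ 0‖ + 1 + s / M.cm) (by
          filter_upwards [hL.eventually_ge_atTop s,
            h0.norm.eventually (gt_mem_nhds (lt_add_one _))] with i h1 h2
          have := norm_le_of_dist_le (M := M) (hσ i 0 s le_rfl hs h1)
          rw [sub_zero] at this
          linarith)
      exact ⟨p, fun _ => hp⟩
    · exact ⟨0, fun h => (hs h).elim⟩
  choose η hη using hlim
  have e0 : γ 0 = η 0 := tendsto_nhds_unique h0 (hη 0 le_rfl)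
  have hlip : ∀ s t, 0 ≤ s → s ≤ t → M.dist (η s) (η t) ≤ t - s := fun s t a b => by
    refine le_of_tendsto (tendsto_dist (M := M) (hη s a) (hη t (a.trans b))) ?_
    filter_upwards [hL.eventually_ge_atTop t] with i hi
    exact hσ i s t a b hi
  have hfη : ∀ s, 0 ≤ s → f (η s) = f (γ 0) + s := fun s hs => by
    apply le_antisymm
    · have h1 := hf (η 0) (η s)
      have h2 := hlip 0 s le_rfl hs
      rw [← e0] at h1 h2
      linarith
    · have h1 : Tendsto (fun i => f (σ i 0) + s - ε i) U (𝓝 (f (γ 0) + s - 0)) :=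
        (((hf.continuous.tendsto _).comp h0).add_const s).sub hε
      rw [sub_zero] at h1
      refine le_of_tendsto_of_tendsto h1 ((hf.continuous.tendsto _).comp (hη s hs)) ?_
      filter_upwards [hL.eventually_ge_atTop s] with i hi
      exact hf' i s hs hi
  set ρ : ℝ → ℝ × ℝ := fun t => if t ≤ 0 then γ t else η t with hρ
  have hρc : M.Cal f ρ := by
    refine ⟨fun s t h => lip_glue e0 (fun s t h _ => hγ.1 s t h) hlip s t h, fun s => ?_⟩
    simp only [hρ, le_refl, if_true]
    split_ifs with h
    · exact hγ.2 s
    · exact hfη s (not_le.1 h).le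
  have := (hρc.locIso hf).eq_of_eqOn (hγ.locIso hf) (show (-1:ℝ) < 0 by norm_num)
    (fun t ht => by simp only [hρ, if_pos ht.2.le])
  have es : η s = γ s := by
    rcases hs.eq_or_lt with rfl | h
    · exact e0.symm
    · have := congrFun this s
      simpa only [hρ, if_neg (not_le.2 h)] using this
  rw [← es]
  exact hη s hs

theorem cal_limit' {ι : Type*} (U : Ultrafilter ι) {f : ℝ × ℝ → ℝ} (hf : M.Lip f)
    {σ : ι → ℝ → ℝ × ℝ} {L ε : ι → ℝ} {γ : ℝ → ℝ × ℝ} (hγ : M.Cal f γ)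
    (hσ : ∀ i s t, 0 ≤ s → s ≤ t → t ≤ L i → M.dist (σ i s) (σ i t) ≤ t - s)
    (hL : Tendsto L U atTop) (hε : Tendsto ε U (𝓝 0))
    (hf' : ∀ i s, 0 ≤ s → s ≤ L i → f (σ i 0) + s - ε i ≤ f (σ i s))
    (h0 : Tendsto (fun i => σ i 0) U (𝓝 (γ 0))) {s : ι → ℝ} {a : ℝ} (hs : ∀ i, 0 ≤ s i)
    (hsa : Tendsto s U (𝓝 a)) : Tendsto (fun i => σ i (s i)) U (𝓝 (γ a)) := by
  have ha : 0 ≤ a := ge_of_tendsto' hsa hs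
  have h1 := cal_limit U hf hγ hσ hL hε hf' h0 ha
  have hm := M.cm_pos
  have h2 : Tendsto (fun i => |s i - a| / M.cm) U (𝓝 0) := by
    have := ((hsa.sub_const a).abs).div_const M.cm
    simpa using this
  have h3 : Tendsto (fun i => σ i (s i) - σ i a) U (𝓝 0) := by
    refine squeeze_zero_norm' ?_ h2
    filter_upwards [hL.eventually_ge_atTop a, hL.eventually_ge_atTop (a + 1),
      hsa.eventually (gt_mem_nhds (lt_add_one a))] with i h4 h5 h6
    rw [le_div_iff₀ hm, mul_comm]
    rcases le_total (s i) a with h | h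
    · rw [abs_sub_comm, abs_of_nonneg (sub_nonneg.2 h), norm_sub_rev]
      exact (cm_norm_le_dist _ _).trans (hσ i _ _ (hs i) h h4)
    · rw [abs_of_nonneg (sub_nonneg.2 h)]
      exact (cm_norm_le_dist _ _).trans (hσ i _ _ ha h (by linarith))
  have := h3.add h1
  simpa using this

variable {ℓ : ℝ} {o : ℝ × ℝ} {e : ℤ × ℤ}

theorem dist_sub_lat_right (x y : ℝ × ℝ) (k : ℤ × ℤ) :
    M.dist x (y - lat k) = M.dist (x + lat k) y := by
  rw [← dist_add_lat x (y - lat k) k, sub_add_cancel]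

/-- Through every point there is a ray along which the Busemann type function decreases. -/
theorem exists_ray (h : ∀ n : ℕ, M.dist o (o + lat (n • e)) = n * ℓ) (hℓ : 0 < ℓ) (z : ℝ × ℝ) :
    ∃ η : ℝ → ℝ × ℝ, η 0 = z ∧ (∀ s t, 0 ≤ s → s ≤ t → M.dist (η s) (η t) ≤ t - s) ∧
      ∀ s, 0 ≤ s → M.bus ℓ o e (η s) = M.bus ℓ o e z - s := by
  choose σ h0 h1 h2 h3 using fun n : ℕ => exists_segment (M := M) z (o - lat (n • e))
  set L : ℕ → ℝ := fun n => M.dist z (o - lat (n • e)) with hL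
  have hL' : ∀ n, L n = M.dist o (z + lat (n • e)) := fun n => by
    rw [hL, dist_comm o, ← dist_sub_lat_right]
  have hLtop : Tendsto L atTop atTop := by
    have : Tendsto (fun n : ℕ => (n : ℝ) * ℓ + -M.dist o z) atTop atTop :=
      tendsto_atTop_add_const_right _ _ (tendsto_natCast_atTop_atTop.atTop_mul_const hℓ)
    refine tendsto_atTop_mono (fun n => ?_) this
    have := bus_lower h z n
    rw [hL']; linarith
  set U : Ultrafilter ℕ := Filter.hyperfilter ℕ
  have hU : (U : Filter ℕ) ≤ atTop := by
    rw [← Nat.cofinite_eq_atTop]; exact Filter.hyperfilter_le_cofinite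
  have hlim : ∀ s, ∃ p, 0 ≤ s → Tendsto (fun n => σ n s) U (𝓝 p) := fun s => by
    by_cases hs : 0 ≤ s
    · obtain ⟨p, hp⟩ := exists_ultrafilter_lim U (f := fun n => σ n s) (C := ‖z‖ + s / M.cm)
        (Eventually.of_forall fun n => by
          have := h3 n 0 s
          rw [h0, zero_sub, abs_neg, abs_of_nonneg hs] at this
          exact norm_le_of_dist_le this)
      exact ⟨p, fun _ => hp⟩
    · exact ⟨0, fun h => (hs h).elim⟩
  choose η hη using hlim
  have e0 : η 0 = z :=
    tendsto_nhds_unique (hη 0 le_rfl) (tendsto_const_nhds.congr fun n => (h0 n).symm)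
  have hlip : ∀ s t, 0 ≤ s → s ≤ t → M.dist (η s) (η t) ≤ t - s := fun s t a b => by
    refine le_of_tendsto' (tendsto_dist (M := M) (hη s a) (hη t (a.trans b))) fun n => ?_
    rw [← abs_of_nonneg (sub_nonneg.2 b), abs_sub_comm]
    exact h3 n s t
  refine ⟨η, e0, hlip, fun s hs => le_antisymm ?_ ?_⟩
  · have l1 : Tendsto (fun n : ℕ => M.dist o (z + lat (n • e)) - n * ℓ - s) U
        (𝓝 (M.bus ℓ o e z - s)) := ((tendsto_bus h z).mono_left hU).sub_const s
    refine le_of_tendsto_of_tendsto (((bus_lip h).continuous.tendsto _).comp (hη s hs)) l1 ?_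
    filter_upwards [(hLtop.mono_left hU).eventually_ge_atTop s] with n hn
    have a1 := bus_le h (σ n s) n
    have a2 := h2 n s (L n) hs hn le_rfl
    simp only [hL] at a2
    rw [h1, dist_sub_lat_right, dist_comm] at a2
    have a3 := hL' n
    simp only [hL] at a3
    simp only [Function.comp]
    linarith
  · have a1 := bus_lip h (η s) z
    have a2 := hlip 0 s le_rfl hs
    rw [e0, dist_comm] at a2
    linarith

end TorusMetric

namespace TorusMetric

variable {M : TorusMetric}

/-- Summing a sequence indexed by the integers. -/
theorem exists_int_sum {A : Type*} [AddCommGroup A] (f : ℤ → A) :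
    ∃ t : ℤ → A, t 0 = 0 ∧ ∀ j, t (j + 1) = t j + f j := by
  refine ⟨fun j => if 0 ≤ j then ∑ i ∈ Finset.Ico 0 j, f i else -∑ i ∈ Finset.Ico j 0, f i,
    by simp, fun j => ?_⟩
  rcases lt_trichotomy j (-1) with h | h | h
  · have h1 : ¬ (0 ≤ j + 1) := by omega
    have h2 : ¬ (0 ≤ j) := by omega
    simp only [h1, h2, if_false]
    rw [← Finset.insert_Ico_add_one_left_eq_Ico (show j < 0 by omega), Finset.sum_insert (by simp)]
    abel
  · subst h
    have : Finset.Ico (-1 : ℤ) 0 = {-1} := by decide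
    simp [this]
  · have h1 : (0 ≤ j + 1) := by omega
    have h2 : (0 ≤ j) := by omega
    simp only [h1, h2, if_true]
    rw [← Finset.insert_Ico_right_eq_Ico_add_one h2, Finset.sum_insert (by simp)]
    abel

theorem exists_int_floor {t : ℤ → ℝ} {m : ℝ} (hm : 0 < m) (ht : ∀ j, m ≤ t (j + 1) - t j) (u : ℝ) :
    ∃ j, t j ≤ u ∧ u < t (j + 1) := by
  have hmono : Monotone fun j : ℤ => t j - m * j := by
    refine monotone_int_of_le_succ fun j => ?_
    have := ht j
    push_cast
    linarith
  have h1 : ∃ b : ℤ, ∀ z : ℤ, t z ≤ u → z ≤ b := by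
    obtain ⟨N, hN⟩ := exists_nat_gt ((u - t 0) / m)
    rw [div_lt_iff₀ hm] at hN
    refine ⟨N, fun z hz => ?_⟩
    by_contra hlt
    have h2 := hmono (show (0:ℤ) ≤ z by omega)
    have h3 : (N:ℝ) ≤ z := by exact_mod_cast (show (N:ℤ) ≤ z by omega)
    simp only [Int.cast_zero, mul_zero, sub_zero] at h2
    nlinarith
  have h2 : ∃ z, t z ≤ u := by
    obtain ⟨N, hN⟩ := exists_nat_gt ((t 0 - u) / m)
    rw [div_lt_iff₀ hm] at hN
    refine ⟨-N, ?_⟩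
    have h2 := hmono (show (-N:ℤ) ≤ 0 by omega)
    simp only [Int.cast_zero, mul_zero, sub_zero] at h2
    push_cast at h2
    nlinarith
  obtain ⟨j, hj, hj'⟩ := Int.exists_greatest_of_bdd h1 h2
  refine ⟨j, hj, not_le.1 fun h => ?_⟩
  have := hj' _ h
  omega

/-- Concatenation of curves parametrized with at most unit speed. -/
theorem exists_concat {t : ℤ → ℝ} {m : ℝ} (hm : 0 < m) (ht : ∀ j, m ≤ t (j + 1) - t j)
    {σ : ℤ → ℝ → ℝ × ℝ} (hσ : ∀ j, σ j (t (j + 1) - t j) = σ (j + 1) 0)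
    (hl : ∀ j u v, M.dist (σ j u) (σ j v) ≤ |u - v|) :
    ∃ γ : ℝ → ℝ × ℝ, (∀ j s, 0 ≤ s → s ≤ t (j + 1) - t j → γ (t j + s) = σ j s) ∧
      ∀ u v, u ≤ v → M.dist (γ u) (γ v) ≤ v - u := by
  choose J hJ hJ' using exists_int_floor hm ht
  have hmono : StrictMono t := strictMono_int_of_lt_succ fun j => by linarith [ht j]
  have huniq : ∀ j u, t j ≤ u → u < t (j + 1) → J u = j := fun j u h1 h2 => by
    have a1 := hmono.lt_iff_lt.1 (h1.trans_lt (hJ' u))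
    have a2 := hmono.lt_iff_lt.1 ((hJ u).trans_lt h2)
    omega
  set γ : ℝ → ℝ × ℝ := fun u => σ (J u) (u - t (J u)) with hγ
  have hval : ∀ j s, 0 ≤ s → s ≤ t (j + 1) - t j → γ (t j + s) = σ j s := fun j s h0 h1 => by
    rcases h1.lt_or_eq with h | h
    · simp only [hγ, huniq j (t j + s) (by linarith) (by linarith), add_sub_cancel_left]
    · have e : t j + s = t (j + 1) := by linarith
      have := ht (j + 1)
      simp only [hγ, e, huniq (j + 1) (t (j + 1)) le_rfl (by linarith), sub_self]
      rw [← hσ, h]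
  have hl' : ∀ j u v, 0 ≤ u → u ≤ v → v ≤ t (j + 1) - t j →
      M.dist (γ (t j + u)) (γ (t j + v)) ≤ v - u := fun j u v h0 h1 h2 => by
    rw [hval j u h0 (h1.trans h2), hval j v (h0.trans h1) h2]
    refine (hl j u v).trans ?_
    rw [abs_sub_comm, abs_of_nonneg (sub_nonneg.2 h1)]
  have hnodes : ∀ i j, i ≤ j → M.dist (γ (t i)) (γ (t j)) ≤ t j - t i := fun i j hij => by
    induction j, hij using Int.leInduction with
    | base => rw [dist_self]; simp
    | succ j hij ih =>
      have h1 := hl' j 0 (t (j + 1) - t j) le_rfl (by linarith [ht j]) le_rfl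
      rw [add_zero, add_sub_cancel, sub_zero] at h1
      linarith [dist_triangle (M := M) (γ (t i)) (γ (t j)) (γ (t (j + 1)))]
  refine ⟨γ, hval, fun u v huv => ?_⟩
  have hJm : J u ≤ J v := by
    have := hmono.lt_iff_lt.1 ((hJ u).trans_lt (huv.trans_lt (hJ' v)))
    omega
  rcases hJm.eq_or_lt with h | h
  · have h1 := hl' (J u) (u - t (J u)) (v - t (J u)) (by linarith [hJ u]) (by linarith)
      (by rw [h]; linarith [hJ' v])
    rw [add_sub_cancel, add_sub_cancel] at h1
    linarith
  · have h1 := hl' (J u) (u - t (J u)) (t (J u + 1) - t (J u)) (by linarith [hJ u])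
      (by linarith [hJ' u]) le_rfl
    have h2 := hnodes (J u + 1) (J v) (by omega)
    have h3 := hl' (J v) 0 (v - t (J v)) le_rfl (by linarith [hJ v]) (by linarith [hJ' v])
    rw [add_sub_cancel, add_sub_cancel] at h1
    rw [add_sub_cancel, add_zero] at h3
    linarith [dist_triangle (M := M) (γ u) (γ (t (J u + 1))) (γ v),
      dist_triangle (M := M) (γ (t (J u + 1))) (γ (t (J v))) (γ v)]

theorem Lip.eq_along {f : ℝ × ℝ → ℝ} (hf : M.Lip f) {ℓ : ℝ} (hℓ : 0 < ℓ) {e : ℤ × ℤ}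
    {α : ℝ → ℝ × ℝ} (hα : ∀ s t, s ≤ t → M.dist (α s) (α t) ≤ t - s)
    (hper : ∀ s, α (s + ℓ) = α s + lat e) (hfe : ∀ x, f (x + lat e) = f x + ℓ) (s : ℝ) :
    f (α s) = f (α 0) + s := by
  have h1 : ∀ n : ℕ, f (α (n * ℓ)) = f (α 0) + n * ℓ := fun n => by
    induction n with
    | zero => simp
    | succ n ih =>
      push_cast
      rw [add_mul, one_mul, hper, hfe, ih]; ring
  have h2 : ∀ n : ℕ, f (α (-(n * ℓ))) = f (α 0) - n * ℓ := fun n => by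
    induction n with
    | zero => simp
    | succ n ih =>
      have := hper (-((n + 1 : ℕ) * ℓ))
      rw [show -(((n + 1 : ℕ) : ℝ) * ℓ) + ℓ = -(n * ℓ) by push_cast; ring] at this
      rw [this, hfe] at ih
      push_cast at ih ⊢
      linarith
  obtain ⟨n, hn⟩ := exists_nat_gt (|s| / ℓ)
  rw [div_lt_iff₀ hℓ] at hn
  have a1 := neg_abs_le s
  have a2 := le_abs_self s
  have b1 := hf (α (-(n * ℓ))) (α s)
  have b2 := hf (α s) (α (n * ℓ))
  have c1 := hα (-(n * ℓ)) s (by linarith)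
  have c2 := hα s (n * ℓ) (by linarith)
  rw [h2] at b1
  rw [h1] at b2
  linarith

theorem exists_axis (M : TorusMetric) : ∃ (ℓ : ℝ) (α : ℝ → ℝ × ℝ), 0 < ℓ ∧
    (∀ n : ℕ, M.dist (α 0) (α 0 + lat (n • e₁)) = n * ℓ) ∧
    (∀ s t, s ≤ t → M.dist (α s) (α t) ≤ t - s) ∧ ∀ s, α (s + ℓ) = α s + lat e₁ := by
  obtain ⟨o, ℓ, h1, h2⟩ := exists_axis_point (M := M) e₁
  have hℓ : 0 < ℓ := by
    rw [← h1]
    refine lt_of_lt_of_le ?_ (cm_norm_le_dist _ _)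
    have : ‖o + lat e₁ - o‖ = 1 := by simp [lat, e₁, Prod.norm_def]
    rw [this, mul_one]
    exact M.cm_pos
  obtain ⟨σ, s0, s1, -, s3⟩ := exists_segment (M := M) o (o + lat e₁)
  rw [h1] at s1
  obtain ⟨γ, hγ, hγ'⟩ := exists_concat (M := M) (t := fun j => j * ℓ)
    (σ := fun j s => σ s + lat (j, 0)) hℓ (fun j => by push_cast; linarith)
    (fun j => by
      rw [show ((j + 1 : ℤ) : ℝ) * ℓ - j * ℓ = ℓ by push_cast; ring, s0, s1]
      simp only [lat, e₁]
      ext <;> simp; ring)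
    (fun j u v => by rw [dist_add_lat]; exact s3 u v)
  have e0 : γ 0 = o := by
    have := hγ 0 0 le_rfl (by push_cast; linarith)
    simpa [s0, lat, ← Prod.zero_eq_mk] using this
  refine ⟨ℓ, γ, hℓ, by rw [e0]; exact h2, hγ', fun s => ?_⟩
  obtain ⟨j, hj, hj'⟩ := exists_int_floor (t := fun j : ℤ => j * ℓ) hℓ
    (fun j => by push_cast; linarith) s
  have a1 := hγ j (s - j * ℓ) (by linarith) (by linarith)
  have a2 := hγ (j + 1) (s - j * ℓ) (by linarith) (by push_cast at hj' ⊢; linarith)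
  rw [add_sub_cancel] at a1
  rw [show ((j + 1 : ℤ) : ℝ) * ℓ + (s - j * ℓ) = s + ℓ by push_cast; ring] at a2
  rw [a1, a2]
  simp only [lat, e₁]
  ext <;> simp; ring

end TorusMetric

namespace TorusMetric

/-- A periodic minimal line `α` together with a vertical translation moving it off itself. -/
structure Strip (M : TorusMetric) where
  ℓ : ℝ
  α : ℝ → ℝ × ℝ
  Bd : ℝ
  m : ℤ
  hℓ : 0 < ℓ
  axis : ∀ n : ℕ, M.dist (α 0) (α 0 + lat (n • e₁)) = n * ℓ
  lip : ∀ s t, s ≤ t → M.dist (α s) (α t) ≤ t - s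
  per : ∀ s, α (s + ℓ) = α s + lat e₁
  hB : ∀ s, |(α s).2 - (α 0).2| ≤ Bd
  hm : 2 * Bd + 1 < m

theorem lip_continuous {M : TorusMetric} {γ : ℝ → ℝ × ℝ}
    (h : ∀ s t, s ≤ t → M.dist (γ s) (γ t) ≤ t - s) : Continuous γ := by
  refine continuous_of_lip (M := M) fun s t => ?_
  rcases le_total s t with hs | hs
  · rw [abs_sub_comm, abs_of_nonneg (sub_nonneg.2 hs)]; exact h s t hs
  · rw [dist_comm, abs_of_nonneg (sub_nonneg.2 hs)]; exact h t s hs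

theorem exists_strip (M : TorusMetric) : ∃ (o2 Bd : ℝ), ∀ m : ℤ, 2 * Bd + 1 < m →
    ∃ S : M.Strip, (S.α 0).2 = o2 ∧ S.Bd = Bd ∧ S.m = m := by
  obtain ⟨ℓ, α, hℓ, h1, h2, h3⟩ := exists_axis M
  obtain ⟨C, hC⟩ := isCompact_Icc.exists_bound_of_continuousOn (f := fun s => (α s).2 - (α 0).2)
    (((lip_continuous h2).snd.sub continuous_const).continuousOn (s := Icc 0 ℓ))
  have hp : Function.Periodic (fun s => (α s).2 - (α 0).2) ℓ := fun s => by
    simp only [h3 s]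
    simp [lat, e₁]
  refine ⟨(α 0).2, C, fun m hm => ⟨⟨ℓ, α, C, m, hℓ, h1, h2, h3, fun s => ?_, hm⟩, rfl, rfl, rfl⟩⟩
  obtain ⟨y, hy, e⟩ := hp.exists_mem_Ico₀ hℓ s
  rw [e]
  exact hC y ⟨hy.1, hy.2.le⟩

namespace Strip

variable {M : TorusMetric} (S : M.Strip)

/-- The vertical translation of a strip. -/
def v : ℤ × ℤ := (0, S.m)

/-- The Busemann function at minus infinity of the lower boundary line. -/
def b : ℝ × ℝ → ℝ := M.bus S.ℓ (S.α 0) e₁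

/-- The Busemann function at plus infinity of the upper boundary line. -/
def b' : ℝ × ℝ → ℝ := M.bus S.ℓ (S.α 0 + lat S.v) (-e₁)

/-- The excess of the lower boundary line. -/
def β : ℝ := S.b' (S.α 0)

/-- The excess of a point: it vanishes along the minimal lines joining the two boundary lines. -/
def E (x : ℝ × ℝ) : ℝ := S.b x + S.b' x - S.β

theorem axis' (n : ℕ) : M.dist (S.α 0 + lat S.v) (S.α 0 + lat S.v + lat (n • (-e₁))) = n * S.ℓ := by
  rw [add_right_comm, dist_add_lat, ← S.axis n, smul_neg, lat_neg, ← sub_eq_add_neg,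
    dist_sub_lat_right, dist_comm]

theorem b_lip : M.Lip S.b := bus_lip S.axis
theorem b'_lip : M.Lip S.b' := bus_lip S.axis'

theorem b_add (x : ℝ × ℝ) : S.b (x + lat e₁) = S.b x + S.ℓ := bus_add S.axis x

theorem b'_add (x : ℝ × ℝ) : S.b' (x + lat e₁) = S.b' x - S.ℓ := by
  have := bus_add S.axis' (x + lat e₁)
  rw [lat_neg, add_neg_cancel_right] at this
  exact eq_sub_of_add_eq this.symm

theorem int_add {A : Type*} [AddCommGroup A] {B : Type*} [AddCommGroup B] {f : A → B} {a : A} {c : B}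
    (h : ∀ x, f (x + a) = f x + c) (n : ℤ) (x : A) : f (x + n • a) = f x + n • c := by
  induction n using Int.induction_on with
  | zero => simp
  | succ n ih => rw [add_smul, one_smul, ← add_assoc, h, ih, add_smul, one_smul, add_assoc]
  | pred n ih =>
    have := h (x + (-(n:ℤ) - 1) • a)
    rw [add_assoc, ← add_one_zsmul, sub_add_cancel, ih] at this
    rw [eq_sub_of_add_eq this.symm, sub_smul, one_smul, add_sub_assoc]

theorem lat_fst (n : ℤ) : lat (n, 0) = n • lat e₁ := by
  ext <;> simp [lat, e₁]

theorem b_add_int (n : ℤ) (x : ℝ × ℝ) : S.b (x + lat (n, 0)) = S.b x + n * S.ℓ := by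
  rw [lat_fst, int_add S.b_add, zsmul_eq_mul]

theorem b'_add_int (n : ℤ) (x : ℝ × ℝ) : S.b' (x + lat (n, 0)) = S.b' x - n * S.ℓ := by
  rw [lat_fst, int_add (f := S.b') (c := -S.ℓ) (fun x => by rw [S.b'_add, sub_eq_add_neg]), zsmul_eq_mul]
  ring

theorem α_add_int (n : ℤ) (s : ℝ) : S.α (s + n * S.ℓ) = S.α s + lat (n, 0) := by
  rw [← zsmul_eq_mul, int_add S.per, lat_fst]

theorem E_add_int (n : ℤ) (x : ℝ × ℝ) : S.E (x + lat (n, 0)) = S.E x := by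
  rw [E, E, b_add_int, b'_add_int]; ring

theorem b_α (s : ℝ) : S.b (S.α s) = s := by
  rw [S.b_lip.eq_along S.hℓ S.lip S.per S.b_add s]
  have : S.b (S.α 0) = 0 := by
    refine le_antisymm ?_ (le_bus fun n => by rw [S.axis, sub_self])
    have : S.b (S.α 0) ≤ _ := bus_le S.axis (S.α 0) 0
    simpa [lat_zero, dist_self] using this
  rw [this, zero_add]

theorem b'_α (s : ℝ) : S.b' (S.α s) = S.β - s := by
  have := S.b'_lip.eq_along S.hℓ (α := fun s => S.α (-s)) (e := -e₁)
    (fun s t h => by rw [dist_comm]; linarith [S.lip (-t) (-s) (by linarith)])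
    (fun s => by
      have := S.per (-(s + S.ℓ))
      rw [show -(s + S.ℓ) + S.ℓ = -s by ring] at this
      simp only [this, lat_neg, add_neg_cancel_right]) (fun x => bus_add S.axis' x) (-s)
  simp only [neg_neg, neg_zero] at this
  rw [this, β]; ring

theorem b'_αv (s : ℝ) : S.b' (S.α s + lat S.v) = -s := by
  have := S.b'_lip.eq_along S.hℓ (α := fun s => S.α (-s) + lat S.v) (e := -e₁)
    (fun s t h => by rw [dist_add_lat, dist_comm]; linarith [S.lip (-t) (-s) (by linarith)])
    (fun s => by
      have := S.per (-(s + S.ℓ))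
      rw [show -(s + S.ℓ) + S.ℓ = -s by ring] at this
      simp only [this, lat_neg]
      abel) (fun x => bus_add S.axis' x) (-s)
  simp only [neg_neg, neg_zero] at this
  have h0 : S.b' (S.α 0 + lat S.v) = 0 := by
    refine le_antisymm ?_ (le_bus fun n => by rw [S.axis', sub_self])
    have : S.b' (S.α 0 + lat S.v) ≤ _ := bus_le S.axis' (S.α 0 + lat S.v) 0
    simpa [lat_zero, dist_self] using this
  rw [this, h0, zero_add]

theorem b_αv (s : ℝ) : S.b (S.α s + lat S.v) = S.β + s := by
  have := S.b_lip.eq_along S.hℓ (α := fun s => S.α s + lat S.v)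
    (fun s t h => by rw [dist_add_lat]; exact S.lip _ _ h)
    (fun s => by simp only [S.per]; abel) S.b_add s
  rw [this]
  congr 1
  unfold β b b' bus
  congr 1
  funext n
  rw [smul_neg, lat_neg, ← sub_eq_add_neg, dist_sub_lat_right, dist_comm, add_right_comm]

theorem E_nonneg (x : ℝ × ℝ) : 0 ≤ S.E x := by
  have key : ∀ n k : ℕ, S.β ≤ (M.dist (S.α 0) (x + lat (n • e₁)) - n * S.ℓ) +
      (M.dist (S.α 0 + lat S.v) (x + lat (k • (-e₁))) - k * S.ℓ) := fun n k => by
    have h1 := dist_triangle (M := M) (S.α 0) (x + lat (n • e₁))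
      (S.α 0 + lat S.v + lat ((n + k) • e₁))
    have h2 := bus_le S.axis (S.α 0 + lat S.v) (n + k)
    have h3 := S.b_αv 0
    rw [add_zero] at h3
    change S.b _ ≤ _ at h2
    rw [h3] at h2
    have h4 : M.dist (x + lat (n • e₁)) (S.α 0 + lat S.v + lat ((n + k) • e₁)) =
        M.dist (S.α 0 + lat S.v) (x + lat (k • (-e₁))) := by
      rw [add_smul, lat_add, ← add_assoc, add_right_comm, dist_add_lat, smul_neg, lat_neg,
        ← sub_eq_add_neg, dist_sub_lat_right, dist_comm]
    push_cast at h2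
    linarith
  have h2 : S.β - S.b' x ≤ S.b x := le_bus fun n => by
    have h3 : S.β - (M.dist (S.α 0) (x + lat (n • e₁)) - n * S.ℓ) ≤ S.b' x :=
      le_bus fun k => by linarith [key n k]
    linarith
  unfold E
  linarith

theorem E_continuous : Continuous S.E :=
  (S.b_lip.continuous.add S.b'_lip.continuous).sub continuous_const

/-- The minimal lines of a strip, parametrized by the Busemann function. -/
structure Leaf (γ : ℝ → ℝ × ℝ) : Prop where
  lip : ∀ s t, s ≤ t → M.dist (γ s) (γ t) ≤ t - s
  hb : ∀ s, S.b (γ s) = s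
  hb' : ∀ s, S.b' (γ s) = S.β - s

variable {S}

theorem Leaf.E {γ : ℝ → ℝ × ℝ} (h : S.Leaf γ) (s : ℝ) : S.E (γ s) = 0 := by
  rw [Strip.E, h.hb, h.hb']; ring

theorem Leaf.cal {γ : ℝ → ℝ × ℝ} (h : S.Leaf γ) (a : ℝ) : M.Cal S.b (fun s => γ (a + s)) :=
  ⟨fun s t hst => by linarith [h.lip (a + s) (a + t) (by linarith)], fun s => by
    simp only [h.hb]; ring⟩

theorem Leaf.cal' {γ : ℝ → ℝ × ℝ} (h : S.Leaf γ) (a : ℝ) : M.Cal S.b' (fun s => γ (a - s)) :=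
  ⟨fun s t hst => by
    rw [dist_comm]; linarith [h.lip (a - t) (a - s) (by linarith)], fun s => by
    simp only [h.hb']; ring⟩

theorem Leaf.continuous {γ : ℝ → ℝ × ℝ} (h : S.Leaf γ) : Continuous γ := lip_continuous h.lip

theorem Leaf.isoOn {γ : ℝ → ℝ × ℝ} (h : S.Leaf γ) (a b : ℝ) : M.IsoOn γ a b := by
  intro s t _ hst _
  have h1 := S.b_lip (γ s) (γ t)
  rw [h.hb, h.hb] at h1
  linarith [h.lip s t hst]

theorem Leaf.dist {γ : ℝ → ℝ × ℝ} (h : S.Leaf γ) (s t : ℝ) : M.dist (γ s) (γ t) = |s - t| := by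
  rcases le_total s t with hs | hs
  · rw [h.isoOn s t s t le_rfl hs le_rfl, abs_sub_comm, abs_of_nonneg (by linarith)]
  · rw [dist_comm, h.isoOn t s t s le_rfl hs le_rfl, abs_of_nonneg (by linarith)]

theorem Leaf.locIso {γ : ℝ → ℝ × ℝ} (h : S.Leaf γ) : M.LocIso γ :=
  fun _ => ⟨1, one_pos, h.isoOn _ _⟩

theorem Leaf.unique {γ η : ℝ → ℝ × ℝ} (h : S.Leaf γ) (h' : S.Leaf η) {s t : ℝ}
    (e : γ s = η t) : γ = η := by
  have est : s = t := by rw [← h.hb s, e, h'.hb]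
  subst est
  set ρ : ℝ → ℝ × ℝ := fun t => if t ≤ s then γ t else η t with hρ
  have hl : S.Leaf ρ := ⟨fun a b hab => lip_glue e (fun a b hab _ => h.lip a b hab)
    (fun a b _ hab => h'.lip a b hab) a b hab, fun a => by
      simp only [hρ]; split_ifs; exacts [h.hb a, h'.hb a], fun a => by
      simp only [hρ]; split_ifs; exacts [h.hb' a, h'.hb' a]⟩
  have e1 := hl.locIso.eq_of_eqOn h.locIso (show s - 1 < s by linarith)
    (fun t ht => by simp only [hρ, if_pos ht.2.le])
  have e2 := hl.locIso.eq_of_eqOn h'.locIso (show s < s + 1 by linarith)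
    (fun t ht => by simp only [hρ, if_neg (not_le.2 ht.1)])
  rw [← e1, e2]

theorem Leaf.translate {γ : ℝ → ℝ × ℝ} (h : S.Leaf γ) (n : ℤ) :
    S.Leaf (fun s => γ (s - n * S.ℓ) + lat (n, 0)) :=
  ⟨fun s t hst => by
    rw [dist_add_lat]; linarith [h.lip (s - n * S.ℓ) (t - n * S.ℓ) (by linarith)],
   fun s => by rw [b_add_int, h.hb]; ring, fun s => by rw [b'_add_int, h.hb']; ring⟩

variable (S)

theorem leaf_α : S.Leaf S.α := ⟨S.lip, S.b_α, S.b'_α⟩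

theorem leaf_αv : S.Leaf (fun s => S.α (s - S.β) + lat S.v) :=
  ⟨fun s t hst => by
    rw [dist_add_lat]; linarith [S.lip (s - S.β) (t - S.β) (by linarith)],
   fun s => by rw [b_αv]; ring, fun s => by rw [b'_αv]; ring⟩

theorem exists_leaf {z : ℝ × ℝ} (hz : S.E z = 0) : ∃ γ, S.Leaf γ ∧ γ (S.b z) = z := by
  obtain ⟨η, h1, h2, h3⟩ := exists_ray S.axis S.hℓ z
  obtain ⟨η', h1', h2', h3'⟩ := exists_ray S.axis' S.hℓ z
  change ∀ s, 0 ≤ s → S.b (η s) = S.b z - s at h3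
  change ∀ s, 0 ≤ s → S.b' (η' s) = S.b' z - s at h3'
  set a := S.b z with ha
  have hz' : S.b' z = S.β - a := by unfold E at hz; linarith
  have e3 : ∀ s, 0 ≤ s → S.b' (η s) = S.β - a + s := fun s hs => by
    have i1 := S.E_nonneg (η s)
    have i2 := S.b'_lip (η 0) (η s)
    have i3 := h2 0 s le_rfl hs
    rw [h1] at i2 i3
    have i4 := h3 s hs
    unfold E at i1
    linarith
  have e3' : ∀ s, 0 ≤ s → S.b (η' s) = a + s := fun s hs => by
    have i1 := S.E_nonneg (η' s)
    have i2 := S.b_lip (η' 0) (η' s)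
    have i3 := h2' 0 s le_rfl hs
    rw [h1'] at i2 i3
    have i4 := h3' s hs
    unfold E at i1
    linarith
  refine ⟨fun s => if s ≤ a then η (a - s) else η' (s - a), ⟨fun s t hst => ?_, fun s => ?_,
    fun s => ?_⟩, ?_⟩
  · exact lip_glue (γ := fun s => η (a - s)) (η := fun s => η' (s - a)) (by simp [h1, h1'])
      (fun s t h1 h3 => by
        rw [dist_comm]
        linarith [h2 (a - t) (a - s) (by linarith) (by linarith)])
      (fun s t h1 h3 => by linarith [h2' (s - a) (t - a) (by linarith) (by linarith)]) s t hst
  · split_ifs with h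
    · rw [h3 _ (by linarith)]; ring
    · rw [e3' _ (by linarith)]; ring
  · split_ifs with h
    · rw [e3 _ (by linarith)]; ring
    · rw [h3' _ (by linarith), hz']; ring
  · simp [h1]

/-- The minimal line through a point of vanishing excess. -/
def leaf (z : ℝ × ℝ) : ℝ → ℝ × ℝ :=
  open Classical in if h : S.E z = 0 then (S.exists_leaf h).choose else fun _ => z

variable {S}

theorem leaf_spec {z : ℝ × ℝ} (hz : S.E z = 0) : S.Leaf (S.leaf z) := by
  rw [leaf, dif_pos hz]; exact (S.exists_leaf hz).choose_spec.1

theorem leaf_self {z : ℝ × ℝ} (hz : S.E z = 0) : S.leaf z (S.b z) = z := by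
  rw [leaf, dif_pos hz]; exact (S.exists_leaf hz).choose_spec.2

theorem Leaf.leaf_eq {γ : ℝ → ℝ × ℝ} (h : S.Leaf γ) (s : ℝ) : S.leaf (γ s) = γ :=
  (leaf_spec (h.E s)).unique h (leaf_self (h.E s))

theorem leaf_tendsto {ι : Type*} (U : Ultrafilter ι) {x : ι → ℝ × ℝ} {z : ℝ × ℝ} {s : ι → ℝ} {a : ℝ}
    (hx : ∀ᶠ i in U, S.E (x i) = 0) (hz : Tendsto x U (𝓝 z)) (hs : Tendsto s U (𝓝 a)) :
    Tendsto (fun i => S.leaf (x i) (s i)) U (𝓝 (S.leaf z a)) := by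
  have hE : S.E z = 0 := by
    have h1 : Tendsto (fun i => S.E (x i)) U (𝓝 (S.E z)) := (S.E_continuous.tendsto z).comp hz
    exact tendsto_nhds_unique h1 (tendsto_const_nhds.congr' (hx.mono fun i hi => hi.symm))
  have hbz : Tendsto (fun i => S.b (x i)) U (𝓝 (S.b z)) := (S.b_lip.continuous.tendsto z).comp hz
  have hd : ∀ᶠ i in U, ∀ t, M.dist (x i) (S.leaf (x i) t) = |S.b (x i) - t| := by
    filter_upwards [hx] with i hi t
    have := (leaf_spec hi).dist (S.b (x i)) t
    rwa [leaf_self hi] at this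
  have hlim : ∀ t, ∃ p, Tendsto (fun i => S.leaf (x i) t) U (𝓝 p) := fun t => by
    refine exists_ultrafilter_lim U (C := ‖z‖ + 1 + (|S.b z - t| + 1) / M.cm) ?_
    filter_upwards [hd, hz.norm.eventually (gt_mem_nhds (lt_add_one _)),
      ((hbz.sub_const t).abs).eventually (gt_mem_nhds (lt_add_one _))] with i h1 h2 h3
    have := norm_le_of_dist_le (M := M) ((h1 t).le.trans h3.le)
    linarith
  choose γ hγ using hlim
  have hγl : S.Leaf γ := by
    refine ⟨fun s t hst => ?_, fun s => ?_, fun s => ?_⟩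
    · refine le_of_tendsto (tendsto_dist (M := M) (hγ s) (hγ t)) ?_
      filter_upwards [hx] with i hi
      exact (leaf_spec hi).lip s t hst
    · have h1 : Tendsto (fun i => S.b (S.leaf (x i) s)) U (𝓝 (S.b (γ s))) :=
        (S.b_lip.continuous.tendsto _).comp (hγ s)
      exact tendsto_nhds_unique h1 (tendsto_const_nhds.congr'
        (hx.mono fun i hi => ((leaf_spec hi).hb s).symm))
    · have h1 : Tendsto (fun i => S.b' (S.leaf (x i) s)) U (𝓝 (S.b' (γ s))) :=
        (S.b'_lip.continuous.tendsto _).comp (hγ s)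
      exact tendsto_nhds_unique h1 (tendsto_const_nhds.congr'
        (hx.mono fun i hi => ((leaf_spec hi).hb' s).symm))
  have hvar : ∀ {s : ι → ℝ} {a : ℝ}, Tendsto s U (𝓝 a) →
      Tendsto (fun i => S.leaf (x i) (s i)) U (𝓝 (γ a)) := fun {s a} hs => by
    have h2 : Tendsto (fun i => |s i - a| / M.cm) U (𝓝 0) := by
      have := ((hs.sub_const a).abs).div_const M.cm
      simpa using this
    have h3 : Tendsto (fun i => S.leaf (x i) (s i) - S.leaf (x i) a) U (𝓝 0) := by
      refine squeeze_zero_norm' ?_ h2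
      filter_upwards [hx] with i hi
      rw [le_div_iff₀ M.cm_pos, mul_comm, abs_sub_comm, ← (leaf_spec hi).dist]
      exact cm_norm_le_dist _ _
    simpa using h3.add (hγ a)
  have hγz : γ (S.b z) = z :=
    tendsto_nhds_unique (hvar hbz) (hz.congr' (hx.mono fun i hi => (leaf_self hi).symm))
  have : S.leaf z = γ := by rw [← hγl.leaf_eq (S.b z), hγz]
  rw [this]
  exact hvar hs

/-- The minimal lines depend continuously on the point. -/
theorem leaf_continuous :
    Continuous fun q : {z // S.E z = 0} × ℝ => S.leaf q.1 q.2 := by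
  refine continuous_iff_ultrafilter.2 fun q U hU => ?_
  have h1 : Tendsto (fun q : {z // S.E z = 0} × ℝ => (q.1 : ℝ × ℝ)) U (𝓝 q.1) :=
    ((continuous_subtype_val.comp continuous_fst).tendsto q).mono_left hU
  exact leaf_tendsto U (Eventually.of_forall fun q => q.1.2) h1
    ((continuous_snd.tendsto q).mono_left hU)

attribute [irreducible] leaf

theorem leaf_continuous_comp {X : Type*} [TopologicalSpace X] {f : X → ℝ × ℝ} {s : X → ℝ}
    (hf : Continuous f) (hE : ∀ x, S.E (f x) = 0) (hs : Continuous s) :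
    Continuous fun x => S.leaf (f x) (s x) := by
  have h : Continuous fun x => ((⟨f x, hE x⟩ : {z // S.E z = 0}), s x) :=
    (hf.subtype_mk hE).prodMk hs
  exact (leaf_continuous (S := S)).comp h

end Strip

end TorusMetric

theorem lat_nsmul_nat (n : ℕ) (a : ℤ × ℤ) : lat (n • a) = n • lat a := by
  rw [lat_nsmul, Nat.cast_smul_eq_nsmul]

theorem idx_shift {f : ℝ → ℂ} (hf : Continuous f) (h0 : ∀ t, f t ≠ 0) (he : EndsRight f) (a : ℝ) :
    idx (fun t => f (t + a)) = idx f := by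
  obtain ⟨L, h1, h2, h3, h4⟩ := hasIdx_idx hf h0 he
  exact HasIdx.idx_eq ⟨fun t => L (t + a), h1.comp (continuous_add_const a), fun t => h2 _,
    (tendsto_atTop_add_const_right atTop a tendsto_id).eventually h3,
    (tendsto_atBot_add_const_right atBot a tendsto_id).eventually h4⟩

/-- The side of a curve on which a point lies. -/
def side (h : ℝ → ℝ × ℝ) (x : ℝ × ℝ) : ℤ := idx fun t => toC (h t - x)

/-- A curve staying at bounded distance from a uniform parametrization in the first coordinate. -/
def Steady (ℓ B : ℝ) (h : ℝ → ℝ × ℝ) : Prop := ∀ s, |s - ℓ * (h s).1| ≤ B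

section side

variable {ℓ B : ℝ}

theorem Steady.far {h : ℝ → ℝ × ℝ} (hh : Steady ℓ B h) (hℓ : 0 < ℓ) {x : ℝ × ℝ} {R : ℝ}
    (hx : |x.1| ≤ R) (t : ℝ) : (B + ℓ * R + 1 ≤ t → 0 < (toC (h t - x)).re) ∧
      (t ≤ -(B + ℓ * R + 1) → (toC (h t - x)).re < 0) := by
  have h1 := abs_le.1 (hh t)
  have h2 := abs_le.1 hx
  rw [toC_re, Prod.fst_sub]
  constructor
  · intro ht
    have : ℓ * x.1 ≤ ℓ * R := mul_le_mul_of_nonneg_left h2.2 hℓ.le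
    have : 0 < ℓ * ((h t).1 - x.1) := by rw [mul_sub]; linarith
    exact pos_of_mul_pos_right this hℓ.le
  · intro ht
    have : ℓ * -R ≤ ℓ * x.1 := mul_le_mul_of_nonneg_left h2.1 hℓ.le
    have : 0 < ℓ * (x.1 - (h t).1) := by rw [mul_sub]; linarith
    linarith [pos_of_mul_pos_right this hℓ.le]

theorem Steady.endsRight {h : ℝ → ℝ × ℝ} (hh : Steady ℓ B h) (hℓ : 0 < ℓ) (x : ℝ × ℝ) :
    EndsRight fun t => toC (h t - x) :=
  ⟨by filter_upwards [eventually_ge_atTop (B + ℓ * |x.1| + 1)] with t ht using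
      (hh.far hℓ le_rfl t).1 ht,
    by filter_upwards [eventually_le_atBot (-(B + ℓ * |x.1| + 1))] with t ht using
      (hh.far hℓ le_rfl t).2 ht⟩

theorem side_eventually {X : Type*} [TopologicalSpace X] {h : X → ℝ → ℝ × ℝ} {q : X → ℝ × ℝ}
    (hℓ : 0 < ℓ) (hh : Continuous fun p : X × ℝ => h p.1 p.2) (hq : Continuous q)
    (hst : ∀ x, Steady ℓ B (h x)) {x₀ : X} (h0 : ∀ t, h x₀ t ≠ q x₀) :
    ∀ᶠ x in 𝓝 x₀, side (h x) (q x) = side (h x₀) (q x₀) := by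
  refine eventually_idx_eq (F := fun x t => toC (h x t - q x))
    (continuous_toC.comp (hh.sub (hq.comp continuous_fst)))
    (fun t => by rw [Ne, toC_eq_zero, sub_eq_zero]; exact h0 t)
    (T := B + ℓ * (|(q x₀).1| + 1) + 1) ?_
  filter_upwards [((hq.fst.abs).tendsto x₀).eventually (gt_mem_nhds (lt_add_one _))] with x hx t
  exact (hst x).far hℓ hx.le t

theorem side_eq_of_preconnected {X : Type*} [TopologicalSpace X] {h : X → ℝ → ℝ × ℝ}
    {q : X → ℝ × ℝ} (hℓ : 0 < ℓ) (hh : Continuous fun p : X × ℝ => h p.1 p.2) (hq : Continuous q)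
    (hst : ∀ x, Steady ℓ B (h x)) {A : Set X} (hA : IsPreconnected A)
    (h0 : ∀ x ∈ A, ∀ t, h x t ≠ q x) {x y : X} (hx : x ∈ A) (hy : y ∈ A) :
    side (h x) (q x) = side (h y) (q y) := by
  refine hA.constant (f := fun x => side (h x) (q x)) (fun z hz => ?_) hx hy
  have := side_eventually hℓ hh hq hst (h0 z hz)
  exact (continuousAt_const.congr (this.mono fun _ h => h.symm)).continuousWithinAt

/-- The side is constant along paths avoiding the curve. -/
theorem side_eq_of_avoid {h : ℝ → ℝ × ℝ} (hℓ : 0 < ℓ) (hh : Continuous h) (hst : Steady ℓ B h)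
    {X : Type*} [TopologicalSpace X] {q : X → ℝ × ℝ} {A : Set X} (hA : IsPreconnected A)
    (hq : ContinuousOn q A) (h0 : ∀ x ∈ A, ∀ t, h t ≠ q x) {x y : X} (hx : x ∈ A) (hy : y ∈ A) :
    side h (q x) = side h (q y) :=
  side_eq_of_preconnected (X := ℝ × ℝ) (q := id) hℓ (hh.comp continuous_snd) continuous_id
    (fun _ => hst) (hA.image q hq) (by rintro _ ⟨x, hx, rfl⟩; exact h0 x hx)
    (mem_image_of_mem q hx) (mem_image_of_mem q hy)

theorem side_eq_one {h : ℝ → ℝ × ℝ} (hℓ : 0 < ℓ) (hh : Continuous h) (hst : Steady ℓ B h)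
    {x : ℝ × ℝ} (hx : ∀ t, (h t).2 < x.2) : side h x = 1 :=
  idx_eq_one_of_im_neg (continuous_toC.comp (hh.sub continuous_const))
    (fun t => by simpa using hx t) (hst.endsRight hℓ x)

theorem side_eq_zero {h : ℝ → ℝ × ℝ} (hℓ : 0 < ℓ) (hh : Continuous h) (hst : Steady ℓ B h)
    {x : ℝ × ℝ} (hx : ∀ t, x.2 < (h t).2) : side h x = 0 :=
  idx_eq_zero_of_im_pos (continuous_toC.comp (hh.sub continuous_const))
    (fun t => by simpa using hx t) (hst.endsRight hℓ x)

theorem side_translate {h : ℝ → ℝ × ℝ} (hℓ : 0 < ℓ) (hh : Continuous h) (hst : Steady ℓ B h)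
    {x : ℝ × ℝ} (hx : ∀ t, h t ≠ x) (a : ℝ) (k : ℝ × ℝ) :
    side (fun t => h (t + a) + k) (x + k) = side h x := by
  have := idx_shift (f := fun t => toC (h t - x)) (continuous_toC.comp (hh.sub continuous_const))
    (fun t => by rw [Ne, toC_eq_zero, sub_eq_zero]; exact hx t)
    (hst.endsRight hℓ x) a
  rw [side, side, ← this]
  simp only [add_sub_add_right_eq_sub]

end side

namespace TorusMetric.Strip

variable {M : TorusMetric} (S : M.Strip)

theorem exists_width : ∃ B, ∀ x : ℝ × ℝ, (S.α 0).2 - S.Bd ≤ x.2 → x.2 ≤ (S.α 0).2 + S.m + S.Bd →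
    |S.b x - S.ℓ * x.1| ≤ B := by
  obtain ⟨C, hC⟩ := (isCompact_Icc (a := ((0 : ℝ), (S.α 0).2 - S.Bd))
    (b := ((1 : ℝ), (S.α 0).2 + S.m + S.Bd))).exists_bound_of_continuousOn
    (f := fun x => S.b x - S.ℓ * x.1)
    (S.b_lip.continuous.sub (continuous_const.mul continuous_fst)).continuousOn
  refine ⟨C, fun x h1 h2 => ?_⟩
  have := hC (x + lat (-⌊x.1⌋, 0)) ⟨⟨?_, ?_⟩, ⟨?_, ?_⟩⟩
  · rw [b_add_int] at this
    convert this using 1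
    simp only [lat, Prod.fst_add, Real.norm_eq_abs]
    congr 1; push_cast; ring
  all_goals simp only [lat, Prod.fst_add, Prod.snd_add, Int.cast_neg, Int.cast_zero, add_zero, h1, h2]
  · linarith [Int.floor_le x.1]
  · linarith [Int.lt_floor_add_one x.1]

/-- A bound for the oscillation of the Busemann function on a strip. -/
def B : ℝ := S.exists_width.choose

variable {S}

theorem Leaf.steady {γ : ℝ → ℝ × ℝ} (h : S.Leaf γ) (h1 : ∀ s, (S.α 0).2 - S.Bd ≤ (γ s).2)
    (h2 : ∀ s, (γ s).2 ≤ (S.α 0).2 + S.m + S.Bd) : Steady S.ℓ S.B γ := fun s => by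
  have := S.exists_width.choose_spec (γ s) (h1 s) (h2 s)
  rwa [h.hb] at this

variable (S)

theorem Bd_nonneg : 0 ≤ S.Bd := (abs_nonneg _).trans (S.hB 0)

theorem m_pos : (0 : ℝ) < S.m := by linarith [S.hm, S.Bd_nonneg]

theorem steady_α : Steady S.ℓ S.B S.α :=
  S.leaf_α.steady (fun s => by linarith [(abs_le.1 (S.hB s)).1])
    fun s => by linarith [(abs_le.1 (S.hB s)).2, S.m_pos]

/-- Points below the lower boundary line. -/
def Low (x : ℝ × ℝ) : Prop := x ∉ range S.α ∧ side S.α x = 0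

/-- Points above the lower boundary line. -/
def Up (x : ℝ × ℝ) : Prop := x ∉ range S.α ∧ side S.α x ≠ 0

variable {S}

theorem Leaf.isClosed_range {γ : ℝ → ℝ × ℝ} (h : S.Leaf γ) : IsClosed (range γ) := by
  have : range γ = {x | γ (S.b x) = x} := by
    ext x
    refine ⟨?_, fun h => ⟨_, h⟩⟩
    rintro ⟨s, rfl⟩
    change γ _ = γ s
    rw [h.hb]
  rw [this]
  exact isClosed_eq (h.continuous.comp S.b_lip.continuous) continuous_id

theorem eventually_side {x : ℝ × ℝ} (hx : x ∉ range S.α) :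
    ∀ᶠ y in 𝓝 x, y ∉ range S.α ∧ side S.α y = side S.α x := by
  refine (S.leaf_α.isClosed_range.isOpen_compl.eventually_mem hx).and ?_
  exact side_eventually (h := fun _ => S.α) (q := id) S.hℓ (S.leaf_α.continuous.comp continuous_snd)
    continuous_id (fun _ => S.steady_α) (fun t h => hx ⟨t, h⟩)

variable (S)

theorem isOpen_Low : IsOpen {x | S.Low x} :=
  isOpen_iff_eventually.2 fun _ hx => (eventually_side hx.1).mono fun _ h => ⟨h.1, h.2.trans hx.2⟩

theorem isOpen_Up : IsOpen {x | S.Up x} :=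
  isOpen_iff_eventually.2 fun _ hx => (eventually_side hx.1).mono fun _ h =>
    ⟨h.1, h.2.trans_ne hx.2⟩

theorem up_of_lt {x : ℝ × ℝ} (h : (S.α 0).2 + S.Bd < x.2) : S.Up x := by
  have h1 : ∀ t, (S.α t).2 < x.2 := fun t => by linarith [(abs_le.1 (S.hB t)).2]
  refine ⟨?_, ?_⟩
  · rintro ⟨t, rfl⟩; exact (h1 t).ne rfl
  · rw [side_eq_one S.hℓ S.leaf_α.continuous S.steady_α h1]; exact one_ne_zero

theorem low_of_lt {x : ℝ × ℝ} (h : x.2 < (S.α 0).2 - S.Bd) : S.Low x := by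
  have h1 : ∀ t, x.2 < (S.α t).2 := fun t => by linarith [(abs_le.1 (S.hB t)).1]
  refine ⟨?_, ?_⟩
  · rintro ⟨t, rfl⟩; exact (h1 t).ne rfl
  · exact side_eq_zero S.hℓ S.leaf_α.continuous S.steady_α h1

theorem mem_range_add (x : ℝ × ℝ) (n : ℤ) : x + lat (n, 0) ∈ range S.α ↔ x ∈ range S.α := by
  constructor
  · rintro ⟨t, ht⟩
    refine ⟨t + (-n : ℤ) * S.ℓ, ?_⟩
    rw [α_add_int, ht]
    ext <;> simp [lat]
  · rintro ⟨t, rfl⟩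
    exact ⟨_, S.α_add_int n t⟩

theorem side_α_add {x : ℝ × ℝ} (hx : x ∉ range S.α) (n : ℤ) :
    side S.α (x + lat (n, 0)) = side S.α x := by
  rw [← side_translate S.hℓ S.leaf_α.continuous S.steady_α (fun t h => hx ⟨t, h⟩) (-n * S.ℓ)
    (lat (n, 0))]
  congr 1
  funext t
  have := S.α_add_int (-n) t
  push_cast at this
  rw [this]
  ext <;> simp [lat]

theorem low_add (x : ℝ × ℝ) (n : ℤ) : S.Low (x + lat (n, 0)) ↔ S.Low x := by
  unfold Low
  rw [mem_range_add]
  exact and_congr_right fun h => by rw [S.side_α_add h]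

theorem up_add (x : ℝ × ℝ) (n : ℤ) : S.Up (x + lat (n, 0)) ↔ S.Up x := by
  unfold Up
  rw [mem_range_add]
  exact and_congr_right fun h => by rw [S.side_α_add h]

/-- A path from the lower to the upper side crosses the line. -/
theorem crossing {q : ℝ → ℝ × ℝ} (hq : Continuous q) {a b : ℝ} (hab : a ≤ b)
    (h1 : ¬ S.Up (q a) ∧ ¬ S.Low (q b) ∨ ¬ S.Low (q a) ∧ ¬ S.Up (q b)) :
    ∃ t ∈ Icc a b, ∃ s, q t = S.α s := by
  by_contra! hcon
  have h3 := side_eq_of_avoid S.hℓ S.leaf_α.continuous S.steady_α (A := Icc a b) isPreconnected_Icc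
    hq.continuousOn (fun t ht s => (hcon t ht s).symm) (left_mem_Icc.2 hab) (right_mem_Icc.2 hab)
  have r1 : q a ∉ range S.α := by
    rintro ⟨s, hs⟩; exact hcon a (left_mem_Icc.2 hab) s hs.symm
  have r2 : q b ∉ range S.α := by
    rintro ⟨s, hs⟩; exact hcon b (right_mem_Icc.2 hab) s hs.symm
  unfold Up Low at h1
  rw [h3] at h1
  tauto

/-- The closed strip between the boundary lines. -/
def Cl (x : ℝ × ℝ) : Prop := ¬ S.Low x ∧ ¬ S.Up (x - lat S.v)

/-- The open strip between the boundary lines. -/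
def Op (x : ℝ × ℝ) : Prop := S.Up x ∧ S.Low (x - lat S.v)

theorem isClosed_Cl : IsClosed {x | S.Cl x} := by
  refine IsClosed.inter (S.isOpen_Low.isClosed_compl)
    (IsClosed.preimage (continuous_id.sub continuous_const) S.isOpen_Up.isClosed_compl)

theorem isOpen_Op : IsOpen {x | S.Op x} :=
  S.isOpen_Up.inter (S.isOpen_Low.preimage (continuous_id.sub continuous_const))

variable {S}

theorem Op.cl {x : ℝ × ℝ} (h : S.Op x) : S.Cl x :=
  ⟨fun h1 => h.1.2 h1.2, fun h1 => h1.2 h.2.2⟩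

theorem Cl.ge {x : ℝ × ℝ} (h : S.Cl x) : (S.α 0).2 - S.Bd ≤ x.2 :=
  not_lt.1 fun h1 => h.1 (S.low_of_lt h1)

theorem Cl.le {x : ℝ × ℝ} (h : S.Cl x) : x.2 ≤ (S.α 0).2 + S.m + S.Bd :=
  not_lt.1 fun h1 => h.2 (S.up_of_lt (by simp only [v, lat, Prod.snd_sub]; linarith))

theorem op_of_lt {x : ℝ × ℝ} (h1 : (S.α 0).2 + S.Bd < x.2) (h2 : x.2 < (S.α 0).2 + S.m - S.Bd) :
    S.Op x :=
  ⟨S.up_of_lt h1, S.low_of_lt (by simp only [v, lat, Prod.snd_sub]; linarith)⟩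

theorem cl_add (x : ℝ × ℝ) (n : ℤ) : S.Cl (x + lat (n, 0)) ↔ S.Cl x := by
  unfold Cl
  rw [S.low_add, add_sub_right_comm, S.up_add]

theorem Leaf.cl {γ : ℝ → ℝ × ℝ} (h : S.Leaf γ) {s : ℝ} (hs : S.Cl (γ s)) (t : ℝ) :
    S.Cl (γ t) := by
  constructor
  · intro hl
    have : ∃ r, γ r ∈ range S.α := by
      rcases le_total s t with hst | hst
      · obtain ⟨r, -, u, hu⟩ := S.crossing h.continuous hst
          (Or.inr ⟨hs.1, fun hu => hu.2 hl.2⟩)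
        exact ⟨r, u, hu.symm⟩
      · obtain ⟨r, -, u, hu⟩ := S.crossing h.continuous hst
          (Or.inl ⟨fun hu => hu.2 hl.2, hs.1⟩)
        exact ⟨r, u, hu.symm⟩
    obtain ⟨r, u, hu⟩ := this
    have := S.leaf_α.unique h hu
    exact hl.1 ⟨t, by rw [this]⟩
  · intro hl
    have hc : Continuous fun s => γ s - lat S.v := h.continuous.sub continuous_const
    have : ∃ r, γ r - lat S.v ∈ range S.α := by
      rcases le_total s t with hst | hst
      · obtain ⟨r, -, u, hu⟩ := S.crossing hc hst (Or.inl ⟨hs.2, fun hu => hl.2 hu.2⟩)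
        exact ⟨r, u, hu.symm⟩
      · obtain ⟨r, -, u, hu⟩ := S.crossing hc hst (Or.inr ⟨fun hu => hl.2 hu.2, hs.2⟩)
        exact ⟨r, u, hu.symm⟩
    obtain ⟨r, u, hu⟩ := this
    have := S.leaf_αv.unique h (s := u + S.β) (t := r) (by
      simp only [add_sub_cancel_right, hu, sub_add_cancel])
    refine hl.1 ⟨t - S.β, ?_⟩
    rw [← this, add_sub_cancel_right]

theorem Leaf.steady_of_cl {γ : ℝ → ℝ × ℝ} (h : S.Leaf γ) {s : ℝ} (hs : S.Cl (γ s)) :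
    Steady S.ℓ S.B γ :=
  h.steady (fun t => (h.cl hs t).ge) fun t => (h.cl hs t).le

theorem le_dist {x y : ℝ × ℝ} (hx : ¬ S.Up (x - lat S.v)) (hy : ¬ S.Low y) (n : ℤ) :
    S.b' x + S.b y + n * S.ℓ ≤ M.dist x (y + lat S.v + lat (n, 0)) := by
  obtain ⟨σ, s0, s1, s2, s3⟩ := exists_segment (M := M) x (y + lat S.v + lat (n, 0))
  obtain ⟨t, ht, u, hu⟩ := S.crossing (q := fun t => σ t - lat S.v)
    ((continuous_of_lip s3).sub continuous_const) (dist_nonneg (M := M) x (y + lat S.v + lat (n, 0)))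
    (Or.inl ⟨by rw [s0]; exact hx, by
      rw [s1, add_right_comm, add_sub_cancel_right, S.low_add]; exact hy⟩)
  have e1 := s2 0 t le_rfl ht.1 ht.2
  have e2 := s2 t _ ht.1 ht.2 le_rfl
  rw [s0] at e1
  rw [s1] at e2
  have hu' : σ t = S.α u + lat S.v := by rw [← hu, sub_add_cancel]
  have i1 := S.b'_lip (σ t) x
  have i2 := S.b_lip (σ t - lat S.v) (y + lat (n, 0))
  have e3 := S.b'_αv u
  have e4 := S.b_α u
  rw [hu, e4, b_add_int, ← dist_add_lat _ _ S.v, ← hu', add_right_comm] at i2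
  rw [hu', e3, ← hu', dist_comm] at i1
  linarith

theorem b_add_v {y : ℝ × ℝ} (hy : ¬ S.Low y) : S.β + S.b y ≤ S.b (y + lat S.v) := by
  refine le_bus fun n => ?_
  have h1 : ¬ S.Up (S.α 0 - lat S.v) := fun h => h.2 (S.low_of_lt (by
    simp only [v, lat, Prod.snd_sub]; linarith [S.hm, S.Bd_nonneg])).2
  have := S.le_dist h1 hy n
  rw [lat_fst, natCast_zsmul, ← lat_nsmul_nat, S.b'_α] at this
  push_cast at this
  linarith

theorem b'_sub_v {x : ℝ × ℝ} (hx : ¬ S.Up (x - lat S.v)) : S.β + S.b' x ≤ S.b' (x - lat S.v) := by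
  refine le_bus fun n => ?_
  have h1 : ¬ S.Low (S.α 0 + lat S.v) := fun h => (S.up_of_lt (x := S.α 0 + lat S.v) (by
    simp only [v, lat, Prod.snd_add]; linarith [S.hm, S.Bd_nonneg])).2 h.2
  have := S.le_dist hx h1 n
  have e := S.b_αv 0
  rw [lat_fst, natCast_zsmul, ← lat_nsmul_nat, e] at this
  push_cast at this
  have h2 : M.dist (S.α 0 + lat S.v) (x - lat S.v + lat (n • (-e₁))) =
      M.dist x (S.α 0 + lat S.v + lat S.v + lat (n • e₁)) := by
    rw [smul_neg, lat_neg, ← sub_eq_add_neg, dist_sub_lat_right, dist_sub_lat_right, dist_comm]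
    congr 1; abel
  rw [h2]
  linarith

end TorusMetric.Strip

theorem abs_crossDet_le (v w : ℝ × ℝ) : |crossDet v w| ≤ 2 * ‖v‖ * ‖w‖ := by
  have h1 : |v.1| ≤ ‖v‖ := norm_fst_le v
  have h2 : |v.2| ≤ ‖v‖ := norm_snd_le v
  have h3 : |w.1| ≤ ‖w‖ := norm_fst_le w
  have h4 : |w.2| ≤ ‖w‖ := norm_snd_le w
  calc |crossDet v w| ≤ |v.1 * w.2| + |v.2 * w.1| := abs_sub _ _
    _ = |v.1| * |w.2| + |v.2| * |w.1| := by rw [abs_mul, abs_mul]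
    _ ≤ ‖v‖ * ‖w‖ + ‖v‖ * ‖w‖ := by gcongr
    _ = _ := by ring

theorem crossDet_sub (v a b : ℝ × ℝ) : crossDet v (a - b) = crossDet v a - crossDet v b := by
  simp only [crossDet, Prod.fst_sub, Prod.snd_sub]; ring

theorem crossDet_smul (v a : ℝ × ℝ) (r : ℝ) : crossDet v (r • a) = r * crossDet v a := by
  simp only [crossDet, Prod.smul_fst, Prod.smul_snd, smul_eq_mul]; ring

theorem crossDet_neg (v a : ℝ × ℝ) : crossDet v (-a) = -crossDet v a := by
  simp only [crossDet, Prod.fst_neg, Prod.snd_neg]; ring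

theorem crossDet_self (v : ℝ × ℝ) : crossDet v v = 0 := by
  simp only [crossDet]; ring

/-- Rotation by a right angle. -/
def rot (v : ℝ × ℝ) : ℝ × ℝ := (-v.2, v.1)

theorem crossDet_rot_pos {v : ℝ × ℝ} (hv : v ≠ 0) : 0 < crossDet v (rot v) := by
  have : v.1 ≠ 0 ∨ v.2 ≠ 0 := by
    by_contra! h
    exact hv (Prod.ext h.1 h.2)
  simp only [crossDet, rot]
  rcases this with h | h
  · nlinarith [sq_pos_of_ne_zero h, sq_nonneg v.2]
  · nlinarith [sq_pos_of_ne_zero h, sq_nonneg v.1]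

theorem eq_rot_add {v : ℝ × ℝ} (hv : v ≠ 0) (w : ℝ × ℝ) :
    w = (crossDet v w / crossDet v (rot v)) • rot v +
      ((v.1 * w.1 + v.2 * w.2) / crossDet v (rot v)) • v := by
  have h := (crossDet_rot_pos hv).ne'
  ext
  · simp only [Prod.fst_add, Prod.smul_fst, smul_eq_mul]
    field_simp
    simp only [crossDet, rot]; ring
  · simp only [Prod.snd_add, Prod.smul_snd, smul_eq_mul]
    field_simp
    simp only [crossDet, rot]; ring

theorem exists_smul_of_crossDet {v w : ℝ × ℝ} (hv : v ≠ 0) (h : crossDet v w = 0) :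
    ∃ r : ℝ, w = r • v :=
  ⟨_, by conv_lhs => rw [eq_rot_add hv w, h, zero_div, zero_smul, zero_add]⟩

namespace TorusMetric.Strip

variable {M : TorusMetric} {S : M.Strip}

/-- Points reached from a minimal line by leaving it in a transverse direction avoid it. -/
theorem Leaf.cone {γ : ℝ → ℝ × ℝ} (h : S.Leaf γ) {s₀ : ℝ} {w₀ : ℝ × ℝ}
    (hd : crossDet (deriv γ s₀) w₀ ≠ 0) :
    ∃ δ > 0, ∀ s w r, |s - s₀| < δ → ‖w - w₀‖ < δ → 0 < r → r < δ → ∀ u, γ u ≠ γ s + r • w := by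
  set v := deriv γ s₀ with hv
  set d := |crossDet v w₀| with hdd
  have hd0 : 0 < d := abs_pos.2 hd
  have hC := M.cC_pos
  set C := M.cC * (‖w₀‖ + 1) with hCd
  have hC0 : 0 < C := by positivity
  set A := ‖v‖ + 1 with hA
  have hA0 : 0 < A := by positivity
  have hstr : HasStrictDerivAt γ v s₀ :=
    (h.locIso.contDiff.contDiffAt).hasStrictDerivAt (by simp)
  have ho := hstr.isLittleO.def (show 0 < d / (8 * A * C) by positivity)
  rw [Metric.eventually_nhds_iff] at ho
  obtain ⟨δ₁, hδ₁, ho⟩ := ho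
  refine ⟨min (min (δ₁ / 2) (δ₁ / (2 * C))) (min 1 (d / (4 * A))), by positivity, ?_⟩
  intro s w r hs hw hr hr' u hu
  obtain ⟨hs1, hs2⟩ := lt_min_iff.1 (lt_min_iff.1 hs).1
  obtain ⟨hw1, hw2⟩ := lt_min_iff.1 (lt_min_iff.1 hw).2
  have hr2 := (lt_min_iff.1 (lt_min_iff.1 hr').1).2
  have hwn : ‖w‖ ≤ ‖w₀‖ + 1 := by
    have := norm_add_le w₀ (w - w₀)
    rw [add_sub_cancel] at this
    linarith
  have hus : |u - s| ≤ C * r := by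
    have h1 := dist_le (M := M) (γ s) (γ u)
    rw [h.dist, hu, add_sub_cancel_left, norm_smul, Real.norm_of_nonneg hr.le, abs_sub_comm] at h1
    calc |u - s| ≤ M.cC * (r * ‖w‖) := h1
      _ ≤ M.cC * (r * (‖w₀‖ + 1)) := by gcongr
      _ = _ := by rw [hCd]; ring
  have hCr : C * r < δ₁ / 2 := by
    rw [lt_div_iff₀ (by positivity)] at hr2
    linarith
  have hdist : Dist.dist (u, s) (s₀, s₀) < δ₁ := by
    rw [Prod.dist_eq, Real.dist_eq, Real.dist_eq]
    refine max_lt ?_ (by linarith)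
    have := abs_add_le (u - s) (s - s₀)
    rw [sub_add_sub_cancel] at this
    linarith
  have h1 := ho hdist
  simp only at h1
  rw [hu, add_sub_cancel_left, Real.norm_eq_abs] at h1
  have h2 := abs_crossDet_le v (r • w - (u - s) • v)
  rw [crossDet_sub, crossDet_smul, crossDet_smul, crossDet_self, mul_zero, sub_zero, abs_mul,
    abs_of_pos hr] at h2
  have h3 : r * |crossDet v w| ≤ r * (d / 4) := by
    calc r * |crossDet v w| ≤ 2 * ‖v‖ * ‖r • w - (u - s) • v‖ := h2
      _ ≤ 2 * A * (d / (8 * A * C) * |u - s|) := by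
          gcongr
          · linarith
          · exact h1
      _ ≤ 2 * A * (d / (8 * A * C) * (C * r)) := by gcongr
      _ = r * (d / 4) := by field_simp; ring
  have h4 := le_of_mul_le_mul_left h3 hr
  have h5 := abs_crossDet_le v (w - w₀)
  rw [crossDet_sub] at h5
  have h6 : 2 * ‖v‖ * ‖w - w₀‖ ≤ d / 2 := by
    calc 2 * ‖v‖ * ‖w - w₀‖ ≤ 2 * A * (d / (4 * A)) := by
          gcongr
          linarith
      _ = d / 2 := by field_simp; ring
  have h7 := abs_sub_abs_le_abs_sub (crossDet v w₀) (crossDet v w)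
  rw [abs_sub_comm] at h7
  linarith

/-- The side of a curve on which a transverse direction points. -/
def Germ (γ : ℝ → ℝ × ℝ) (s : ℝ) (w : ℝ × ℝ) (n : ℤ) : Prop :=
  ∃ δ > 0, ∀ s' w' r, |s' - s| < δ → ‖w' - w‖ < δ → 0 < r → r < δ →
    (∀ u, γ u ≠ γ s' + r • w') ∧ side γ (γ s' + r • w') = n

theorem Germ.unique {γ : ℝ → ℝ × ℝ} {s : ℝ} {w : ℝ × ℝ} {n n' : ℤ} (h : Germ γ s w n)
    (h' : Germ γ s w n') : n = n' := by
  obtain ⟨δ, hδ, h⟩ := h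
  obtain ⟨δ', hδ', h'⟩ := h'
  have hm : 0 < min δ δ' := lt_min hδ hδ'
  have h1 := min_le_left δ δ'
  have h2 := min_le_right δ δ'
  rw [← (h s w (min δ δ' / 2) (by simpa) (by simpa) (by linarith) (by linarith)).2,
    ← (h' s w (min δ δ' / 2) (by simpa) (by simpa) (by linarith) (by linarith)).2]

theorem Germ.eventually {γ : ℝ → ℝ × ℝ} {s : ℝ} {w : ℝ × ℝ} {n : ℤ} (h : Germ γ s w n) :
    ∀ᶠ q in 𝓝 (s, w), Germ γ q.1 q.2 n := by
  obtain ⟨δ, hδ, h⟩ := h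
  filter_upwards [Metric.ball_mem_nhds (s, w) (half_pos hδ)] with q hq
  rw [Metric.mem_ball, Prod.dist_eq, Real.dist_eq, dist_eq_norm, max_lt_iff] at hq
  refine ⟨δ / 2, half_pos hδ, fun s' w' r h1 h2 h3 h4 => h s' w' r ?_ ?_ h3 (by linarith)⟩
  · have := abs_add_le (s' - q.1) (q.1 - s)
    rw [sub_add_sub_cancel] at this
    linarith
  · have := norm_add_le (w' - q.2) (q.2 - w)
    rw [sub_add_sub_cancel] at this
    linarith

theorem Leaf.exists_germ {γ : ℝ → ℝ × ℝ} (h : S.Leaf γ) (hst : Steady S.ℓ S.B γ) {s : ℝ}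
    {w : ℝ × ℝ} (hd : crossDet (deriv γ s) w ≠ 0) : ∃ n, Germ γ s w n := by
  obtain ⟨δ, hδ, hc⟩ := h.cone hd
  refine ⟨side γ (γ s + (δ / 2) • w), δ, hδ, fun s' w' r h1 h2 h3 h4 =>
    ⟨hc s' w' r h1 h2 h3 h4, ?_⟩⟩
  set A : Set (ℝ × (ℝ × ℝ) × ℝ) := Metric.ball s δ ×ˢ (Metric.ball w δ ×ˢ Ioo 0 δ) with hA
  have hAc : Convex ℝ A := (convex_ball _ _).prod ((convex_ball _ _).prod (convex_Ioo _ _))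
  refine side_eq_of_avoid S.hℓ h.continuous hst (q := fun q : ℝ × (ℝ × ℝ) × ℝ => γ q.1 + q.2.2 • q.2.1)
    hAc.isPreconnected ?_ (fun q hq u => ?_) (x := (s', w', r)) (y := (s, w, δ / 2)) ?_ ?_
  · have := h.continuous
    exact Continuous.continuousOn (by fun_prop)
  · obtain ⟨a1, a2, a3⟩ := hq
    rw [Metric.mem_ball, Real.dist_eq] at a1
    rw [Metric.mem_ball, dist_eq_norm] at a2
    exact hc _ _ _ a1 a2 a3.1 a3.2 u
  · refine ⟨?_, ?_, h3, h4⟩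
    · rwa [Metric.mem_ball, Real.dist_eq]
    · rwa [Metric.mem_ball, dist_eq_norm]
  · exact ⟨Metric.mem_ball_self hδ, Metric.mem_ball_self hδ, half_pos hδ, half_lt_self hδ⟩

theorem Leaf.germ_const {γ : ℝ → ℝ × ℝ} (h : S.Leaf γ) (hst : Steady S.ℓ S.B γ) {s s' : ℝ}
    {w w' : ℝ × ℝ} (hd : 0 < crossDet (deriv γ s) w) (hd' : 0 < crossDet (deriv γ s') w')
    {ε : ℝ} (hε : ε ≠ 0) {n n' : ℤ} (hn : Germ γ s (ε • w) n) (hn' : Germ γ s' (ε • w') n') :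
    n = n' := by
  have hne : ∀ {s w}, 0 < crossDet (deriv γ s) w → crossDet (deriv γ s) (ε • w) ≠ 0 := by
    intro s w h1
    rw [crossDet_smul]
    exact mul_ne_zero hε h1.ne'
  choose! ν hν using fun (q : ℝ × ℝ × ℝ) (hq : 0 < crossDet (deriv γ q.1) q.2) =>
    h.exists_germ hst (hne hq)
  have hγ' : Continuous (deriv γ) := h.locIso.contDiff_one.continuous_deriv le_rfl
  set A : Set (ℝ × ℝ × ℝ) := {q | 0 < crossDet (deriv γ q.1) q.2} with hA
  have hAp : IsPreconnected A := by
    have : A = (fun q : ℝ × ℝ × ℝ => ((q.1, q.2.1 • rot (deriv γ q.1) + q.2.2 • deriv γ q.1) :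
        ℝ × ℝ × ℝ)) '' (univ ×ˢ (Ioi 0 ×ˢ univ)) := by
      ext ⟨s, w⟩
      have hp := crossDet_rot_pos (h.locIso.deriv_ne_zero s)
      constructor
      · intro hq
        refine ⟨(s, crossDet (deriv γ s) w / crossDet (deriv γ s) (rot (deriv γ s)),
          ((deriv γ s).1 * w.1 + (deriv γ s).2 * w.2) / crossDet (deriv γ s) (rot (deriv γ s))),
          ⟨trivial, div_pos hq hp, trivial⟩, ?_⟩
        exact Prod.ext rfl (eq_rot_add (h.locIso.deriv_ne_zero s) w).symm
      · rintro ⟨⟨s₁, a, b⟩, ⟨-, ha, -⟩, hq⟩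
        simp only [Prod.mk.injEq] at hq
        obtain ⟨rfl, rfl⟩ := hq
        show 0 < crossDet (deriv γ s₁) (a • rot (deriv γ s₁) + b • deriv γ s₁)
        have : crossDet (deriv γ s₁) (a • rot (deriv γ s₁) + b • deriv γ s₁) =
            a * crossDet (deriv γ s₁) (rot (deriv γ s₁)) := by
          simp only [crossDet, Prod.fst_add, Prod.snd_add, Prod.smul_fst, Prod.smul_snd, smul_eq_mul]
          ring
        rw [this]
        exact mul_pos ha hp
    rw [this]
    refine (isPreconnected_univ.prod (isPreconnected_Ioi.prod isPreconnected_univ)).image _ ?_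
    refine Continuous.continuousOn ?_
    unfold rot
    fun_prop
  have hloc : ContinuousOn ν A := fun q hq => by
    have h1 := (hν q hq).eventually
    have h2 : Tendsto (fun q' : ℝ × ℝ × ℝ => (q'.1, ε • q'.2)) (𝓝 q) (𝓝 (q.1, ε • q.2)) :=
      Continuous.tendsto (by fun_prop) q
    have h3 : ∀ᶠ q' in 𝓝[A] q, ν q' = ν q := by
      filter_upwards [(h2.eventually h1).filter_mono nhdsWithin_le_nhds, self_mem_nhdsWithin]
        with q' h3 h4 using (hν q' h4).unique h3
    exact continuousWithinAt_const.congr_of_eventuallyEq h3 rfl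
  have := hAp.constant hloc (x := (s, w)) (y := (s', w')) hd hd'
  rw [hn.unique (hν (s, w) hd), hn'.unique (hν (s', w') hd'), this]

/-- The two sides of a minimal line are different. -/
theorem Leaf.germ_ne {γ : ℝ → ℝ × ℝ} (h : S.Leaf γ) (hst : Steady S.ℓ S.B γ) {n n' : ℤ}
    (hn : Germ γ 0 (rot (deriv γ 0)) n) (hn' : Germ γ 0 (-rot (deriv γ 0)) n') : n ≠ n' := by
  obtain ⟨δ, hδ, hn⟩ := hn
  obtain ⟨δ', hδ', hn'⟩ := hn'
  set v := deriv γ 0 with hv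
  have hv0 : toC v ≠ 0 := fun h0 => h.locIso.deriv_ne_zero 0 (toC_eq_zero.1 h0)
  set u : ℝ → ℂ := fun t => (toC (γ t) - toC (γ 0)) / toC v with hu
  have hder : HasDerivAt u 1 0 := by
    have h1 : HasDerivAt γ v 0 := (h.locIso.contDiff_one.differentiable (by simp) 0).hasDerivAt
    have h2 : HasDerivAt (fun t => toC (γ t)) (toC v) 0 :=
      Complex.equivRealProdCLM.symm.hasFDerivAt.comp_hasDerivAt (0 : ℝ) h1
    have h3 := (h2.sub_const (toC (γ 0))).div_const (toC v)
    rwa [div_self hv0] at h3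
  have hu0 : u 0 = 0 := by simp [hu]
  have hev := (hasDerivAt_iff_isLittleO.1 hder).def (show (0:ℝ) < 1 / 2 by norm_num)
  rw [Metric.eventually_nhds_iff] at hev
  obtain ⟨τ', hτ', hev⟩ := hev
  have hre : ∀ t, |t| < τ' → |(u t).re - t| ≤ 1 / 2 * |t| := fun t ht => by
    have := hev (y := t) (by rwa [Real.dist_eq, sub_zero])
    rw [hu0, sub_zero, sub_zero, Real.norm_eq_abs] at this
    refine le_trans ?_ this
    have h1 := Complex.abs_re_le_norm (u t - t • (1:ℂ))
    simpa using h1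
  set τ := τ' / 2 with hτ
  have hτ0 : 0 < τ := half_pos hτ'
  have hvn : 0 < ‖toC v‖ := norm_pos_iff.2 hv0
  have hC := M.cC_pos
  have hfar : ∀ t, τ ≤ |t| → τ / (M.cC * ‖toC v‖) ≤ ‖u t‖ := fun t ht => by
    have h1 := dist_le (M := M) (γ 0) (γ t)
    rw [h.dist, zero_sub, abs_neg] at h1
    have h2 : ‖γ t - γ 0‖ ≤ ‖toC (γ t - γ 0)‖ := by
      rw [Prod.norm_def]
      exact max_le (Complex.abs_re_le_norm (toC (γ t - γ 0)))
        (Complex.abs_im_le_norm (toC (γ t - γ 0)))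
    rw [hu]
    simp only
    rw [norm_div, div_le_div_iff₀ (by positivity) hvn, ← toC_sub]
    calc τ * ‖toC v‖ ≤ M.cC * ‖toC (γ t - γ 0)‖ * ‖toC v‖ := by
          gcongr
          exact (ht.trans h1).trans (by gcongr)
      _ = _ := by ring
  set s := min (min δ δ') (τ / (M.cC * ‖toC v‖) / 3) / 2 with hs
  have hm : 0 < min (min δ δ') (τ / (M.cC * ‖toC v‖) / 3) := by positivity
  have hs0 : 0 < s := half_pos hm
  have hs1 : s < min (min δ δ') (τ / (M.cC * ‖toC v‖) / 3) := half_lt_self hm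
  obtain ⟨⟨hs2, hs3⟩, hs4⟩ := (lt_min_iff.1 hs1).imp_left lt_min_iff.1
  have e1 : toC (γ 0 + s • rot v) = toC (γ 0) + toC v * (s * Complex.I) := by
    apply Complex.ext <;> simp [rot] <;> ring
  have e2 : toC (γ 0 + s • -rot v) = toC (γ 0) - toC v * (s * Complex.I) := by
    apply Complex.ext <;> simp [rot] <;> ring
  have key := idx_ne_of_crossing (h := fun t => toC (γ t)) (u := u) (P₀ := toC (γ 0)) (v := toC v)
    (continuous_toC.comp h.continuous) hv0 (fun t => by simp only [hu]; field_simp; ring) hs0 hτ0 hu0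
    (fun t h1 h2 => by
      have := abs_le.1 (hre t (by rw [abs_of_pos h1]; linarith))
      rw [abs_of_pos h1] at this
      linarith [this.1])
    (fun t h1 h2 => by
      have := abs_le.1 (hre t (by rw [abs_of_neg h2]; linarith))
      rw [abs_of_neg h2] at this
      linarith [this.2])
    (fun t ht => by linarith [hfar t ht])
    (by rw [← e1]; exact hst.endsRight S.hℓ (γ 0 + s • rot v))
    (by rw [← e2]; exact hst.endsRight S.hℓ (γ 0 + s • -rot v))
  rw [← e1, ← e2] at key
  rw [← (hn 0 (rot v) s (by simpa) (by simpa) hs0 hs2).2,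
    ← (hn' 0 (-rot v) s (by simpa) (by simpa) hs0 hs3).2]
  exact key

end TorusMetric.Strip

namespace TorusMetric.Strip

variable {M : TorusMetric} {S : M.Strip}

/-- The directions of the minimal lines depend continuously on the base point. -/
theorem continuous_deriv_leaf :
    Continuous fun z : {z // S.E z = 0} => deriv (S.leaf z) (S.b z) := by
  set F : ℕ → {z // S.E z = 0} → ℝ × ℝ := fun n z =>
    ((1 / ((n : ℝ) + 1)))⁻¹ • (S.leaf z (S.b z + 1 / ((n : ℝ) + 1)) - S.leaf z (S.b z)) with hF
  have hb : Continuous fun z : {z // S.E z = 0} => S.b z := S.b_lip.continuous.comp continuous_subtype_val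
  have hFc : ∀ n, Continuous (F n) := fun n => by
    have h1 : Continuous fun z : {z // S.E z = 0} => S.leaf z (S.b z + 1 / ((n : ℝ) + 1)) :=
      leaf_continuous_comp continuous_subtype_val (fun z => z.2) (hb.add continuous_const)
    have h2 : Continuous fun z : {z // S.E z = 0} => S.leaf z (S.b z) :=
      leaf_continuous_comp continuous_subtype_val (fun z => z.2) hb
    exact (h1.sub h2).const_smul (1 / ((n : ℝ) + 1))⁻¹
  have hlim : Tendsto (fun n : ℕ => 4 * M.cB * √(1 / ((n : ℝ) + 1))) atTop (𝓝 0) := by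
    have h1 := (Real.continuous_sqrt.tendsto 0).comp tendsto_one_div_add_atTop_nhds_zero_nat
    have h2 := h1.const_mul (4 * M.cB)
    simpa [Function.comp_def] using h2
  have : TendstoUniformly F (fun z => deriv (S.leaf z) (S.b z)) atTop := by
    rw [Metric.tendstoUniformly_iff]
    intro ε hε
    filter_upwards [hlim.eventually (gt_mem_nhds hε)] with n hn z
    rw [_root_.dist_comm, dist_eq_norm]
    refine lt_of_le_of_lt ?_ hn
    have hn1 : (0 : ℝ) < 1 / ((n : ℝ) + 1) := by positivity
    have hn2 : 1 / ((n : ℝ) + 1) ≤ 1 := by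
      rw [div_le_one (by positivity)]
      linarith [(Nat.cast_nonneg n : (0:ℝ) ≤ n)]
    exact IsoOn.slope_sub_deriv_le (leaf_spec z.2).continuous
      ((leaf_spec z.2).isoOn (S.b z - 1) (S.b z + 2)) (by linarith) hn1 hn2 (by linarith)
  exact this.continuous (Frequently.of_forall hFc)

theorem Germ.along {γ q : ℝ → ℝ × ℝ} {s : ℝ} {w : ℝ × ℝ} {n : ℤ} (hn : Germ γ s w n)
    (hq : HasDerivAt q w 0) (h0 : q 0 = γ s) :
    ∀ᶠ r in 𝓝[>] (0 : ℝ), (∀ u, γ u ≠ q r) ∧ side γ (q r) = n := by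
  obtain ⟨δ, hδ, hn⟩ := hn
  have h1 : Tendsto (slope q 0) (𝓝[>] 0) (𝓝 w) :=
    (hasDerivAt_iff_tendsto_slope.1 hq).mono_left
      (nhdsWithin_mono _ fun x (hx : 0 < x) => hx.ne')
  filter_upwards [h1.eventually (Metric.ball_mem_nhds w hδ), self_mem_nhdsWithin,
    Ioo_mem_nhdsGT hδ] with r h2 h3 h4
  have h5 := hn s (slope q 0 r) r (by simpa) (by change Dist.dist _ _ < _ at h2; rwa [dist_eq_norm] at h2) h3 h4.2
  have h6 : γ s + r • slope q 0 r = q r := by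
    have := sub_smul_slope q 0 r
    rw [sub_zero] at this
    rw [this, ← h0, vsub_eq_sub, add_sub_cancel]
  rwa [h6] at h5

theorem no_loop_of_transverse {c : ℝ → ℝ × ℝ} (hc : M.LocIso c) {t₁ t₂ : ℝ} (ht : t₁ < t₂)
    (hl : c t₁ = c t₂) (hE : ∀ t ∈ Icc t₁ t₂, S.E (c t) = 0) (hCl : ∀ t ∈ Icc t₁ t₂, S.Cl (c t))
    (hd : ∀ t ∈ Icc t₁ t₂, 0 < crossDet (deriv (S.leaf (c t)) (S.b (c t))) (deriv c t)) :
    False := by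
  have hd1 := hd t₁ ⟨le_rfl, ht.le⟩
  have hE1 := hE t₁ ⟨le_rfl, ht.le⟩
  have hCl1 := hCl t₁ ⟨le_rfl, ht.le⟩
  set γ := S.leaf (c t₁) with hγd
  have hγ : S.Leaf γ := leaf_spec hE1
  have hγ1 : γ (S.b (c t₁)) = c t₁ := leaf_self hE1
  have hst : Steady S.ℓ S.B γ := hγ.steady_of_cl (s := S.b (c t₁)) (by rwa [hγ1])
  have hcd : ∀ t, HasDerivAt c (deriv c t) t := fun t =>
    (hc.contDiff_one.differentiable (by simp) t).hasDerivAt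
  obtain ⟨n₁, hn₁⟩ := hγ.exists_germ hst (w := (1 : ℝ) • deriv c t₁) (s := S.b (c t₁))
    (by rw [one_smul]; exact hd1.ne')
  have ha1 := hn₁.along (q := fun r => c (t₁ + r)) (by
    have := hcd t₁
    rw [← add_zero t₁] at this
    simpa using HasDerivAt.comp_const_add t₁ 0 this) (by simp [hγ1])
  obtain ⟨ρ, hρ, ha1⟩ := (mem_nhdsGT_iff_exists_Ioo_subset.1 ha1)
  have hρ : 0 < ρ := hρ
  have ha1 : ∀ r, 0 < r → r < ρ → (∀ u, γ u ≠ c (t₁ + r)) ∧ side γ (c (t₁ + r)) = n₁ :=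
    fun r h1 h2 => ha1 ⟨h1, h2⟩
  have hρ2 : t₁ + ρ ≤ t₂ := by
    by_contra! h1
    have := (ha1 (t₂ - t₁) (by linarith) (by linarith)).1 (S.b (c t₁))
    rw [add_sub_cancel, ← hl] at this
    exact this hγ1
  have hcomp : IsCompact (Icc (t₁ + ρ) t₂ ∩ c ⁻¹' range γ) :=
    isCompact_Icc.inter_right (hγ.isClosed_range.preimage hc.continuous)
  obtain ⟨t₀, ⟨ht₀, s₀, hs₀⟩, hmin⟩ := hcomp.exists_isLeast
    ⟨t₂, ⟨hρ2, le_rfl⟩, S.b (c t₁), hγ1.trans hl⟩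
  have hav : ∀ t ∈ Ioo t₁ t₀, ∀ u, γ u ≠ c t := fun t h1 u hu => by
    rcases lt_or_ge t (t₁ + ρ) with h2 | h2
    · have := (ha1 (t - t₁) (by linarith [h1.1]) (by linarith)).1 u
      rw [add_sub_cancel] at this
      exact this hu
    · exact absurd (hmin ⟨⟨h2, h1.2.le.trans ht₀.2⟩, u, hu⟩) (not_le.2 h1.2)
  have hside : ∀ t ∈ Ioo t₁ t₀, side γ (c t) = n₁ := fun t h1 => by
    have h2 : 0 < min (t₀ - t₁) ρ := lt_min (by linarith [ht₀.1]) hρ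
    have h3 := min_le_left (t₀ - t₁) ρ
    have h4 := min_le_right (t₀ - t₁) ρ
    rw [← (ha1 (min (t₀ - t₁) ρ / 2) (by linarith) (by linarith)).2]
    exact side_eq_of_avoid S.hℓ hγ.continuous hst isPreconnected_Ioo hc.continuous.continuousOn
      hav h1 ⟨by linarith, by linarith⟩
  have hd0 := hd t₀ ⟨by linarith [ht₀.1], ht₀.2⟩
  have hb0 : S.b (c t₀) = s₀ := by rw [← hs₀, hγ.hb]
  rw [hb0, ← hs₀, hγ.leaf_eq] at hd0
  obtain ⟨n₂, hn₂⟩ := hγ.exists_germ hst (w := (-1 : ℝ) • deriv c t₀) (s := s₀)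
    (by rw [crossDet_smul]; linarith)
  have ha2 := hn₂.along (q := fun r => c (t₀ - r)) (by
    have := hcd t₀
    rw [← sub_zero t₀] at this
    simpa using HasDerivAt.comp_const_sub t₀ 0 this) (by simp [hs₀])
  obtain ⟨r, ⟨-, hr⟩, hr0, hr1⟩ := (ha2.and (Ioo_mem_nhdsGT
    (show (0:ℝ) < t₀ - t₁ by linarith [ht₀.1]))).exists
  have h12 : n₁ = n₂ := by
    rw [← hr, hside (t₀ - r) ⟨by linarith, by linarith⟩]
  have hrp := crossDet_rot_pos (hγ.locIso.deriv_ne_zero 0)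
  obtain ⟨p, hp⟩ := hγ.exists_germ hst (w := (1:ℝ) • rot (deriv γ 0)) (s := 0)
    (by rw [one_smul]; exact hrp.ne')
  obtain ⟨m, hm⟩ := hγ.exists_germ hst (w := (-1:ℝ) • rot (deriv γ 0)) (s := 0)
    (by rw [crossDet_smul]; linarith)
  have e1 := hγ.germ_const hst hd1 hrp one_ne_zero hn₁ hp
  have e2 := hγ.germ_const hst hd0 hrp (by norm_num) hn₂ hm
  rw [one_smul] at hp
  rw [neg_one_smul] at hm
  exact hγ.germ_ne hst hp hm (by rw [← e1, ← e2, h12])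

/-- A geodesic loop cannot stay within the union of the minimal lines. -/
theorem no_loop_of_E_zero {c : ℝ → ℝ × ℝ} (hc : M.LocIso c) {t₁ t₂ : ℝ} (ht : t₁ < t₂)
    (hl : c t₁ = c t₂) (hE : ∀ t ∈ Icc t₁ t₂, S.E (c t) = 0)
    (hCl : ∀ t ∈ Icc t₁ t₂, S.Cl (c t)) : False := by
  obtain ⟨φ, hφ⟩ : ∃ φ : ℝ → ℝ, φ = fun t => crossDet (deriv (S.leaf (c t)) (S.b (c t))) (deriv c t) :=
    ⟨_, rfl⟩
  have hφc : ContinuousOn φ (Icc t₁ t₂) := by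
    have h1 : Continuous fun t : Icc t₁ t₂ => deriv (S.leaf (c t)) (S.b (c t)) :=
      continuous_deriv_leaf.comp
        (Continuous.subtype_mk (hc.continuous.comp continuous_subtype_val) fun t => hE t t.2)
    have h2 : ContinuousOn (fun t => deriv (S.leaf (c t)) (S.b (c t))) (Icc t₁ t₂) :=
      continuousOn_iff_continuous_domRestrict.2 h1
    have h3 : Continuous (deriv c) := hc.contDiff_one.continuous_deriv le_rfl
    simp only [hφ, crossDet]
    exact (h2.fst.mul h3.snd.continuousOn).sub (h2.snd.mul h3.fst.continuousOn)
  have hφ0 : ∀ t ∈ Icc t₁ t₂, φ t ≠ 0 := fun t h1 h2 => by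
    have hγ := leaf_spec (hE t h1)
    rw [hφ] at h2
    obtain ⟨r, hr⟩ := exists_smul_of_crossDet (hγ.locIso.deriv_ne_zero _) h2
    have h3 := hc.eq_or_eq_neg hγ.locIso (leaf_self (hE t h1)).symm hr
    have h4 : ∃ s₁ s₂, S.leaf (c t) s₁ = c t₁ ∧ S.leaf (c t) s₂ = c t₂ ∧ s₁ ≠ s₂ := by
      have e1 := add_sub_cancel t t₁
      have e2 := add_sub_cancel t t₂
      rcases h3 with h3 | h3
      · refine ⟨_, _, by rw [← h3 (t₁ - t), e1], by rw [← h3 (t₂ - t), e2], fun h => ?_⟩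
        linarith
      · refine ⟨_, _, by rw [← h3 (t₁ - t), e1], by rw [← h3 (t₂ - t), e2], fun h => ?_⟩
        linarith
    obtain ⟨s₁, s₂, e1, e2, h5⟩ := h4
    apply h5
    rw [← hγ.hb s₁, ← hγ.hb s₂, e1, e2, hl]
  have hpre := isPreconnected_Icc.image φ hφc (s := Icc t₁ t₂)
  by_cases hneg : ∃ t ∈ Icc t₁ t₂, φ t < 0
  · obtain ⟨t', ht', hneg⟩ := hneg
    have hall : ∀ t ∈ Icc t₁ t₂, φ t < 0 := fun t h1 => by
      by_contra! h2
      obtain ⟨u, hu, hu0⟩ := hpre.ordConnected.out ⟨t', ht', rfl⟩ ⟨t, h1, rfl⟩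
        (show (0:ℝ) ∈ Icc (φ t') (φ t) from ⟨hneg.le, h2⟩)
      exact hφ0 u hu hu0
    have hm : ∀ t ∈ Icc (-t₂) (-t₁), -t ∈ Icc t₁ t₂ := fun t h => ⟨by linarith [h.2], by linarith [h.1]⟩
    refine no_loop_of_transverse hc.neg (neg_lt_neg ht) (by simp [hl]) (fun t h => hE _ (hm t h))
      (fun t h => hCl _ (hm t h)) fun t h => ?_
    have := hall _ (hm t h)
    rw [hφ] at this
    rw [deriv_comp_neg, crossDet_neg]
    linarith
  · push Not at hneg
    exact no_loop_of_transverse hc ht hl hE hCl fun t h =>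
      by have := lt_of_le_of_ne (hneg t h) (hφ0 t h).symm; rwa [hφ] at this

end TorusMetric.Strip

namespace TorusMetric.Strip

variable {M : TorusMetric} {S : M.Strip}

theorem leaf_ne {z q : ℝ × ℝ} (hz : S.E z = 0) (hq : 0 < S.E q) (t : ℝ) : S.leaf z t ≠ q :=
  fun h => hq.ne' (h ▸ (leaf_spec hz).E t)

theorem steady_leaf {z : ℝ × ℝ} (hz : S.E z = 0) (hc : S.Cl z) : Steady S.ℓ S.B (S.leaf z) :=
  (leaf_spec hz).steady_of_cl (s := S.b z) (by rwa [leaf_self hz])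

theorem leaf_add {z : ℝ × ℝ} (hz : S.E z = 0) (n : ℤ) :
    S.leaf (z + lat (n, 0)) = fun s => S.leaf z (s - n * S.ℓ) + lat (n, 0) := by
  have := ((leaf_spec hz).translate n).leaf_eq (S.b z + n * S.ℓ)
  rwa [add_sub_cancel_right, leaf_self hz] at this

theorem side_leaf_add {z q : ℝ × ℝ} (hz : S.E z = 0) (hc : S.Cl z) (hq : 0 < S.E q) (n : ℤ) :
    side (S.leaf (z + lat (n, 0))) (q + lat (n, 0)) = side (S.leaf z) q := by
  rw [leaf_add hz]
  exact side_translate S.hℓ (leaf_spec hz).continuous (steady_leaf hz hc) (leaf_ne hz hq)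
    (-(n * S.ℓ)) (lat (n, 0))

theorem side_leaf_eventually {z q : ℝ × ℝ} (hz : S.E z = 0) (hc : S.Cl z) (hq : 0 < S.E q) :
    ∀ᶠ y in 𝓝 z, S.E y = 0 → S.Cl y → side (S.leaf y) q = side (S.leaf z) q := by
  have h1 := side_eventually (X := {y // S.E y = 0 ∧ S.Cl y}) (h := fun y => S.leaf y)
    (q := fun _ => q) (B := S.B) S.hℓ
    (leaf_continuous_comp (continuous_subtype_val.comp continuous_fst) (fun p => p.1.2.1)
      continuous_snd) continuous_const (fun y => steady_leaf y.2.1 y.2.2) (x₀ := ⟨z, hz, hc⟩)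
    (leaf_ne hz hq)
  have h2 := (eventually_nhds_subtype_iff {y | S.E y = 0 ∧ S.Cl y} ⟨z, hz, hc⟩
    (fun y => side (S.leaf y) q = side (S.leaf z) q)).1 h1
  rw [eventually_nhdsWithin_iff] at h2
  filter_upwards [h2] with y hy h3 h4 using hy ⟨h3, h4⟩

theorem isClosed_side (S : M.Strip) {q : ℝ × ℝ} (hq : 0 < S.E q) (A : Set ℤ) :
    IsClosed {z | S.E z = 0 ∧ S.Cl z ∧ side (S.leaf z) q ∈ A} := by
  refine isClosed_of_closure_subset fun z hz => ?_
  have h1 : S.E z = 0 ∧ S.Cl z := by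
    have : IsClosed {z | S.E z = 0 ∧ S.Cl z} :=
      (isClosed_eq S.E_continuous continuous_const).inter S.isClosed_Cl
    exact closure_minimal (fun y (hy : S.E y = 0 ∧ S.Cl y ∧ _) =>
      show S.E y = 0 ∧ S.Cl y from ⟨hy.1, hy.2.1⟩) this hz
  obtain ⟨y, hy, h2⟩ := ((side_leaf_eventually h1.1 h1.2 hq).and_frequently
    (mem_closure_iff_frequently.1 hz)).exists
  exact ⟨h1.1, h1.2, hy h2.1 h2.2.1 ▸ h2.2.2⟩

theorem side_of_not_up {z q : ℝ × ℝ} (hc : S.Cl z) (h : ¬ S.Up z)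
    (hq : (S.α 0).2 + S.Bd < q.2) : side (S.leaf z) q = 1 := by
  have hr : z ∈ range S.α := by
    by_contra h1
    exact h ⟨h1, fun h2 => hc.1 ⟨h1, h2⟩⟩
  obtain ⟨s, rfl⟩ := hr
  rw [S.leaf_α.leaf_eq]
  exact side_eq_one S.hℓ S.leaf_α.continuous S.steady_α fun t => by
    linarith [(abs_le.1 (S.hB t)).2]

theorem side_of_not_low {z q : ℝ × ℝ} (hc : S.Cl z) (h : ¬ S.Low (z - lat S.v))
    (hq : q.2 < (S.α 0).2 + S.m - S.Bd) : side (S.leaf z) q = 0 := by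
  have hr : z - lat S.v ∈ range S.α := by
    by_contra h1
    exact hc.2 ⟨h1, fun h2 => h ⟨h1, h2⟩⟩
  obtain ⟨s, hs⟩ := hr
  have hz : z = (fun s => S.α (s - S.β) + lat S.v) (s + S.β) := by simp [hs]
  have hv : (lat S.v).2 = S.m := rfl
  rw [hz, S.leaf_αv.leaf_eq]
  have hB : ∀ t, -S.Bd ≤ (S.α t).2 - (S.α 0).2 ∧ (S.α t).2 - (S.α 0).2 ≤ S.Bd :=
    fun t => abs_le.1 (S.hB t)
  have hst : Steady S.ℓ S.B fun s => S.α (s - S.β) + lat S.v := by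
    refine S.leaf_αv.steady (fun t => ?_) fun t => ?_
    · rw [Prod.snd_add, hv]
      linarith [hB (t - S.β), S.m_pos]
    · rw [Prod.snd_add, hv]
      linarith [hB (t - S.β)]
  refine side_eq_zero S.hℓ S.leaf_αv.continuous hst fun t => ?_
  rw [Prod.snd_add, hv]
  linarith [hB (t - S.β)]

/-- Points of the closed strip in a bounded range form a compact set. -/
theorem isCompact_Cl (S : M.Strip) (R : ℝ) : IsCompact {x | S.Cl x ∧ |x.1| ≤ R} := by
  refine Metric.isCompact_of_isClosed_isBounded
    (S.isClosed_Cl.inter (isClosed_le continuous_fst.abs continuous_const)) ?_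
  rw [isBounded_iff_forall_norm_le]
  refine ⟨max R (|(S.α 0).2| + S.m + S.Bd), fun x hx => ?_⟩
  rw [Prod.norm_def]
  refine max_le_max hx.2 (abs_le.2 ⟨?_, ?_⟩)
  · linarith [hx.1.ge, neg_abs_le (S.α 0).2, S.m_pos]
  · linarith [hx.1.le, le_abs_self (S.α 0).2]

/-- Points of the strip of small excess exist on any locus separating the two boundary lines. -/
theorem exists_small_E (S : M.Strip) {G : ℝ × ℝ → ℝ} (hG : Continuous G) (h0 : G (S.α 0) ≤ 0)
    (h1 : ∀ n : ℤ, 0 ≤ G (S.α 0 + lat S.v + lat (n, 0))) {ε : ℝ} (hε : 0 < ε) :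
    ∃ x, G x = 0 ∧ S.E x ≤ ε := by
  have hb0 : S.b (S.α 0) = 0 := S.b_α 0
  have hβ : S.b (S.α 0 + lat S.v) = S.β := by rw [S.b_αv, add_zero]
  have hlim := tendsto_bus S.axis (S.α 0 + lat S.v)
  change Tendsto _ _ (𝓝 (S.b _)) at hlim
  rw [hβ] at hlim
  obtain ⟨n, hn⟩ := (hlim.eventually (gt_mem_nhds (lt_add_of_pos_right S.β hε))).exists
  have hne : (n • e₁ : ℤ × ℤ) = ((n : ℤ), 0) := by simp [e₁]
  rw [hne] at hn
  obtain ⟨γ, g0, g1, -, hl⟩ := M.exists_segment (S.α 0) (S.α 0 + lat S.v + lat ((n : ℤ), 0))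
  set L := M.dist (S.α 0) (S.α 0 + lat S.v + lat ((n : ℤ), 0)) with hL
  have hL0 : 0 ≤ L := dist_nonneg _ _
  have hγ : Continuous γ := continuous_of_lip hl
  obtain ⟨s, hs, hs0⟩ := intermediate_value_Icc hL0 (hG.comp hγ).continuousOn
    (show (0:ℝ) ∈ Icc ((G ∘ γ) 0) ((G ∘ γ) L) from ⟨by simpa [g0], by simpa [g1] using h1 n⟩)
  refine ⟨γ s, hs0, ?_⟩
  have e1 : S.b (γ s) ≤ s := by
    have h2 := S.b_lip (γ 0) (γ s)
    have h3 := hl 0 s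
    rw [g0, hb0] at h2
    rw [g0, zero_sub, abs_neg, abs_of_nonneg hs.1] at h3
    linarith
  have e2 : S.b' (γ s) ≤ L - s - n * S.ℓ := by
    have h2 := S.b'_lip (γ L) (γ s)
    have h3 := hl L s
    have h4 : S.b' (γ L) = -(n * S.ℓ) := by
      rw [g1, b'_add_int, S.b'_αv]
      push_cast; ring
    rw [h4] at h2
    rw [abs_of_nonneg (by linarith [hs.2])] at h3
    linarith
  unfold E
  linarith

/-- Some minimal line separates a point of positive excess from its translate. -/
theorem exists_separating {p : ℝ × ℝ} (hp : 0 < S.E p) (h1 : (S.α 0).2 + S.Bd < p.2)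
    (h2 : p.2 < (S.α 0).2 + S.m - S.Bd) :
    ∃ z, S.E z = 0 ∧ S.Cl z ∧ side (S.leaf z) p ≠ side (S.leaf z) (p + lat (1, 0)) := by
  by_contra! H
  have hp' : 0 < S.E (p + lat (1, 0)) := by rwa [E_add_int]
  set G₀ : Set (ℝ × ℝ) := {z | S.E z = 0 ∧ S.Cl z ∧ side (S.leaf z) p ∈ ({1} : Set ℤ)} ∪
    {z | S.Up z}ᶜ with hG0
  set G₁ : Set (ℝ × ℝ) := {z | S.E z = 0 ∧ S.Cl z ∧ side (S.leaf z) p ∈ ({1} : Set ℤ)ᶜ} ∪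
    {z | S.Low (z - lat S.v)}ᶜ with hG1
  have hc0 : IsClosed G₀ := (S.isClosed_side hp _).union S.isOpen_Up.isClosed_compl
  have hc1 : IsClosed G₁ := (S.isClosed_side hp _).union
    (S.isOpen_Low.preimage (continuous_id.sub continuous_const)).isClosed_compl
  have hinv : ∀ z, S.E z = 0 → S.Cl z →
      side (S.leaf (z + lat (1, 0))) p = side (S.leaf z) p := fun z h3 h4 => by
    rw [H _ (by rwa [E_add_int]) ((cl_add z 1).2 h4), side_leaf_add h3 h4 hp]
  have hiff : ∀ A : Set ℤ, ∀ z, (S.E (z + lat (1, 0)) = 0 ∧ S.Cl (z + lat (1, 0)) ∧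
      side (S.leaf (z + lat (1, 0))) p ∈ A) ↔ (S.E z = 0 ∧ S.Cl z ∧ side (S.leaf z) p ∈ A) := by
    intro A z
    rw [E_add_int, cl_add]
    exact and_congr_right fun h3 => and_congr_right fun h4 => by rw [hinv z h3 h4]
  have hi0 : ∀ z, z + lat (1, 0) ∈ G₀ ↔ z ∈ G₀ := fun z =>
    or_congr (hiff _ z) (not_congr (S.up_add z 1))
  have hi1 : ∀ z, z + lat (1, 0) ∈ G₁ ↔ z ∈ G₁ := fun z =>
    or_congr (hiff _ z) (not_congr (by
      change S.Low (z + lat (1, 0) - lat S.v) ↔ _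
      rw [add_sub_right_comm]; exact S.low_add _ 1))
  have hinf : ∀ G : Set (ℝ × ℝ), (∀ z, z + lat (1, 0) ∈ G ↔ z ∈ G) → ∀ (n : ℤ) (z : ℝ × ℝ),
      Metric.infDist (z + lat (n, 0)) G = Metric.infDist z G := by
    intro G hG n z
    have hone : ∀ z, Metric.infDist (z + lat (1, 0)) G = Metric.infDist z G := by
      intro z
      have e := Metric.infDist_image (IsometryEquiv.addRight (lat (1, 0))).isometry
        (x := z) (t := G)
      have e' : (IsometryEquiv.addRight (lat (1, 0))) '' G = G := by
        ext y
        constructor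
        · rintro ⟨x, hx, rfl⟩
          exact (hG x).2 hx
        · intro hy
          exact ⟨y - lat (1, 0), (hG _).1 (by rwa [sub_add_cancel]), sub_add_cancel y _⟩
      rwa [e'] at e
    have h4 := int_add (f := fun z => Metric.infDist z G) (a := lat e₁) (c := 0)
      (fun x => (hone x).trans (add_zero _).symm) n z
    rw [smul_zero, add_zero, ← lat_fst] at h4
    exact h4
  have hdisj : ∀ z, z ∈ G₀ → z ∉ G₁ := by
    rintro z (⟨a1, a2, a3⟩ | a) (⟨b1, b2, b3⟩ | b)
    · exact b3 a3
    · rw [side_of_not_low a2 b h2] at a3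
      exact absurd a3 (by simp)
    · exact b3 (side_of_not_up b2 a h1)
    · have h3 : z.2 ≤ (S.α 0).2 + S.Bd := not_lt.1 fun h => a (S.up_of_lt h)
      have h4 : (S.α 0).2 - S.Bd ≤ (z - lat S.v).2 := not_lt.1 fun h => b (S.low_of_lt h)
      have h5 : (z - lat S.v).2 = z.2 - S.m := rfl
      linarith [S.hm]
  have hα : S.α 0 ∈ G₀ := Or.inr fun h => h.1 ⟨0, rfl⟩
  have hαv : ∀ n : ℤ, S.α 0 + lat S.v + lat (n, 0) ∈ G₁ := fun n => Or.inr fun h => by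
    change S.Low _ at h
    rw [add_assoc, add_comm (lat S.v), ← add_assoc, add_sub_cancel_right] at h
    exact ((S.low_add _ n).1 h).1 ⟨0, rfl⟩
  have hne0 : G₀.Nonempty := ⟨_, hα⟩
  have hne1 : G₁.Nonempty := ⟨_, hαv 0⟩
  set G : ℝ × ℝ → ℝ := fun z => Metric.infDist z G₀ - Metric.infDist z G₁ with hG
  have hGc : Continuous G := (Metric.continuous_infDist_pt _).sub (Metric.continuous_infDist_pt _)
  have hGn : ∀ z, G z = 0 → z ∉ G₀ ∧ z ∉ G₁ := fun z hz => by
    have hz : Metric.infDist z G₀ = Metric.infDist z G₁ := sub_eq_zero.1 hz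
    constructor <;> intro h3
    · rw [Metric.infDist_zero_of_mem h3] at hz
      exact hdisj z h3 ((hc1.mem_iff_infDist_zero hne1).2 hz.symm)
    · rw [Metric.infDist_zero_of_mem h3] at hz
      exact hdisj z ((hc0.mem_iff_infDist_zero hne0).2 hz) h3
  have hGcl : ∀ z, G z = 0 → S.Op z := fun z hz => by
    obtain ⟨h3, h4⟩ := hGn z hz
    exact ⟨not_not.1 fun h => h3 (Or.inr h), not_not.1 fun h => h4 (Or.inr h)⟩
  have hsmall : ∀ ε > 0, ∃ x, (S.Cl x ∧ |x.1| ≤ 1) ∧ G x = 0 ∧ S.E x ≤ ε := fun ε hε => by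
    obtain ⟨x, h3, h4⟩ := S.exists_small_E hGc
      (by simp only [hG, Metric.infDist_zero_of_mem hα, zero_sub, Left.neg_nonpos_iff]
          exact Metric.infDist_nonneg)
      (fun n => by
        simp only [hG, Metric.infDist_zero_of_mem (hαv n), sub_zero]
        exact Metric.infDist_nonneg) hε
    refine ⟨x + lat (-⌊x.1⌋, 0), ⟨(cl_add x _).2 (hGcl x h3).cl, ?_⟩, ?_, ?_⟩
    · have : (x + lat (-⌊x.1⌋, 0)).1 = Int.fract x.1 := by
        simp [lat, ← sub_eq_add_neg, Int.self_sub_floor]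
      rw [this, abs_of_nonneg (Int.fract_nonneg _)]
      exact (Int.fract_lt_one _).le
    · simpa only [hG, hinf _ hi0, hinf _ hi1] using h3
    · rwa [E_add_int]
  have hQ : IsCompact {x | (S.Cl x ∧ |x.1| ≤ 1) ∧ G x = 0} :=
    (S.isCompact_Cl 1).inter_right (isClosed_eq hGc continuous_const)
  obtain ⟨x₁, hx₁, hx₁', -⟩ := hsmall 1 one_pos
  obtain ⟨x, ⟨⟨hx, -⟩, hGx⟩, hmin⟩ := hQ.exists_isMinOn ⟨x₁, hx₁, hx₁'⟩ S.E_continuous.continuousOn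
  have hEx : S.E x = 0 := le_antisymm (le_of_forall_pos_le_add fun ε hε => by
    obtain ⟨y, h3, h4, h5⟩ := hsmall ε hε
    rw [zero_add]
    exact (hmin ⟨h3, h4⟩).trans h5) (S.E_nonneg x)
  obtain ⟨h3, h4⟩ := hGn x hGx
  by_cases h5 : side (S.leaf x) p = 1
  · exact h3 (Or.inl ⟨hEx, hx, h5⟩)
  · exact h4 (Or.inl ⟨hEx, hx, h5⟩)

/-- A set of minimal lines, isolated among all minimal lines of the strip and disjoint from its
translate. -/
structure Gap (S : M.Strip) (Y : Set (ℝ × ℝ)) : Prop where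
  closed : IsClosed Y
  nonempty : Y.Nonempty
  E : ∀ z ∈ Y, S.E z = 0
  op : ∀ z ∈ Y, S.Op z
  isolated : ∀ z ∈ Y, ∀ᶠ y in 𝓝 z, S.E y = 0 → y ∈ Y
  leaf : ∀ z ∈ Y, ∀ s, S.leaf z s ∈ Y
  disjoint : ∀ z ∈ Y, z + lat (1, 0) ∉ Y

theorem exists_gap {p : ℝ × ℝ} (hp : 0 < S.E p) (h1 : (S.α 0).2 + S.Bd < p.2)
    (h2 : p.2 < (S.α 0).2 + S.m - S.Bd) : ∃ Y, S.Gap Y := by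
  have hp' : 0 < S.E (p + lat (1, 0)) := by rwa [E_add_int]
  have hq : (p + lat (1, 0)).2 = p.2 := by simp [lat]
  obtain ⟨z₀, hz₀, hc₀, hne⟩ := exists_separating hp h1 h2
  set i := side (S.leaf z₀) p with hi
  set j := side (S.leaf z₀) (p + lat (1, 0)) with hj
  set Y : Set (ℝ × ℝ) := {z | S.E z = 0 ∧ S.Cl z ∧ side (S.leaf z) p ∈ ({i} : Set ℤ)} ∩
    {z | S.E z = 0 ∧ S.Cl z ∧ side (S.leaf z) (p + lat (1, 0)) ∈ ({j} : Set ℤ)} with hY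
  have hop : ∀ z ∈ Y, S.Op z := by
    rintro z ⟨⟨h3, h4, h5⟩, -, -, h6⟩
    have h5 : side (S.leaf z) p = i := h5
    have h6 : side (S.leaf z) (p + lat (1, 0)) = j := h6
    refine ⟨not_not.1 fun h => hne ?_, not_not.1 fun h => hne ?_⟩
    · rw [← h5, ← h6, side_of_not_up h4 h h1, side_of_not_up h4 h (by rwa [hq])]
    · rw [← h5, ← h6, side_of_not_low h4 h h2, side_of_not_low h4 h (by rwa [hq])]
  refine ⟨Y, (S.isClosed_side hp _).inter (S.isClosed_side hp' _),
    ⟨z₀, ⟨hz₀, hc₀, rfl⟩, hz₀, hc₀, rfl⟩, fun z hz => hz.1.1, hop, ?_, ?_, ?_⟩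
  · intro z hz
    have hz' := hz
    obtain ⟨⟨h3, h4, h5⟩, -, -, h6⟩ := hz'
    filter_upwards [side_leaf_eventually h3 h4 hp, side_leaf_eventually h3 h4 hp',
      S.isOpen_Op.mem_nhds (hop z hz)] with y h7 h8 h9 h10
    have h9 : S.Op y := h9
    exact ⟨⟨h10, h9.cl, (h7 h10 h9.cl).trans h5⟩, h10, h9.cl, (h8 h10 h9.cl).trans h6⟩
  · rintro z ⟨⟨h3, h4, h5⟩, -, -, h6⟩ s
    have hl := leaf_spec h3
    have h7 := hl.E s
    have h8 := hl.cl (s := S.b z) (by rwa [leaf_self h3]) s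
    refine ⟨⟨h7, h8, ?_⟩, h7, h8, ?_⟩ <;> rwa [hl.leaf_eq]
  · rintro z ⟨⟨h3, h4, h5⟩, -, -, h6⟩ ⟨-, -, -, h7⟩
    have h5 : side (S.leaf z) p = i := h5
    have h7 : side (S.leaf (z + lat (1, 0))) (p + lat (1, 0)) = j := h7
    rw [side_leaf_add h3 h4 hp, h5] at h7
    exact hne h7

end TorusMetric.Strip

namespace TorusMetric

variable {M : TorusMetric}

theorem exists_uniform_bus {o : ℝ × ℝ} {ℓ : ℝ} {e : ℤ × ℤ}
    (h : ∀ n : ℕ, M.dist o (o + lat (n • e)) = n * ℓ) {R : Set (ℝ × ℝ)} (hR : IsCompact R)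
    {ε : ℝ} (hε : 0 < ε) :
    ∃ N : ℕ, ∀ n ≥ N, ∀ x ∈ R, M.dist o (x + lat (n • e)) - n * ℓ ≤ M.bus ℓ o e x + ε := by
  have h1 := Antitone.tendstoUniformlyOn_of_forall_tendsto
    (F := fun (n : ℕ) x => M.dist o (x + lat (n • e)) - n * ℓ) (f := M.bus ℓ o e) hR
    (fun n => ((M.continuous_dist.comp (by fun_prop :
      Continuous fun x => (o, x + lat (n • e)))).sub continuous_const).continuousOn)
    (fun x _ => bus_antitone (axis_one h) x) (bus_lip h).continuous.continuousOn
    (fun x _ => tendsto_bus h x)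
  rw [Metric.tendstoUniformlyOn_iff] at h1
  obtain ⟨N, hN⟩ := eventually_atTop.1 (h1 ε hε)
  refine ⟨N, fun n hn x hx => ?_⟩
  have := abs_lt.1 (Real.dist_eq _ _ ▸ hN n hn x hx)
  linarith [this.1]

theorem exists_chain (M : TorusMetric) {R : Set (ℝ × ℝ)} (hR : IsCompact R) (hne : R.Nonempty)
    {n : ℕ} (hn : 2 ≤ n) (κ : ZMod n → ℤ × ℤ) :
    ∃ x : ZMod n → ℝ × ℝ, (∀ j, x j ∈ R) ∧ ∀ j, ∀ y ∈ R,
      M.dist (x (j - 1)) (x j + lat (κ (j - 1))) + M.dist (x j) (x (j + 1) + lat (κ j)) ≤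
      M.dist (x (j - 1)) (y + lat (κ (j - 1))) + M.dist y (x (j + 1) + lat (κ j)) := by
  have : NeZero n := ⟨by omega⟩
  have : Fact (1 < n) := ⟨by omega⟩
  obtain ⟨x, hx, hmin⟩ := (isCompact_univ_pi fun _ : ZMod n => hR).exists_isMinOn
    (univ_pi_nonempty_iff.2 fun _ => hne)
    (f := fun x : ZMod n → ℝ × ℝ => ∑ j, M.dist (x j) (x (j + 1) + lat (κ j)))
    (continuous_finsetSum _ fun j _ => M.continuous_dist.comp (by fun_prop :
      Continuous fun x : ZMod n → ℝ × ℝ => (x j, x (j + 1) + lat (κ j)))).continuousOn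
  refine ⟨x, fun j => hx j (mem_univ _), fun j y hy => ?_⟩
  have h1 : (Function.update x j y) ∈ pi univ fun _ : ZMod n => R := by
    intro i _
    by_cases hi : i = j
    · subst hi; simpa using hy
    · simpa [hi] using hx i (mem_univ _)
  have h2 : ∑ i, (M.dist (x i) (x (i + 1) + lat (κ i))) ≤ ∑ i, (M.dist (Function.update x j y i)
    (Function.update x j y (i + 1) + lat (κ i))) := hmin h1
  have hj : j - 1 ≠ j := by simp
  have hj' : j + 1 ≠ j := by simp
  have h3 : ∑ i, (M.dist (Function.update x j y i)
      (Function.update x j y (i + 1) + lat (κ i)) - M.dist (x i) (x (i + 1) + lat (κ i))) =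
      ∑ i ∈ {j - 1, j}, (M.dist (Function.update x j y i)
      (Function.update x j y (i + 1) + lat (κ i)) - M.dist (x i) (x (i + 1) + lat (κ i))) := by
    refine (Finset.sum_subset (Finset.subset_univ _) fun i _ hi => ?_).symm
    simp only [Finset.mem_insert, Finset.mem_singleton, not_or] at hi
    have h4 : i + 1 ≠ j := fun h => hi.1 (eq_sub_of_add_eq h)
    rw [Function.update_of_ne hi.2, Function.update_of_ne h4, sub_self]
  rw [Finset.sum_sub_distrib, Finset.sum_pair hj, sub_add_cancel, Function.update_self,
    Function.update_of_ne hj, Function.update_of_ne hj'] at h3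
  linarith

namespace Strip

variable {S : M.Strip}

/-- A compact neighbourhood of a fundamental piece of a gap family, in which the only points of
zero excess belong to the family. -/
structure Gate (S : M.Strip) (Y R : Set (ℝ × ℝ)) (ρ : ℝ) : Prop where
  pos : 0 < ρ
  compact : IsCompact R
  op : ∀ x ∈ R, S.Op x
  mem : ∀ x ∈ R, S.E x = 0 → x ∈ Y
  ball : ∀ z ∈ Y, S.b z = 0 → ∀ x, ‖x - z‖ ≤ ρ → x ∈ R
  nonempty : ∃ z ∈ Y, S.b z = 0

theorem Gap.exists_gate {Y : Set (ℝ × ℝ)} (hY : S.Gap Y) : ∃ R ρ, S.Gate Y R ρ := by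
  have hK : IsCompact {z | z ∈ Y ∧ S.b z = 0} := by
    refine (S.isCompact_Cl (S.B / S.ℓ)).of_isClosed_subset
      (hY.closed.inter (isClosed_eq S.b_lip.continuous continuous_const)) fun z hz => ?_
    have hcl := (hY.op z hz.1).cl
    have h1 := steady_leaf (hY.E z hz.1) hcl 0
    have h2 := leaf_self (hY.E z hz.1)
    rw [hz.2] at h2
    rw [h2, zero_sub, abs_neg, abs_mul, abs_of_pos S.hℓ] at h1
    exact ⟨hcl, by rwa [le_div_iff₀' S.hℓ]⟩
  obtain ⟨ρ, hρ, hsub⟩ := hK.exists_cthickening_subset_open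
    (S.isOpen_Op.inter (isOpen_interior (s := {y | S.E y = 0 → y ∈ Y}))) fun z hz =>
      ⟨hY.op z hz.1, mem_interior_iff_mem_nhds.2 (hY.isolated z hz.1)⟩
  refine ⟨_, ρ, hρ, hK.cthickening, fun x hx => (hsub hx).1,
    fun x hx => interior_subset (hsub hx).2, fun z hz hb x hx => ?_, ?_⟩
  · exact Metric.closedBall_subset_cthickening (E := {z | z ∈ Y ∧ S.b z = 0}) ⟨hz, hb⟩ ρ
      (by rwa [mem_closedBall_iff_norm])
  · obtain ⟨z, hz⟩ := hY.nonempty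
    exact ⟨_, hY.leaf z hz 0, (leaf_spec (hY.E z hz)).hb 0⟩

theorem exists_dist_le (S : M.Strip) {R : Set (ℝ × ℝ)} (hR : IsCompact R) {ε : ℝ} (hε : 0 < ε) :
    ∃ N : ℕ, ∀ n : ℕ, N ≤ n → ∀ x ∈ R, ∀ y ∈ R,
      M.dist x (y + lat S.v + lat ((n : ℤ), 0)) ≤ S.b' x + S.b y + n * S.ℓ + ε := by
  obtain ⟨N₁, h₁⟩ := exists_uniform_bus S.axis hR (half_pos hε)
  obtain ⟨N₂, h₂⟩ := exists_uniform_bus S.axis' hR (half_pos hε)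
  refine ⟨N₁ + N₂, fun n hn x hx y hy => ?_⟩
  obtain ⟨k, rfl⟩ := Nat.exists_eq_add_of_le (le_trans (Nat.le_add_left _ _) hn)
  have hb := h₁ k (by omega) y hy
  have hb' := h₂ N₂ le_rfl x hx
  have htri := dist_triangle (M := M) x (S.α 0 + lat S.v + lat ((N₂ : ℤ), 0))
    (y + lat S.v + lat (((N₂ + k : ℕ) : ℤ), 0))
  have e1 : M.dist (S.α 0 + lat S.v + lat ((N₂ : ℤ), 0))
      (y + lat S.v + lat (((N₂ + k : ℕ) : ℤ), 0)) = M.dist (S.α 0) (y + lat (k • e₁)) := by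
    rw [← dist_add_lat (S.α 0) _ (S.v + ((N₂ : ℤ), 0))]
    congr 1
    · rw [lat_add, add_assoc]
    · rw [add_assoc, add_assoc, ← lat_add, ← lat_add]
      congr 2
      ext <;> simp [e₁, Strip.v, add_comm]
  have e2 : M.dist x (S.α 0 + lat S.v + lat ((N₂ : ℤ), 0)) =
      M.dist (S.α 0 + lat S.v) (x + lat (N₂ • -e₁)) := by
    rw [dist_comm, smul_neg, lat_neg, ← sub_eq_add_neg, dist_sub_lat_right]
    congr 3
    ext <;> simp [e₁]
  rw [e1, e2] at htri
  have e3 : S.b y = M.bus S.ℓ (S.α 0) e₁ y := rfl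
  have e4 : S.b' x = M.bus S.ℓ (S.α 0 + lat S.v) (-e₁) x := rfl
  rw [← e3] at hb
  rw [← e4] at hb'
  have e5 : ((N₂ + k : ℕ) : ℝ) = N₂ + k := Nat.cast_add _ _
  rw [e5]
  linarith

end Strip

end TorusMetric

namespace TorusMetric.Strip

variable {M : TorusMetric} {S : M.Strip}

/-- The curve `σ` goes from a lower translate of a point of `R` through a point of `R` to an
upper translate of a point of `R`, with almost optimal lengths. -/
structure Pass (S : M.Strip) (R : Set (ℝ × ℝ)) (ε : ℝ) (N : ℕ) (L L' : ℝ) (σ : ℝ → ℝ × ℝ) :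
    Prop where
  lip : ∀ u v, u ≤ v → M.dist (σ u) (σ v) ≤ v - u
  mem : σ 0 ∈ R
  E : S.E (σ 0) ≤ ε
  hL : 0 ≤ L
  hL' : 0 ≤ L'
  fwd : ∃ n : ℕ, N ≤ n ∧ ∃ y ∈ R, σ L = y + lat S.v + lat ((n : ℤ), 0) ∧
    L ≤ S.b' (σ 0) + S.b y + n * S.ℓ + ε
  bwd : ∃ n : ℕ, N ≤ n ∧ ∃ y ∈ R, σ (-L') = y - lat S.v - lat ((n : ℤ), 0) ∧
    L' ≤ S.b' y + S.b (σ 0) + n * S.ℓ + ε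

variable {R : Set (ℝ × ℝ)} {ε : ℝ} {N : ℕ} {L L' : ℝ} {σ : ℝ → ℝ × ℝ}

theorem Pass.le_length (h : S.Pass R ε N L L' σ) (hR : ∀ x ∈ R, S.Op x) {C : ℝ}
    (hC : ∀ x ∈ R, |S.b x| ≤ C ∧ |S.b' x| ≤ C) :
    N * S.ℓ - 2 * C ≤ L ∧ N * S.ℓ - 2 * C ≤ L' := by
  have hmul : ∀ n : ℕ, N ≤ n → (N : ℝ) * S.ℓ ≤ n * S.ℓ := fun n hn =>
    mul_le_mul_of_nonneg_right (Nat.cast_le.2 hn) S.hℓ.le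
  constructor
  · obtain ⟨n, hn, y, hy, h1, -⟩ := h.fwd
    have h2 := h.lip 0 L h.hL
    have h3 := le_dist (hR _ h.mem).cl.2 (hR y hy).cl.1 n
    rw [h1] at h2
    have h4 := hmul n hn
    push_cast at h3
    linarith [neg_le_of_abs_le (hC y hy).1, neg_le_of_abs_le (hC _ h.mem).2]
  · obtain ⟨n, hn, y, hy, h1, -⟩ := h.bwd
    have h2 := h.lip (-L') 0 (by linarith [h.hL'])
    have h3 := le_dist (hR y hy).cl.2 (hR _ h.mem).cl.1 n
    rw [h1, ← dist_add_lat _ _ (S.v + ((n : ℤ), 0)), lat_add] at h2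
    rw [show y - lat S.v - lat ((n : ℤ), 0) + (lat S.v + lat ((n : ℤ), 0)) = y by abel,
      ← add_assoc] at h2
    have h4 := hmul n hn
    push_cast at h3
    linarith [neg_le_of_abs_le (hC y hy).2, neg_le_of_abs_le (hC _ h.mem).1]

theorem Pass.b_le (h : S.Pass R ε N L L' σ) (hR : ∀ x ∈ R, S.Op x) {s : ℝ} (hs : s ≤ L) :
    S.b (σ 0) + s - 2 * ε ≤ S.b (σ s) := by
  obtain ⟨n, -, y, hy, h1, h2⟩ := h.fwd
  have h3 := S.b_lip (σ s) (σ L)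
  have h4 := h.lip s L hs
  have h5 := b_add_v (hR y hy).cl.1
  have h6 := h.E
  rw [Strip.E] at h6
  rw [h1, b_add_int, ← h1] at h3
  push_cast at h3
  linarith

theorem Pass.b'_le (h : S.Pass R ε N L L' σ) (hR : ∀ x ∈ R, S.Op x) {s : ℝ} (hs : s ≤ L') :
    S.b' (σ 0) + s - 2 * ε ≤ S.b' (σ (-s)) := by
  obtain ⟨n, -, y, hy, h1, h2⟩ := h.bwd
  have h3 := S.b'_lip (σ (-s)) (σ (-L'))
  have h4 := h.lip (-L') (-s) (by linarith)
  have h5 := b'_sub_v (hR y hy).cl.2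
  have h6 := h.E
  have h7 : S.b' (y - lat S.v - lat ((n : ℤ), 0)) = S.b' (y - lat S.v) + n * S.ℓ := by
    have := b'_add_int (S := S) n (y - lat S.v - lat ((n : ℤ), 0))
    rw [sub_add_cancel] at this
    push_cast at this
    linarith
  rw [Strip.E] at h6
  rw [dist_comm, h1, h7, ← h1] at h3
  linarith

theorem exists_bound (S : M.Strip) (hR : IsCompact R) :
    ∃ C, 0 ≤ C ∧ ∀ x ∈ R, |S.b x| ≤ C ∧ |S.b' x| ≤ C := by
  obtain ⟨C₁, h₁⟩ := hR.exists_bound_of_continuousOn S.b_lip.continuous.continuousOn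
  obtain ⟨C₂, h₂⟩ := hR.exists_bound_of_continuousOn S.b'_lip.continuous.continuousOn
  refine ⟨max 0 (max C₁ C₂), le_max_left _ _, fun x hx => ⟨?_, ?_⟩⟩
  · exact (h₁ x hx).trans (le_max_of_le_right (le_max_left _ _))
  · exact (h₂ x hx).trans (le_max_of_le_right (le_max_right _ _))

theorem exists_shadow (S : M.Strip) (hR : IsCompact R) (hO : ∀ x ∈ R, S.Op x) (B : ℝ) {η : ℝ}
    (hη : 0 < η) : ∃ ε > 0, ∃ N₀ : ℕ, ∀ (L L' : ℝ) (σ : ℝ → ℝ × ℝ), S.Pass R ε N₀ L L' σ →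
      ∃ z ∈ R, S.E z = 0 ∧ ∀ s, |s| ≤ B → ‖σ s - S.leaf z (S.b z + s)‖ ≤ η := by
  by_contra hcon
  push Not at hcon
  choose L L' σ hP hbad using fun i : ℕ => hcon (1 / ((i : ℝ) + 1)) (by positivity) i
  obtain ⟨U, hU⟩ : ∃ U : Ultrafilter ℕ, (U : Filter ℕ) ≤ atTop :=
    ⟨_, Ultrafilter.of_le atTop⟩
  have hε : Tendsto (fun i : ℕ => 1 / ((i : ℝ) + 1)) U (𝓝 0) :=
    tendsto_one_div_add_atTop_nhds_zero_nat.mono_left hU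
  obtain ⟨z, hzR, hz⟩ : ∃ z ∈ R, Tendsto (fun i => σ i 0) U (𝓝 z) :=
    isCompact_iff_ultrafilter_le_nhds.1 hR (U.map fun i => σ i 0)
      (le_principal_iff.2 (mem_map.2 (univ_mem' fun i => (hP i).mem)))
  have hEz : S.E z = 0 := le_antisymm
    (le_of_tendsto_of_tendsto' ((S.E_continuous.tendsto z).comp hz) hε fun i => (hP i).E)
    (S.E_nonneg z)
  choose s hsB hs using fun i => hbad i z hzR hEz
  obtain ⟨a, -, ha⟩ : ∃ a ∈ Icc (-B) B, Tendsto s U (𝓝 a) :=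
    isCompact_iff_ultrafilter_le_nhds.1 isCompact_Icc (U.map s)
      (le_principal_iff.2 (mem_map.2 (univ_mem' fun i => abs_le.1 (hsB i))))
  obtain ⟨C, -, hC⟩ := S.exists_bound hR
  have hlen : Tendsto (fun i : ℕ => (i : ℝ) * S.ℓ - 2 * C) U atTop :=
    (tendsto_atTop_add_const_right _ _
      (tendsto_natCast_atTop_atTop.atTop_mul_const S.hℓ)).mono_left hU
  have hleaf := leaf_spec hEz
  have hγ0 : S.leaf z (S.b z) = z := leaf_self hEz
  have key : ¬ Tendsto (fun i => σ i (s i)) U (𝓝 (S.leaf z (S.b z + a))) := by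
    intro hlim
    have h1 : Tendsto (fun i => S.leaf z (S.b z + s i)) U (𝓝 (S.leaf z (S.b z + a))) :=
      (hleaf.continuous.tendsto _).comp (ha.const_add _)
    have h2 := (hlim.sub h1).norm
    rw [sub_self, norm_zero] at h2
    exact absurd (ge_of_tendsto' h2 fun i => (hs i).le) (not_le.2 hη)
  have hε2 : Tendsto (fun i : ℕ => 2 * (1 / ((i : ℝ) + 1))) U (𝓝 0) := by
    simpa using hε.const_mul 2
  rcases U.em fun i => 0 ≤ s i with hpos | hneg
  · have h1 := cal_limit' U S.b_lip (hleaf.cal (S.b z)) (σ := σ) (L := L)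
      (ε := fun i : ℕ => 2 * (1 / ((i : ℝ) + 1))) (fun i u v _ huv _ => (hP i).lip u v huv)
      (tendsto_atTop_mono (fun i => ((hP i).le_length hO hC).1) hlen) hε2
      (fun i u _ hu => (hP i).b_le hO hu) (by simpa [hγ0] using hz)
      (s := fun i => max (s i) 0) (a := a) (fun i => le_max_right _ _)
      (ha.congr' (hpos.mono fun i hi => (max_eq_left hi).symm))
    exact key (h1.congr' (hpos.mono fun i hi => by rw [max_eq_left hi]))
  · have h1 := cal_limit' U S.b'_lip (hleaf.cal' (S.b z)) (σ := fun i u => σ i (-u)) (L := L')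
      (ε := fun i : ℕ => 2 * (1 / ((i : ℝ) + 1)))
      (fun i u v _ huv _ => by
        rw [dist_comm]
        exact ((hP i).lip (-v) (-u) (by linarith)).trans (by linarith))
      (tendsto_atTop_mono (fun i => ((hP i).le_length hO hC).2) hlen) hε2
      (fun i u _ hu => by simpa using (hP i).b'_le hO hu) (by simpa [hγ0] using hz)
      (s := fun i => max (-s i) 0) (a := -a) (fun i => le_max_right _ _)
      (ha.neg.congr' (hneg.mono fun i hi => (max_eq_left (by linarith [not_le.1 hi])).symm))
    simp only [sub_neg_eq_add] at h1
    refine key (h1.congr' (hneg.mono fun i hi => ?_))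
    rw [max_eq_left (by linarith [not_le.1 hi]), neg_neg]

theorem Pass.exists_isoOn {Y : Set (ℝ × ℝ)} {ρ C : ℝ} (hY : S.Gap Y) (hG : S.Gate Y R ρ)
    (h : S.Pass R ε N L L' σ) (hC : ∀ x ∈ R, |S.b x| ≤ C ∧ |S.b' x| ≤ C)
    (hL : C + 1 ≤ L) (hL' : C + 1 ≤ L')
    (hmin : ∀ y ∈ R, L' + L ≤ M.dist (σ (-L')) y + M.dist y (σ L))
    {z : ℝ × ℝ} (hz : z ∈ R) (hE : S.E z = 0)
    (hs : ∀ s, |s| ≤ C + 1 → ‖σ s - S.leaf z (S.b z + s)‖ ≤ ρ / 2) :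
    ∃ e > 0, M.IsoOn σ (-e) e := by
  have hρ := hG.pos
  have hcm := M.cm_pos
  have hzY := hG.mem z hz hE
  have hleaf := leaf_spec hE
  have h0 := hG.ball _ (hY.leaf z hzY 0) (hleaf.hb 0)
  obtain ⟨θ₀, hθ0, hθ1, hθ2⟩ : ∃ θ₀, 0 < θ₀ ∧ θ₀ ≤ 1 ∧ θ₀ ≤ M.cm * (ρ / 2) :=
    ⟨min 1 (M.cm * (ρ / 2)), by positivity, min_le_left _ _, min_le_right _ _⟩
  obtain ⟨θ, hθ, hne⟩ : ∃ θ, (0 ≤ θ ∧ θ ≤ θ₀) ∧ θ - S.b z ≠ 0 := by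
    by_cases hb : S.b z = 0
    · exact ⟨θ₀, ⟨hθ0.le, le_rfl⟩, by rw [hb, sub_zero]; exact hθ0.ne'⟩
    · exact ⟨0, ⟨le_rfl, hθ0.le⟩, by rwa [zero_sub, neg_ne_zero]⟩
  obtain ⟨τ, hτ⟩ : ∃ τ, τ = θ - S.b z := ⟨_, rfl⟩
  rw [← hτ] at hne
  have hb := abs_le.1 (hC z hz).1
  have hτC : |τ| ≤ C + 1 := by rw [abs_le]; constructor <;> linarith [hb.1, hb.2]
  have hmem : σ τ ∈ R := by
    refine h0 _ ?_
    have h1 := hs τ hτC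
    rw [hτ, add_sub_cancel, ← hτ] at h1
    have h2 : ‖S.leaf z θ - S.leaf z 0‖ ≤ ρ / 2 := by
      have h3 := cm_norm_le_dist (M := M) (S.leaf z 0) (S.leaf z θ)
      rw [hleaf.dist, zero_sub, abs_neg, abs_of_nonneg hθ.1] at h3
      exact le_of_mul_le_mul_left (h3.trans (hθ.2.trans hθ2)) hcm
    calc ‖σ τ - S.leaf z 0‖ = ‖(σ τ - S.leaf z θ) + (S.leaf z θ - S.leaf z 0)‖ := by
          rw [sub_add_sub_cancel]
      _ ≤ ρ / 2 + ρ / 2 := (norm_add_le _ _).trans (add_le_add h1 h2)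
      _ = ρ := add_halves ρ
  have h1 := hmin _ hmem
  have hτ' := abs_le.1 hτC
  have hC0 : 0 ≤ C := (abs_nonneg _).trans (hC z hz).1
  rcases lt_or_gt_of_ne hne with hlt | hgt
  · have h2 := h.lip (-L') τ (by linarith [hτ'.1])
    have h3 : M.IsoOn σ τ L := isoOn_of_lip (fun s t _ hst _ => h.lip s t hst) (by linarith)
    refine ⟨min (-τ) L, lt_min (by linarith) (by linarith), h3.mono ?_ (min_le_right _ _)⟩
    linarith [min_le_left (-τ) L]
  · have h2 := h.lip τ L (by linarith [hτ'.2])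
    have h3 : M.IsoOn σ (-L') τ := isoOn_of_lip (fun s t _ hst _ => h.lip s t hst) (by linarith)
    refine ⟨min τ L', lt_min (by linarith) (by linarith), h3.mono ?_ (min_le_left _ _)⟩
    linarith [min_le_right τ L']

end TorusMetric.Strip

namespace TorusMetric.Strip

variable {M : TorusMetric} {S : M.Strip} {R Y : Set (ℝ × ℝ)}

theorem Pass.mono {ε ε' : ℝ} {N N' : ℕ} {L L' : ℝ} {σ : ℝ → ℝ × ℝ} (h : S.Pass R ε N L L' σ)
    (hε : ε ≤ ε') (hN : N' ≤ N) : S.Pass R ε' N' L L' σ where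
  lip := h.lip
  mem := h.mem
  E := h.E.trans hε
  hL := h.hL
  hL' := h.hL'
  fwd := by
    obtain ⟨n, hn, y, hy, h1, h2⟩ := h.fwd
    exact ⟨n, hN.trans hn, y, hy, h1, by linarith⟩
  bwd := by
    obtain ⟨n, hn, y, hy, h1, h2⟩ := h.bwd
    exact ⟨n, hN.trans hn, y, hy, h1, by linarith⟩

/-- The translation performed between two consecutive passes. -/
def step (S : M.Strip) (N : ℕ) (i : Bool) : ℤ × ℤ := S.v + (((N + i.toNat : ℕ) : ℤ), 0)

theorem add_lat_step (x : ℝ × ℝ) (N : ℕ) (i : Bool) :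
    x + lat (S.step N i) = x + lat S.v + lat (((N + i.toNat : ℕ) : ℤ), 0) := by
  rw [step, lat_add, add_assoc]

/-- `γ` is a locally minimizing curve which follows the word `w`. -/
structure Orbit (S : M.Strip) (R : Set (ℝ × ℝ)) (C B η : ℝ) (N : ℕ) (w : ℤ → Bool)
    (γ : ℝ → ℝ × ℝ) (t : ℤ → ℝ) (P : ℤ → ℤ × ℤ) : Prop where
  locIso : M.LocIso γ
  t0 : t 0 = 0
  P0 : P 0 = 0
  t_succ : ∀ j, |t (j + 1) - t j - (N + (w j).toNat : ℕ) * S.ℓ| ≤ 2 * C + 1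
  P_succ : ∀ j, P (j + 1) = P j + S.step N (w j)
  mem : γ 0 ∈ R
  shadow : ∀ j, ∃ z ∈ R, S.E z = 0 ∧
    ∀ s, |s| ≤ B → ‖γ (t j + s) - lat (P j) - S.leaf z (S.b z + s)‖ ≤ η

theorem Gap.exists_orbit {ρ C : ℝ} (hY : S.Gap Y) (hG : S.Gate Y R ρ)
    (hC : ∀ x ∈ R, |S.b x| ≤ C ∧ |S.b' x| ≤ C) (B : ℝ) {η : ℝ} (hη : 0 < η) :
    ∃ N₀ : ℕ, ∀ N ≥ N₀, ∀ n ≥ 2, ∀ w : ZMod n → Bool,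
      ∃ γ t P, S.Orbit R C B η N (fun j => w j) γ t P := by
  obtain ⟨y₀, hy₀, hby₀⟩ := hG.nonempty
  have hy₀R : y₀ ∈ R := hG.ball y₀ hy₀ hby₀ y₀ (by simpa using hG.pos.le)
  have hC0 : 0 ≤ C := (abs_nonneg _).trans (hC _ hy₀R).1
  obtain ⟨ε, hε, N₁, hsh⟩ := S.exists_shadow hG.compact hG.op (max B (C + 1))
    (lt_min hη (half_pos hG.pos))
  obtain ⟨N₂, hD⟩ := S.exists_dist_le hG.compact (lt_min (half_pos hε) one_pos)
  obtain ⟨N₃, hN₃⟩ := exists_nat_gt ((3 * C + 1) / S.ℓ)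
  rw [div_lt_iff₀ S.hℓ] at hN₃
  refine ⟨max N₁ (max N₂ N₃), fun N hN n hn w => ?_⟩
  have hN1 : N₁ ≤ N := (le_max_left _ _).trans hN
  have hN2 : N₂ ≤ N := ((le_max_left _ _).trans (le_max_right _ _)).trans hN
  have hN3 : N₃ ≤ N := ((le_max_right _ _).trans (le_max_right _ _)).trans hN
  have hNℓ : 3 * C + 1 ≤ N * S.ℓ :=
    hN₃.le.trans (mul_le_mul_of_nonneg_right (Nat.cast_le.2 hN3) S.hℓ.le)
  obtain ⟨x₀, hx₀, hmin₀⟩ := exists_chain M hG.compact ⟨y₀, hy₀R⟩ hn (fun j => S.step N (w j))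
  obtain ⟨x, hx⟩ : ∃ x : ℤ → ℝ × ℝ, ∀ j, x j = x₀ (j : ZMod n) := ⟨_, fun _ => rfl⟩
  obtain ⟨κ, hκ⟩ : ∃ κ : ℤ → ℤ × ℤ, ∀ j, κ j = S.step N (w j) := ⟨_, fun _ => rfl⟩
  have hxR : ∀ j, x j ∈ R := fun j => hx j ▸ hx₀ _
  have hmin : ∀ j, ∀ y ∈ R,
      M.dist (x (j - 1)) (x j + lat (κ (j - 1))) + M.dist (x j) (x (j + 1) + lat (κ j)) ≤
      M.dist (x (j - 1)) (y + lat (κ (j - 1))) + M.dist y (x (j + 1) + lat (κ j)) := by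
    intro j y hy
    simp only [hx, hκ, Int.cast_add, Int.cast_sub, Int.cast_one]
    exact hmin₀ j y hy
  have hup : ∀ j : ℤ, ∀ a ∈ R, ∀ c ∈ R, M.dist a (c + lat (κ j)) ≤
      S.b' a + S.b c + (N + (w j).toNat : ℕ) * S.ℓ + min (ε / 2) 1 := by
    intro j a ha c hc
    rw [hκ, add_lat_step]
    exact hD _ (hN2.trans (Nat.le_add_right _ _)) a ha c hc
  have hlo : ∀ j : ℤ, ∀ a ∈ R, ∀ c ∈ R, S.b' a + S.b c + (N + (w j).toNat : ℕ) * S.ℓ ≤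
      M.dist a (c + lat (κ j)) := by
    intro j a ha c hc
    rw [hκ, add_lat_step]
    have := le_dist (hG.op a ha).cl.2 (hG.op c hc).cl.1 ((N + (w j).toNat : ℕ) : ℤ)
    rwa [Int.cast_natCast] at this
  have hE : ∀ j, S.E (x j) ≤ ε := by
    intro j
    have h1 := hmin j y₀ hy₀R
    have h2 := hlo (j - 1) _ (hxR (j - 1)) _ (hxR j)
    have h3 := hlo j _ (hxR j) _ (hxR (j + 1))
    have h4 := hup (j - 1) _ (hxR (j - 1)) _ hy₀R
    have h5 := hup j _ hy₀R _ (hxR (j + 1))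
    have h6 := hY.E _ hy₀
    have h7 := min_le_left (ε / 2) 1
    rw [Strip.E] at h6 ⊢
    linarith
  obtain ⟨L, hL⟩ : ∃ L : ℤ → ℝ, ∀ j, L j = M.dist (x j) (x (j + 1) + lat (κ j)) :=
    ⟨_, fun _ => rfl⟩
  have hLlow : ∀ j, C + 1 ≤ L j := by
    intro j
    have h1 := hlo j _ (hxR j) _ (hxR (j + 1))
    rw [← hL] at h1
    have h2 := neg_le_of_abs_le (hC _ (hxR j)).2
    have h3 := neg_le_of_abs_le (hC _ (hxR (j + 1))).1
    have h4 : (N : ℝ) * S.ℓ ≤ (N + (w j).toNat : ℕ) * S.ℓ :=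
      mul_le_mul_of_nonneg_right (Nat.cast_le.2 (Nat.le_add_right _ _)) S.hℓ.le
    linarith
  obtain ⟨t, ht0, ht⟩ := exists_int_sum L
  obtain ⟨P, hP0, hP⟩ := exists_int_sum κ
  have hdist : ∀ j, M.dist (x j + lat (P j)) (x (j + 1) + lat (P (j + 1))) = L j := by
    intro j
    rw [hP, add_comm (P j), lat_add, ← add_assoc, dist_add_lat, hL]
  choose σ hσ0 hσ1 hσi hσl using fun j =>
    M.exists_segment (x j + lat (P j)) (x (j + 1) + lat (P (j + 1)))
  have htd : ∀ j, t (j + 1) - t j = L j := fun j => by rw [ht, add_sub_cancel_left]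
  obtain ⟨γ, hγ, hγl⟩ := exists_concat (M := M) (t := t) (m := 1) (σ := σ) one_pos
    (fun j => by rw [htd]; linarith [hLlow j])
    (fun j => by rw [htd, ← hdist, hσ1, hσ0]) hσl
  have hγt : ∀ j, γ (t j) = x j + lat (P j) := fun j => by
    have := hγ j 0 le_rfl (by rw [htd]; linarith [hLlow j])
    rwa [add_zero, hσ0] at this
  have hbwd : ∀ j, γ (t j + -L (j - 1)) - lat (P j) = x (j - 1) - lat (κ (j - 1)) := by
    intro j
    have h1 := ht (j - 1)
    have h2 := hP (j - 1)
    rw [sub_add_cancel] at h1 h2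
    rw [h1, add_neg_cancel_right, hγt, h2, lat_add]
    abel
  have hfwd : ∀ j, γ (t j + L j) - lat (P j) = x (j + 1) + lat (κ j) := by
    intro j
    rw [← ht, hγt, hP, lat_add]
    abel
  have hpass : ∀ j, S.Pass R ε N (L j) (L (j - 1)) fun s => γ (t j + s) - lat (P j) := by
    intro j
    refine ⟨fun u v huv => ?_, by simpa [hγt] using hxR j, by simpa [hγt] using hE j,
      by linarith [hLlow j], by linarith [hLlow (j - 1)],
      ⟨N + (w j).toNat, Nat.le_add_right _ _, x (j + 1), hxR _, ?_, ?_⟩,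
      ⟨N + (w ((j - 1 : ℤ))).toNat, Nat.le_add_right _ _, x (j - 1), hxR _, ?_, ?_⟩⟩
    · rw [dist_sub_lat]
      exact (hγl _ _ (by linarith)).trans (by linarith)
    · rw [hfwd, hκ, add_lat_step]
    · have h1 := hup j _ (hxR j) _ (hxR (j + 1))
      have h7 := min_le_left (ε / 2) 1
      simp only [add_zero, hγt, add_sub_cancel_right, hL]
      linarith
    · rw [hbwd, hκ, step, lat_add, sub_add_eq_sub_sub]
    · have h1 := hup (j - 1) _ (hxR (j - 1)) _ (hxR j)
      have h7 := min_le_left (ε / 2) 1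
      simp only [add_zero, hγt, add_sub_cancel_right, hL, sub_add_cancel]
      linarith
  have hsha : ∀ j, ∃ z ∈ R, S.E z = 0 ∧ ∀ s, |s| ≤ max B (C + 1) →
      ‖γ (t j + s) - lat (P j) - S.leaf z (S.b z + s)‖ ≤ min η (ρ / 2) := fun j =>
    hsh _ _ _ ((hpass j).mono le_rfl hN1)
  refine ⟨γ, t, P, ?_, ht0, hP0, fun j => ?_, fun j => by rw [hP, hκ], ?_, fun j => ?_⟩
  · intro u
    obtain ⟨j, hj1, hj2⟩ := exists_int_floor (t := t) (m := 1) one_pos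
      (fun j => by rw [htd]; linarith [hLlow j]) u
    rcases hj1.eq_or_lt with rfl | hlt
    · obtain ⟨z, hz, hEz, hs⟩ := hsha j
      obtain ⟨e, he, hiso⟩ := (hpass j).exists_isoOn hY hG hC (hLlow j) (hLlow (j - 1))
        (fun y hy => by
          have h1 := hmin j y hy
          rw [← hL] at h1
          have h2 := hL (j - 1)
          rw [sub_add_cancel] at h2
          rw [← h2] at h1
          rw [hfwd, hbwd, ← dist_add_lat _ y (κ (j - 1)), sub_add_cancel]
          exact h1) hz hEz
        (fun s hs' => (hs s (hs'.trans (le_max_right _ _))).trans (min_le_right _ _))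
      refine ⟨e, he, fun a b ha hab hb => ?_⟩
      have := hiso (a - t j) (b - t j) (by linarith) (by linarith) (by linarith)
      simp only [add_sub_cancel, dist_sub_lat] at this
      linarith
    · have h1 : M.IsoOn γ (t j) (t (j + 1)) :=
        isoOn_of_lip (fun s t _ hst _ => hγl s t hst) (by rw [hγt, hγt, hdist, htd])
      refine ⟨min (u - t j) (t (j + 1) - u), lt_min (by linarith) (by linarith),
        h1.mono ?_ ?_⟩
      · linarith [min_le_left (u - t j) (t (j + 1) - u)]
      · linarith [min_le_right (u - t j) (t (j + 1) - u)]
  · have h1 := hup j _ (hxR j) _ (hxR (j + 1))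
    have h2 := hlo j _ (hxR j) _ (hxR (j + 1))
    have h7 := min_le_right (ε / 2) 1
    have h8 := abs_le.1 (hC _ (hxR j)).2
    have h9 := abs_le.1 (hC _ (hxR (j + 1))).1
    rw [htd, hL, abs_le]
    constructor <;> linarith [h8.1, h8.2, h9.1, h9.2]
  · have := hγt 0
    rw [ht0, hP0, lat_zero, add_zero] at this
    exact this ▸ hxR 0
  · obtain ⟨z, hz, hEz, hs⟩ := hsha j
    exact ⟨z, hz, hEz, fun s hs' => (hs s (hs'.trans (le_max_left _ _))).trans (min_le_left _ _)⟩

end TorusMetric.Strip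

namespace TorusMetric.Strip

variable {M : TorusMetric} {S : M.Strip} {R Y : Set (ℝ × ℝ)}

theorem Gap.exists_separation {ρ : ℝ} (hY : S.Gap Y) (hG : S.Gate Y R ρ) :
    ∃ δ > 0, ∀ z ∈ R, S.E z = 0 → ∀ y ∈ Y,
      δ < ‖y - (z + lat (1, 0))‖ ∧ δ < ‖y + lat (1, 0) - z‖ := by
  have hK : IsCompact (R ∩ {z | S.E z = 0}) :=
    hG.compact.inter_right (isClosed_eq S.E_continuous continuous_const)
  obtain ⟨δ₁, h₁, hs₁⟩ := (hK.image (continuous_add_const (lat (1, 0)))).exists_cthickening_subset_open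
    hY.closed.isOpen_compl (by
      rintro _ ⟨z, hz, rfl⟩
      exact hY.disjoint z (hG.mem z hz.1 hz.2))
  obtain ⟨δ₂, h₂, hs₂⟩ := hK.exists_cthickening_subset_open
    (hY.closed.isOpen_compl.preimage (continuous_id.sub continuous_const)) (by
      intro z hz h
      exact hY.disjoint (z - lat (1, 0)) h (by rw [sub_add_cancel]; exact hG.mem z hz.1 hz.2))
  refine ⟨min δ₁ δ₂, lt_min h₁ h₂, fun z hz hE y hy => ⟨?_, ?_⟩⟩
  · by_contra! h
    exact hs₁ (Metric.closedBall_subset_cthickening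
      (E := (fun x => x + lat (1, 0)) '' (R ∩ {z | S.E z = 0})) ⟨z, ⟨hz, hE⟩, rfl⟩ δ₁
      (mem_closedBall_iff_norm.2 (h.trans (min_le_left _ _)))) hy
  · by_contra! h
    refine hs₂ (Metric.closedBall_subset_cthickening
      (E := (R ∩ {z | S.E z = 0})) ⟨hz, hE⟩ δ₂
      (mem_closedBall_iff_norm.2 (h.trans (min_le_right _ _)))) ?_
    simpa using hy

theorem Lip.abs_sub_le {f : ℝ × ℝ → ℝ} (hf : M.Lip f) (x y : ℝ × ℝ) :
    |f x - f y| ≤ M.cC * ‖x - y‖ := by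
  have h1 := (hf x y).trans (add_le_add_right (dist_le x y) _)
  have h2 := (hf y x).trans (add_le_add_right (dist_le y x) _)
  rw [norm_sub_rev] at h1
  rw [abs_le]
  constructor <;> linarith

theorem Orbit.times {C B η : ℝ} {N : ℕ} {w : ℤ → Bool} {γ : ℝ → ℝ × ℝ} {t : ℤ → ℝ}
    {P : ℤ → ℤ × ℤ} (h : S.Orbit R C B η N w γ t P) (hN : 2 * C + 1 ≤ N * S.ℓ) (j : ℕ) :
    0 ≤ t j ∧ t j ≤ j * ((N + 1) * S.ℓ + 2 * C + 1) := by
  induction j with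
  | zero => simp [h.t0]
  | succ j ih =>
    have h1 := abs_le.1 (h.t_succ j)
    have h2 : (0 : ℝ) ≤ (w j).toNat := Nat.cast_nonneg _
    have h3 : ((w j).toNat : ℝ) ≤ 1 := by exact_mod_cast Bool.toNat_le _
    push_cast at h1 ⊢
    have h4 := mul_nonneg h2 S.hℓ.le
    have h5 := mul_le_mul_of_nonneg_right h3 S.hℓ.le
    constructor <;> nlinarith [h1.1, h1.2]

theorem Gap.orbit_separated {ρ C δ η η₀ : ℝ} (hY : S.Gap Y) (hG : S.Gate Y R ρ)
    (hC : ∀ x ∈ R, |S.b x| ≤ C ∧ |S.b' x| ≤ C)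
    (hδ : ∀ z ∈ R, S.E z = 0 → ∀ y ∈ Y,
      δ < ‖y - (z + lat (1, 0))‖ ∧ δ < ‖y + lat (1, 0) - z‖)
    (h1 : 2 * η + η₀ ≤ δ) (h2 : M.cC * (2 * η + η₀) ≤ 1)
    {N : ℕ} (hN : 2 * C + 1 ≤ N * S.ℓ) {w w' : ℤ → Bool} {γ γ' : ℝ → ℝ × ℝ} {t t' : ℤ → ℝ}
    {P P' : ℤ → ℤ × ℤ} (h : S.Orbit R C (6 * C + 3 + S.ℓ) η N w γ t P)
    (h' : S.Orbit R C (6 * C + 3 + S.ℓ) η N w' γ' t' P') {n : ℕ}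
    (hcl : ∀ u ∈ Icc 0 (n * ((N + 1) * S.ℓ + 2 * C + 1)), ‖γ u - γ' u‖ ≤ η₀)
    {i : ℕ} (hi : i < n) : w i = w' i := by
  obtain ⟨y₀, hy₀, hby₀⟩ := hG.nonempty
  have hC0 : 0 ≤ C :=
    (abs_nonneg _).trans (hC _ (hG.ball y₀ hy₀ hby₀ y₀ (by simpa using hG.pos.le))).1
  have hℓ := S.hℓ
  have key : ∀ j : ℕ, |t j - t' j| ≤ 2 * C + 1 → P j = P' j → j < n →
      w j = w' j ∧ |t (j + 1 : ℕ) - t' (j + 1 : ℕ)| ≤ 2 * C + 1 ∧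
        P (j + 1 : ℕ) = P' (j + 1 : ℕ) := by
    intro j hj1 hj2 hj
    obtain ⟨s, hs⟩ : ∃ s, s = t (j + 1 : ℕ) - t' (j + 1 : ℕ) := ⟨_, rfl⟩
    have hw : ∀ a : Bool, (0 : ℝ) ≤ a.toNat * S.ℓ ∧ (a.toNat : ℝ) * S.ℓ ≤ S.ℓ := by
      intro a; cases a <;> simp [hℓ.le]
    have hsB : |s| ≤ 6 * C + 3 + S.ℓ := by
      have e1 := abs_le.1 (h.t_succ j)
      have e2 := abs_le.1 (h'.t_succ j)
      have e3 := abs_le.1 hj1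
      push_cast at e1 e2 hs
      rw [abs_le, hs]
      constructor <;> nlinarith [hw (w j), hw (w' j)]
    obtain ⟨z, hz, hE, hsh⟩ := h.shadow (j + 1 : ℕ)
    obtain ⟨z', hz', hE', hsh'⟩ := h'.shadow (j + 1 : ℕ)
    have a1 := hsh 0 (by rw [abs_zero]; positivity)
    have a2 := hsh' s hsB
    have ht := h.times hN (j + 1)
    have a3 := hcl (t (j + 1 : ℕ)) ⟨ht.1, ht.2.trans (mul_le_mul_of_nonneg_right
      (Nat.cast_le.2 hj) (by positivity))⟩
    rw [add_zero, add_zero, leaf_self hE] at a1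
    rw [hs, add_sub_cancel, ← hs] at a2
    obtain ⟨y, hy⟩ : ∃ y, y = S.leaf z' (S.b z' + s) := ⟨_, rfl⟩
    rw [← hy] at a2
    have hyY : y ∈ Y := hy ▸ hY.leaf z' (hG.mem z' hz' hE') _
    have hby : S.b y = S.b z' + s := hy ▸ (leaf_spec hE').hb _
    have hPP : lat (P (j + 1 : ℕ)) - lat (P' (j + 1 : ℕ)) =
        lat (((w j).toNat : ℤ) - ((w' j).toNat : ℤ), 0) := by
      rw [Nat.cast_succ, h.P_succ, h'.P_succ, hj2, ← lat_sub]
      congr 1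
      ext <;> simp [step]
    have hclose : ‖y - (z + lat (((w j).toNat : ℤ) - ((w' j).toNat : ℤ), 0))‖ ≤ 2 * η + η₀ := by
      rw [← hPP]
      calc ‖y - (z + (lat (P (j + 1 : ℕ)) - lat (P' (j + 1 : ℕ))))‖
          = ‖(γ (t (j + 1 : ℕ)) - lat (P (j + 1 : ℕ)) - z)
            - (γ' (t (j + 1 : ℕ)) - lat (P' (j + 1 : ℕ)) - y)
            - (γ (t (j + 1 : ℕ)) - γ' (t (j + 1 : ℕ)))‖ := by
              congr 1
              abel
        _ ≤ η + η + η₀ := (norm_sub_le _ _).trans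
            (add_le_add ((norm_sub_le _ _).trans (add_le_add a1 a2)) a3)
        _ = _ := by ring
    obtain ⟨d1, d2⟩ := hδ z hz hE y hyY
    have hww : w j = w' j := by
      rcases hwj : w j with _ | _ <;> rcases hwj' : w' j with _ | _
      · rfl
      · exfalso
        simp only [hwj, hwj', Bool.toNat_true, Bool.toNat_false, Nat.cast_zero, Nat.cast_one,
          zero_sub] at hclose
        have e : y - (z + lat (-1, 0)) = y + lat (1, 0) - z := by
          rw [show ((-1 : ℤ), (0 : ℤ)) = -(1, 0) by simp, lat_neg]
          abel
        rw [e] at hclose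
        linarith
      · exfalso
        simp only [hwj, hwj', Bool.toNat_true, Bool.toNat_false, Nat.cast_zero, Nat.cast_one,
          sub_zero] at hclose
        linarith
      · rfl
    refine ⟨hww, ?_, ?_⟩
    · rw [hww, sub_self, show ((0 : ℤ), (0 : ℤ)) = 0 from rfl, lat_zero, add_zero] at hclose
      have e1 := (Lip.abs_sub_le S.b_lip y z).trans
        ((mul_le_mul_of_nonneg_left hclose M.cC_pos.le).trans h2)
      rw [hby, abs_le] at e1
      have e2 := abs_le.1 (hC z hz).1
      have e3 := abs_le.1 (hC z' hz').1
      rw [← hs, abs_le]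
      constructor <;> linarith [e1.1, e1.2, e2.1, e2.2, e3.1, e3.2]
    · rw [Nat.cast_succ, h.P_succ, h'.P_succ, hj2, hww]
  have main : ∀ j : ℕ, j ≤ n → |t j - t' j| ≤ 2 * C + 1 ∧ P j = P' j := by
    intro j
    induction j with
    | zero =>
      intro _
      simp only [Nat.cast_zero, h.t0, h'.t0, h.P0, h'.P0, sub_self, abs_zero, and_true]
      linarith
    | succ j ih =>
      intro hj
      obtain ⟨e1, e2⟩ := ih (by omega)
      exact (key j e1 e2 (by omega)).2
  obtain ⟨e1, e2⟩ := main i hi.le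
  exact (key i e1 e2 hi).1

theorem Gap.exists_horseshoe (hY : S.Gap Y) : ∃ η₀ : ℝ, 0 < η₀ ∧ ∃ T : ℝ, 0 < T ∧ ∃ r : ℝ, ∀ n ≥ 2,
    ∃ G : (ZMod n → Bool) → ℝ → ℝ × ℝ, (∀ w, M.LocIso (G w)) ∧ (∀ w, ‖G w 0‖ ≤ r) ∧
      ∀ w w', (∀ u ∈ Icc 0 (n * T), ‖G w u - G w' u‖ ≤ η₀) → w = w' := by
  obtain ⟨R, ρ, hG⟩ := hY.exists_gate
  obtain ⟨C, hC0, hC⟩ := S.exists_bound hG.compact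
  obtain ⟨δ, hδ, hsep⟩ := hY.exists_separation hG
  obtain ⟨r, hr⟩ := hG.compact.isBounded.exists_norm_le
  have hcC := M.cC_pos
  obtain ⟨η, hη, h1, h2⟩ : ∃ η > 0, 2 * η + η ≤ δ ∧ M.cC * (2 * η + η) ≤ 1 := by
    refine ⟨min (δ / 3) (1 / (3 * M.cC)), by positivity, ?_, ?_⟩
    · linarith [min_le_left (δ / 3) (1 / (3 * M.cC))]
    · have := mul_le_mul_of_nonneg_left (min_le_right (δ / 3) (1 / (3 * M.cC))) hcC.le
      have e : M.cC * (1 / (3 * M.cC)) = 1 / 3 := by field_simp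
      linarith
  obtain ⟨N₀, hN₀⟩ := hY.exists_orbit hG hC (6 * C + 3 + S.ℓ) hη
  obtain ⟨N₁, hN₁⟩ := exists_nat_gt ((2 * C + 1) / S.ℓ)
  rw [div_lt_iff₀ S.hℓ] at hN₁
  have hℓ := S.hℓ
  have hN : 2 * C + 1 ≤ ((max N₀ N₁ : ℕ) : ℝ) * S.ℓ :=
    hN₁.le.trans (mul_le_mul_of_nonneg_right (Nat.cast_le.2 (le_max_right _ _)) hℓ.le)
  refine ⟨η, hη, ((max N₀ N₁ : ℕ) + 1) * S.ℓ + 2 * C + 1, by positivity, r, fun n hn => ?_⟩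
  choose G t P hO using hN₀ _ (le_max_left N₀ N₁) n hn
  refine ⟨G, fun w => (hO w).locIso, fun w => hr _ (hO w).mem, fun w w' hcl => ?_⟩
  have : NeZero n := ⟨by omega⟩
  funext i
  have := hY.orbit_separated hG hC hsep h1 h2 hN (hO w) (hO w') hcl (i.val_lt)
  simpa using this

end TorusMetric.Strip

namespace TorusMetric

variable {M : TorusMetric}

theorem norm_le_norm2 (p : ℝ × ℝ) : ‖p‖ ≤ norm2 p := by
  rw [Prod.norm_def, norm2]
  exact max_le (Real.abs_le_sqrt (by nlinarith [sq_nonneg p.2]))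
    (Real.abs_le_sqrt (by nlinarith [sq_nonneg p.1]))

theorem norm2_nonneg (p : ℝ × ℝ) : 0 ≤ norm2 p := Real.sqrt_nonneg _

theorem one_le_norm_lat {k : ℤ × ℤ} (hk : k ≠ 0) : 1 ≤ ‖lat k‖ := by
  rw [Prod.norm_def, le_max_iff]
  by_contra! h
  simp only [lat, Real.norm_eq_abs] at h
  obtain ⟨h1, h2⟩ := h
  norm_cast at h1 h2
  exact hk (Prod.ext (Int.abs_lt_one_iff.1 h1) (Int.abs_lt_one_iff.1 h2))

theorem exists_lat_of_phaseDist_le {p q : (ℝ × ℝ) × (ℝ × ℝ)} {ε : ℝ} (hε : 0 < ε)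
    (h : phaseDist p q ≤ ε) : ∃ k, ‖p.1 - q.1 - lat k‖ ≤ 2 * ε := by
  obtain ⟨_, ⟨k, rfl⟩, hk⟩ := exists_lt_of_csInf_lt
    (s := {r : ℝ | ∃ k : ℤ × ℤ, r = norm2 (p.1 - (q.1 + lat k)) + norm2 (p.2 - q.2)})
    ⟨_, 0, rfl⟩ (h.trans_lt (by linarith : ε < 2 * ε))
  refine ⟨k, ?_⟩
  rw [sub_sub]
  linarith [norm_le_norm2 (p.1 - (q.1 + lat k)), norm2_nonneg (p.2 - q.2)]

theorem exists_const_lat {γ γ' : ℝ → ℝ × ℝ} (hγ : Continuous γ) (hγ' : Continuous γ') {ε T : ℝ}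
    (hε : 0 < ε) (hε' : 2 * ε < 1 / 2) (hT : 0 ≤ T)
    (h : ∀ t ∈ Icc 0 T, phaseDist (γ t, deriv γ t) (γ' t, deriv γ' t) ≤ ε) :
    ∃ k, ∀ t ∈ Icc 0 T, ‖γ t - γ' t - lat k‖ ≤ 2 * ε := by
  obtain ⟨k, hk⟩ := exists_lat_of_phaseDist_le hε (h 0 ⟨le_rfl, hT⟩)
  refine ⟨k, fun t ht => ?_⟩
  have hfar : ∀ s ∈ Icc 0 T, ‖γ s - γ' s - lat k‖ ≤ 2 * ε ∨ 1 / 2 < ‖γ s - γ' s - lat k‖ := by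
    intro s hs
    obtain ⟨l, hl⟩ := exists_lat_of_phaseDist_le hε (h s hs)
    rcases eq_or_ne l k with rfl | hne
    · exact Or.inl hl
    · right
      have h1 := one_le_norm_lat (sub_ne_zero.2 hne)
      have h2 := norm_sub_le (γ s - γ' s - lat k) (γ s - γ' s - lat l)
      rw [lat_sub] at h1
      rw [show γ s - γ' s - lat k - (γ s - γ' s - lat l) = lat l - lat k by abel] at h2
      dsimp only at hl
      linarith
  rcases hfar t ht with h1 | h1
  · exact h1
  · exfalso
    obtain ⟨s, hs, hs'⟩ := intermediate_value_Icc ht.1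
      (f := fun s => ‖γ s - γ' s - lat k‖)
      ((hγ.sub hγ').sub continuous_const).norm.continuousOn
      (show (1 / 2 : ℝ) ∈ _ from ⟨hk.trans hε'.le, h1.le⟩)
    rcases hfar s ⟨hs.1, hs.2.trans ht.2⟩ with h2 | h2
    · dsimp only at hs'; linarith
    · dsimp only at hs'; linarith

theorem log_le_elog {a : ℕ} (ha : 0 < a) {x : ℝ≥0∞} (h : (a : ℝ≥0∞) ≤ x) :
    ((Real.log a : ℝ) : EReal) ≤ elog x := by
  unfold elog
  have ha' : (0 : ℝ≥0∞) < a := by exact_mod_cast ha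
  rw [if_neg (ha'.trans_le h).ne']
  split_ifs with hx
  · exact le_top
  · rw [EReal.coe_le_coe_iff]
    refine Real.log_le_log (by exact_mod_cast ha) ?_
    have := ENNReal.toReal_mono hx h
    simpa using this

theorem exists_separated {W : Type*} [Fintype W] {G : W → ℝ → ℝ × ℝ} {η r ε T : ℝ}
    (hG : ∀ w, M.LocIso (G w)) (hr : ∀ w, ‖G w 0‖ ≤ r) (hT : 0 ≤ T)
    (hsep : ∀ w w', (∀ u ∈ Icc 0 T, ‖G w u - G w' u‖ ≤ η) → w = w')
    (hε : 0 < ε) (hε' : 2 * ε < 1 / 2) (hη : 4 * ε ≤ η) {K : ℕ} (hK : 1 + 2 * r ≤ K) :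
    ∃ a : ℕ, (a : ℝ≥0∞) ≤ sepCount M ε T ∧ Fintype.card W ≤ a * (2 * K + 1) ^ 2 := by
  classical
  obtain ⟨A, hA, hmax⟩ := (Finset.univ.filter fun A : Finset W => ∀ a ∈ A, ∀ b ∈ A, a ≠ b →
    ∃ t ∈ Icc 0 T, ε < phaseDist (G a t, deriv (G a) t) (G b t, deriv (G b) t)).exists_max_image
      Finset.card ⟨∅, by simp⟩
  simp only [Finset.mem_filter, Finset.mem_univ, true_and] at hA hmax
  have hinj : Function.Injective G := fun w w' hw => hsep w w' fun u _ => by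
    have h0 : 0 ≤ η := by linarith
    simpa [hw] using h0
  have hcover : ∀ w, ∃ a ∈ A, ∃ k : ℤ × ℤ, ∀ t ∈ Icc 0 T, ‖G w t - G a t - lat k‖ ≤ 2 * ε := by
    intro w
    by_cases hw : w ∈ A
    · refine ⟨w, hw, 0, fun t _ => ?_⟩
      simp [lat_zero, hε.le]
    · have h1 : ¬ ∀ a ∈ insert w A, ∀ b ∈ insert w A, a ≠ b →
          ∃ t ∈ Icc 0 T, ε < phaseDist (G a t, deriv (G a) t) (G b t, deriv (G b) t) := by
        intro h2
        have := hmax _ h2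
        rw [Finset.card_insert_of_notMem hw] at this
        omega
      push Not at h1
      obtain ⟨a, ha, b, hb, hab, h1⟩ := h1
      rw [Finset.mem_insert] at ha hb
      obtain ⟨k, hk⟩ := exists_const_lat (hG a).continuous (hG b).continuous hε hε' hT h1
      rcases ha with rfl | ha
      · rcases hb with rfl | hb
        · exact absurd rfl hab
        · exact ⟨b, hb, k, hk⟩
      · rcases hb with rfl | hb
        · refine ⟨a, ha, -k, fun t ht => ?_⟩
          rw [lat_neg, ← norm_neg, show -(G b t - G a t - -lat k) = G a t - G b t - lat k by abel]
          exact hk t ht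
        · obtain ⟨t, ht, h2⟩ := hA a ha b hb hab
          exact absurd (h1 t ht) (not_le.2 h2)
  choose f hf k hk using hcover
  refine ⟨A.card, ?_, ?_⟩
  · refine le_iSup₂_of_le (A.image G) ⟨fun c hc => ?_, fun c hc c' hc' hne => ?_⟩ ?_
    · obtain ⟨a, -, rfl⟩ := Finset.mem_image.1 hc
      exact (hG a).isGeodesic
    · obtain ⟨a, ha, rfl⟩ := Finset.mem_image.1 hc
      obtain ⟨b, hb, rfl⟩ := Finset.mem_image.1 hc'
      exact hA a ha b hb fun h => hne (h ▸ rfl)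
    · rw [Finset.card_image_of_injective _ hinj]
  · have hkK : ∀ w, k w ∈ Finset.Icc (-(K : ℤ)) K ×ˢ Finset.Icc (-(K : ℤ)) K := by
      intro w
      have h1 := hk w 0 ⟨le_rfl, hT⟩
      have h2 : ‖lat (k w)‖ ≤ K := by
        calc ‖lat (k w)‖ = ‖G w 0 - G (f w) 0 - (G w 0 - G (f w) 0 - lat (k w))‖ := by
              congr 1; abel
          _ ≤ (r + r) + 2 * ε := (norm_sub_le _ _).trans
              (add_le_add ((norm_sub_le _ _).trans (add_le_add (hr _) (hr _))) h1)
          _ ≤ K := by linarith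
      rw [Prod.norm_def, max_le_iff] at h2
      simp only [lat, Real.norm_eq_abs] at h2
      obtain ⟨h3, h4⟩ := h2
      have h3' : |(k w).1| ≤ (K : ℤ) := by exact_mod_cast h3
      have h4' : |(k w).2| ≤ (K : ℤ) := by exact_mod_cast h4
      rw [Finset.mem_product, Finset.mem_Icc, Finset.mem_Icc]
      exact ⟨abs_le.1 h3', abs_le.1 h4'⟩
    have h1 : Fintype.card W ≤
        (A ×ˢ (Finset.Icc (-(K : ℤ)) K ×ˢ Finset.Icc (-(K : ℤ)) K)).card := by
      refine Finset.card_le_card_of_injOn (s := Finset.univ) (fun w => (f w, k w))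
        (fun w _ => Finset.mem_product.2 ⟨hf w, hkK w⟩) fun w _ w' _ hww => ?_
      simp only [Prod.mk.injEq] at hww
      refine hsep w w' fun u hu => ?_
      have e1 := hk w u hu
      have e2 := hk w' u hu
      rw [← hww.1, ← hww.2] at e2
      calc ‖G w u - G w' u‖ = ‖(G w u - G (f w) u - lat (k w)) -
            (G w' u - G (f w) u - lat (k w))‖ := by congr 1; abel
        _ ≤ 2 * ε + 2 * ε := (norm_sub_le _ _).trans (add_le_add e1 e2)
        _ ≤ η := by linarith
    rw [Finset.card_product, Finset.card_product, Int.card_Icc] at h1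
    rw [sq]
    convert h1 using 3 <;> omega

theorem topEnt_ne_zero_of_horseshoe {η T r : ℝ} (hη : 0 < η) (hT : 0 < T)
    (h : ∀ n ≥ 2, ∃ G : (ZMod n → Bool) → ℝ → ℝ × ℝ, (∀ w, M.LocIso (G w)) ∧
      (∀ w, ‖G w 0‖ ≤ r) ∧
      ∀ w w', (∀ u ∈ Icc 0 (n * T), ‖G w u - G w' u‖ ≤ η) → w = w') : topEnt M ≠ 0 := by
  obtain ⟨ε, hε, hε1, hε2⟩ : ∃ ε > 0, 2 * ε < 1 / 2 ∧ 4 * ε ≤ η :=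
    ⟨min (1 / 8) (η / 4), by positivity, by linarith [min_le_left (1 / 8) (η / 4)],
      by linarith [min_le_right (1 / 8) (η / 4)]⟩
  obtain ⟨K, hK⟩ := exists_nat_gt (1 + 2 * r)
  have hl2 : 0 < Real.log 2 := Real.log_pos one_lt_two
  obtain ⟨q, hq⟩ : ∃ q : ℕ, q = (2 * K + 1) ^ 2 := ⟨_, rfl⟩
  have hq0 : 0 < q := hq ▸ by positivity
  have hbound : ∀ n : ℕ, 2 ≤ n → 2 * Real.log q ≤ n * Real.log 2 →
      ((Real.log 2 / (2 * T) : ℝ) : EReal) ≤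
        ((((n : ℝ) * T)⁻¹ : ℝ) : EReal) * elog (sepCount M ε (n * T)) := by
    intro n hn hnq
    obtain ⟨G, h1, h2, h3⟩ := h n hn
    have : NeZero n := ⟨by omega⟩
    have hn0 : (0 : ℝ) < n := Nat.cast_pos.2 (by omega)
    obtain ⟨a, ha, hcard⟩ := exists_separated h1 h2 (by positivity) h3 hε hε1 hε2 hK.le
    rw [← hq] at hcard
    simp only [Fintype.card_fun, Fintype.card_bool, ZMod.card] at hcard
    have ha0 : 0 < a := by
      rcases Nat.eq_zero_or_pos a with rfl | h
      · rw [zero_mul] at hcard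
        exact absurd hcard (not_le.2 (by positivity))
      · exact h
    have hlog : n * Real.log 2 ≤ Real.log a + Real.log q := by
      rw [← Real.log_mul (by positivity) (by positivity), ← Real.log_pow]
      exact Real.log_le_log (by positivity) (by exact_mod_cast hcard)
    refine le_trans ?_ (mul_le_mul_of_nonneg_left (log_le_elog ha0 ha)
      (by exact_mod_cast (by positivity : 0 ≤ ((n : ℝ) * T)⁻¹)))
    rw [← EReal.coe_mul, EReal.coe_le_coe_iff, div_le_iff₀ (by positivity), inv_mul_eq_div,
      div_mul_eq_mul_div, le_div_iff₀ (by positivity)]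
    nlinarith
  have hlim : ((Real.log 2 / (2 * T) : ℝ) : EReal) ≤ limsup (fun T : ℝ =>
      ((T⁻¹ : ℝ) : EReal) * elog (sepCount M ε T)) atTop := by
    refine le_limsup_of_frequently_le (frequently_atTop.2 fun x => ?_)
    obtain ⟨n₁, h₁⟩ := exists_nat_gt (x / T)
    obtain ⟨n₂, h₂⟩ := exists_nat_gt (2 * Real.log q / Real.log 2)
    rw [div_lt_iff₀ hT] at h₁
    rw [div_lt_iff₀ hl2] at h₂
    refine ⟨((n₁ + n₂ + 2 : ℕ) : ℝ) * T, ?_, hbound _ (by omega) ?_⟩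
    · push_cast
      nlinarith [mul_nonneg (Nat.cast_nonneg (α := ℝ) n₂) hT.le]
    · push_cast
      nlinarith [mul_nonneg (Nat.cast_nonneg (α := ℝ) n₁) hl2.le]
  intro h0
  have h1 : ((Real.log 2 / (2 * T) : ℝ) : EReal) ≤ topEnt M := hlim.trans (le_iSup₂_of_le ε hε le_rfl)
  rw [h0] at h1
  have : Real.log 2 / (2 * T) ≤ 0 := by exact_mod_cast h1
  exact absurd this (not_le.2 (by positivity))

end TorusMetric

namespace TorusMetric
variable {M : TorusMetric}

theorem LocIso.add_lat {γ : ℝ → ℝ × ℝ} (h : M.LocIso γ) (k : ℤ × ℤ) :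
    M.LocIso fun t => γ t + lat k := fun t => by
  obtain ⟨ε, hε, hi⟩ := h t
  exact ⟨ε, hε, fun a ha b hb => by simpa only [dist_add_lat] using hi a ha b hb⟩

/-- A self-intersecting geodesic forces positive entropy. -/
theorem topEnt_ne_zero_of_loop {c : ℝ → ℝ × ℝ} (hc : M.LocIso c) {t₁ t₂ : ℝ} (ht : t₁ < t₂)
    (hl : c t₁ = c t₂) : topEnt M ≠ 0 := by
  obtain ⟨o, B, hS⟩ := M.exists_strip
  obtain ⟨C, hC⟩ := isCompact_Icc.exists_bound_of_continuousOn (f := fun t => (c t).2)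
    (hc.continuous.snd.continuousOn (s := Icc t₁ t₂))
  obtain ⟨j, hj⟩ := exists_int_gt (o + B + C)
  obtain ⟨m, hm⟩ := exists_int_gt (max (C + j - o + B) (2 * B + 1))
  obtain ⟨S, rfl, rfl, rfl⟩ := hS m ((le_max_right _ _).trans_lt hm)
  have hm1 := (le_max_left _ _).trans_lt hm
  have hb : ∀ t ∈ Icc t₁ t₂, (S.α 0).2 + S.Bd < (c t + lat (0, j)).2 ∧
      (c t + lat (0, j)).2 < (S.α 0).2 + S.m - S.Bd := fun t h => by
    have := abs_le.1 (hC t h)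
    simp only [lat, Prod.snd_add]
    constructor <;> linarith
  by_cases hE : ∀ t ∈ Icc t₁ t₂, S.E (c t + lat (0, j)) = 0
  · exact (Strip.no_loop_of_E_zero (LocIso.add_lat hc (0, j)) ht (by rw [hl]) hE
      fun t h => (S.op_of_lt (hb t h).1 (hb t h).2).cl).elim
  · push Not at hE
    obtain ⟨t, h, hne⟩ := hE
    obtain ⟨Y, hY⟩ := Strip.exists_gap ((S.E_nonneg _).lt_of_ne' hne) (hb t h).1 (hb t h).2
    obtain ⟨η, hη, T, hT, r, hr⟩ := hY.exists_horseshoe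
    exact topEnt_ne_zero_of_horseshoe hη hT hr

end TorusMetric

/-- If the geodesic flow of the Riemannian metric `g` on `T²` has zero topological entropy,
then no lift `c : ℝ → ℝ²` of a geodesic to the universal covering has a self-intersection,
i.e. every lifted geodesic is injective. -/
theorem stmt5 (M : TorusMetric) (h : topEnt M = 0)
    (c : ℝ → ℝ × ℝ) (hc : M.IsGeodesic c) :
    Function.Injective c := by
  intro t₁ t₂ hl
  by_contra hne
  rcases lt_or_gt_of_ne hne with ht | ht
  · exact TorusMetric.topEnt_ne_zero_of_loop hc.locIso ht hl h
  · exact TorusMetric.topEnt_ne_zero_of_loop hc.locIso ht hl.symm h
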